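/- Boundary Harnack principle in C^{1,1/2} domains (Theorem 1.1): Let K>0. There exists a constant C>0 depending only on n, λ, Λ and K such that the following holds. Assume [g]_{C^{1,1/2}} ≤ K, and let u and v be positive solutions of u_t = Lu and v_t = Lv respectively in 𝒞₁, with u vanishing continuously on Γ. Then for every (x,t) ∈ 𝒞_{1/2} one has u(x,t)/v(x,t) ≤ C · u(Ē)/v(E̲). -/

import Mathlib

noncomputable section
open scoped BigOperators
open Classical

abbrev Spc (m : ℕ) := EuclideanSpace ℝ (Fin (m + 1))
abbrev Spc' (m : ℕ) := EuclideanSpace ℝ (Fin m)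

/-- The horizontal coordinates `x' ∈ ℝ^{n-1}` of a point `x ∈ ℝⁿ`. -/
def xprime {m : ℕ} (x : Spc m) : Spc' m :=
  (WithLp.equiv 2 _).symm fun i => x i.castSucc

/-- The last (vertical) coordinate `x_n` of a point `x ∈ ℝⁿ`. -/
def xlast {m : ℕ} (x : Spc m) : ℝ := x (Fin.last m)

/-- Build a point of `ℝⁿ` from `x' ∈ ℝ^{n-1}` and the vertical coordinate. -/
def mkPt {m : ℕ} (x' : Spc' m) (xn : ℝ) : Spc m :=
  (WithLp.equiv 2 _).symm fun i => if h : i = Fin.last m then xn else x' (i.castPred h)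

/-- The `i`-th standard basis vector. -/
def eVec (m : ℕ) (i : Fin (m + 1)) : Spc m := EuclideanSpace.single i 1

/-- The entry `∂²u/∂xᵢ∂xⱼ` of the spatial Hessian of `u(x,t)` at `p = (x,t)`. -/
def sHess {m : ℕ} (u : Spc m × ℝ → ℝ) (p : Spc m × ℝ) (i j : Fin (m + 1)) : ℝ :=
  fderiv ℝ (fun y => fderiv ℝ (fun z => u (z, p.2)) y (eVec m j)) p.1 (eVec m i)

/-- The operator `Lu = tr(A(x) D²ₓu)` at the point `p = (x,t)`. -/
def Lop {m : ℕ} (A : Spc m → Matrix (Fin (m + 1)) (Fin (m + 1)) ℝ)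
    (u : Spc m × ℝ → ℝ) (p : Spc m × ℝ) : ℝ :=
  ∑ i, ∑ j, A p.1 i j * sHess u p j i

/-- Uniform ellipticity with symmetric coefficients: `λ|ξ|² ≤ ξ·A(x)ξ ≤ Λ|ξ|²`. -/
def IsElliptic {m : ℕ} (lam Lam : ℝ)
    (A : Spc m → Matrix (Fin (m + 1)) (Fin (m + 1)) ℝ) : Prop :=
  (∀ x, (A x).IsSymm) ∧
  ∀ (x ξ : Spc m),
    lam * ‖ξ‖ ^ 2 ≤ ∑ i, ∑ j, ξ i * A x i j * ξ j ∧
      ∑ i, ∑ j, ξ i * A x i j * ξ j ≤ Lam * ‖ξ‖ ^ 2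

/-- `u` is (pointwise) a solution of `u_t = Lu` on `Ω`: twice continuously
differentiable in `x`, differentiable in `t`, with `∂ₜu = tr(A(x)D²ₓu)`. -/
def SolvesL {m : ℕ} (A : Spc m → Matrix (Fin (m + 1)) (Fin (m + 1)) ℝ)
    (u : Spc m × ℝ → ℝ) (Ω : Set (Spc m × ℝ)) : Prop :=
  ∀ p ∈ Ω, ContDiffAt ℝ 2 (fun y => u (y, p.2)) p.1 ∧
    HasDerivAt (fun s => u (p.1, s)) (Lop A u p) p.2

/-- `u` is a pointwise subsolution: `u_t ≤ Lu` on `Ω`. -/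
def SubSolvesL {m : ℕ} (A : Spc m → Matrix (Fin (m + 1)) (Fin (m + 1)) ℝ)
    (u : Spc m × ℝ → ℝ) (Ω : Set (Spc m × ℝ)) : Prop :=
  ∀ p ∈ Ω, ContDiffAt ℝ 2 (fun y => u (y, p.2)) p.1 ∧
    DifferentiableAt ℝ (fun s => u (p.1, s)) p.2 ∧
    deriv (fun s => u (p.1, s)) p.2 ≤ Lop A u p

/-- `u` solves the heat equation `∂ₜu = Δu` on `Ω`. -/
def SolvesHeat {m : ℕ} (u : Spc m × ℝ → ℝ) (Ω : Set (Spc m × ℝ)) : Prop :=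
  ∀ p ∈ Ω, ContDiffAt ℝ 2 (fun y => u (y, p.2)) p.1 ∧
    HasDerivAt (fun s => u (p.1, s)) (∑ i, sHess u p i i) p.2

/-- The graph `Γ = {x_n = g(x',t)}`. -/
def graphSet {m : ℕ} (g : Spc' m → ℝ → ℝ) : Set (Spc m × ℝ) :=
  {p | xlast p.1 = g (xprime p.1) p.2}

/-- The cylinder `𝒞_r` of size `r` on top of the graph of `g`. -/
def Cyl {m : ℕ} (g : Spc' m → ℝ → ℝ) (r : ℝ) : Set (Spc m × ℝ) :=
  {p | ‖xprime p.1‖ < r ∧ -r ^ 2 < p.2 ∧ p.2 < r ^ 2 ∧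
    g (xprime p.1) p.2 < xlast p.1 ∧ xlast p.1 < g (xprime p.1) p.2 + r}

/-- The point `Ē = ((0', g(0',1/2) + 1/2), 1/2)`. -/
def Ebar {m : ℕ} (g : Spc' m → ℝ → ℝ) : Spc m × ℝ := (mkPt 0 (g 0 (1 / 2) + 1 / 2), 1 / 2)

/-- The point `E̲ = ((0', g(0',−1/2) + 1/2), −1/2)`. -/
def Eund {m : ℕ} (g : Spc' m → ℝ → ℝ) : Spc m × ℝ := (mkPt 0 (g 0 (-(1 / 2)) + 1 / 2), -(1 / 2))

/-- `u` vanishes continuously on `Γ`: `u(Q) → 0` as `Q → P` within `Ω`,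
for every `P ∈ Γ` in the closure of `Ω`. -/
def VanishesOn {m : ℕ} (u : Spc m × ℝ → ℝ) (Ω Γ : Set (Spc m × ℝ)) : Prop :=
  ∀ P ∈ Γ ∩ closure Ω, Filter.Tendsto u (nhdsWithin P Ω) (nhds 0)

/-- `[g]_{C^{α,β}} ≤ K`. -/
def HolderSemi {m : ℕ} (α β K : ℝ) (g : Spc' m → ℝ → ℝ) : Prop :=
  ∀ x' y' t s, |g x' t - g y' s| ≤ K * (‖x' - y'‖ ^ α + |t - s| ^ β)

/-- The backward-in-time cylinder `𝒞_r^−` (Lipschitz setting, parabolic scaling). -/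
def CylB {m : ℕ} (g : Spc' m → ℝ → ℝ) (r : ℝ) : Set (Spc m × ℝ) :=
  {p | (∀ i : Fin m, -r < xprime p.1 i ∧ xprime p.1 i < r) ∧ -r ^ 2 < p.2 ∧ p.2 ≤ 0 ∧
    g (xprime p.1) p.2 < xlast p.1 ∧ xlast p.1 < g (xprime p.1) p.2 + r}

/-- The set `𝒜_r` of points of `𝒞_r^−` at height at least `δr` above `Γ`. -/
def ASet {m : ℕ} (g : Spc' m → ℝ → ℝ) (δ r : ℝ) : Set (Spc m × ℝ) :=
  {p ∈ CylB g r | g (xprime p.1) p.2 + δ * r ≤ xlast p.1}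

/-- The backward-in-time cylinder `𝒞_r^−` (Hölder setting, time interval `(−r,0]`). -/
def CylBH {m : ℕ} (g : Spc' m → ℝ → ℝ) (r : ℝ) : Set (Spc m × ℝ) :=
  {p | (∀ i : Fin m, -r < xprime p.1 i ∧ xprime p.1 i < r) ∧ -r < p.2 ∧ p.2 ≤ 0 ∧
    g (xprime p.1) p.2 < xlast p.1 ∧ xlast p.1 < g (xprime p.1) p.2 + r}

/-- The set `𝒜_r` of points of the Hölder cylinder `𝒞_r^−` at height at least `r^β` above `Γ`. -/
def ASetH {m : ℕ} (g : Spc' m → ℝ → ℝ) (β r : ℝ) : Set (Spc m × ℝ) :=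
  {p ∈ CylBH g r | g (xprime p.1) p.2 + r ^ β ≤ xlast p.1}

/-- The height `h_Γ(x,t) = x_n − g(x',t)` above the graph. -/
def hGamma {m : ℕ} (g : Spc' m → ℝ → ℝ) (p : Spc m × ℝ) : ℝ :=
  xlast p.1 - g (xprime p.1) p.2

section estimates
open Filter Topology Set MeasureTheory

/-- The second derivative of `f` at `x`, as a bilinear form. -/
def D2 {m : ℕ} (f : Spc m → ℝ) (x : Spc m) : Spc m →L[ℝ] Spc m →L[ℝ] ℝ :=
  fderiv ℝ (fderiv ℝ f) x

/-- The contraction of a matrix with a bilinear form. -/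
def trF {m : ℕ} (M : Matrix (Fin (m + 1)) (Fin (m + 1)) ℝ)
    (B : Spc m →L[ℝ] Spc m →L[ℝ] ℝ) : ℝ :=
  ∑ i, ∑ j, M i j * B (eVec m j) (eVec m i)

lemma trF_add {m : ℕ} (M : Matrix (Fin (m + 1)) (Fin (m + 1)) ℝ)
    (B B' : Spc m →L[ℝ] Spc m →L[ℝ] ℝ) : trF M (B + B') = trF M B + trF M B' := by
  simp [trF, mul_add, Finset.sum_add_distrib]

lemma trF_smul {m : ℕ} (M : Matrix (Fin (m + 1)) (Fin (m + 1)) ℝ) (c : ℝ)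
    (B : Spc m →L[ℝ] Spc m →L[ℝ] ℝ) : trF M (c • B) = c * trF M B := by
  simp only [trF, Finset.mul_sum, smul_apply, smul_eq_mul]
  refine Finset.sum_congr rfl fun i _ => Finset.sum_congr rfl fun j _ => by ring

lemma trF_sub {m : ℕ} (M : Matrix (Fin (m + 1)) (Fin (m + 1)) ℝ)
    (B B' : Spc m →L[ℝ] Spc m →L[ℝ] ℝ) : trF M (B - B') = trF M B - trF M B' := by
  simp [trF, mul_sub, Finset.sum_sub_distrib]

section calculus
variable {m : ℕ} {f g : Spc m → ℝ} {x : Spc m}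

lemma differentiableAt_fderiv (hf : ContDiffAt ℝ 2 f x) : DifferentiableAt ℝ (fderiv ℝ f) x :=
  (hf.fderiv_right (m := 1) (by norm_num)).differentiableAt (by norm_num)

lemma eventually_differentiableAt (hf : ContDiffAt ℝ 2 f x) :
    ∀ᶠ y in 𝓝 x, DifferentiableAt ℝ f y :=
  (hf.eventually (by simp)).mono fun _ h => h.differentiableAt (by norm_num)

lemma D2_add (hf : ContDiffAt ℝ 2 f x) (hg : ContDiffAt ℝ 2 g x) :
    D2 (fun y => f y + g y) x = D2 f x + D2 g x := by
  have h : fderiv ℝ (fun y => f y + g y) =ᶠ[𝓝 x] fun y => fderiv ℝ f y + fderiv ℝ g y := by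
    filter_upwards [eventually_differentiableAt hf, eventually_differentiableAt hg] with y h1 h2
    exact fderiv_fun_add h1 h2
  rw [D2, h.fderiv_eq, fderiv_fun_add (differentiableAt_fderiv hf) (differentiableAt_fderiv hg)]
  rfl

lemma D2_const_mul (c : ℝ) (f : Spc m → ℝ) (x : Spc m) :
    D2 (fun y => c * f y) x = c • D2 f x := by
  have h : fderiv ℝ (fun y => c * f y) = fun y => c • fderiv ℝ f y := by
    exact fderiv_const_smul_field (𝕜 := ℝ) (f := f) c
  rw [D2, h]
  exact congrFun (fderiv_const_smul_field (𝕜 := ℝ) (f := fderiv ℝ f) c) x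

lemma D2_neg (f : Spc m → ℝ) (x : Spc m) : D2 (fun y => -f y) x = -D2 f x := by
  have := D2_const_mul (-1) f x
  simp only [neg_mul, one_mul] at this
  rw [this]
  ext v w
  simp

lemma D2_sub (hf : ContDiffAt ℝ 2 f x) (hg : ContDiffAt ℝ 2 g x) :
    D2 (fun y => f y - g y) x = D2 f x - D2 g x := by
  have := D2_add hf hg.neg
  simp only [← sub_eq_add_neg] at this
  rw [this, show D2 (fun y => -g y) x = -D2 g x from D2_neg g x]
  ext v w
  simp [sub_eq_add_neg]

lemma D2_const (c : ℝ) (x : Spc m) : D2 (fun _ => c) x = 0 := by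
  have : fderiv ℝ (fun _ : Spc m => c) = fun _ => 0 := by funext y; simp
  rw [D2, this]; simp

lemma Lop_eq (A : Spc m → Matrix (Fin (m + 1)) (Fin (m + 1)) ℝ) (u : Spc m × ℝ → ℝ)
    (p : Spc m × ℝ) (h : ContDiffAt ℝ 2 (fun y => u (y, p.2)) p.1) :
    Lop A u p = trF (A p.1) (D2 (fun y => u (y, p.2)) p.1) := by
  unfold Lop trF sHess D2
  refine Finset.sum_congr rfl fun i _ => Finset.sum_congr rfl fun j _ => ?_
  rw [fderiv_clm_apply (differentiableAt_fderiv h) (differentiableAt_const _)]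
  simp

end calculus

/-- Second-order necessary condition in one variable. -/
lemma deriv_deriv_nonneg_of_isLocalMin {φ : ℝ → ℝ} {a : ℝ} (h : IsLocalMin φ a)
    (hc : ContinuousAt φ a) : 0 ≤ deriv (deriv φ) a := by
  by_contra hneg
  push Not at hneg
  have hmax := isLocalMax_of_deriv_deriv_neg hneg h.deriv_eq_zero hc
  have heq : φ =ᶠ[𝓝 a] fun _ => φ a := by
    filter_upwards [h, hmax] with y h1 h2
    exact le_antisymm h2 h1
  have h1 : deriv φ =ᶠ[𝓝 a] fun _ => 0 := by
    have := heq.deriv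
    simpa using this
  rw [h1.deriv_eq] at hneg
  simp at hneg

lemma D2_nonneg_of_isLocalMin {m : ℕ} {f : Spc m → ℝ} {x : Spc m} (hf : ContDiffAt ℝ 2 f x)
    (h : IsLocalMin f x) (ξ : Spc m) : 0 ≤ D2 f x ξ ξ := by
  have hl : ∀ s : ℝ, HasDerivAt (fun s : ℝ => x + s • ξ) ξ s := fun s => by
    simpa using ((hasDerivAt_id s).smul_const ξ).const_add x
  have hx0 : x + (0 : ℝ) • ξ = x := by simp
  have hcont : Tendsto (fun s : ℝ => x + s • ξ) (𝓝 0) (𝓝 x) := by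
    have := (hl 0).continuousAt.tendsto
    rwa [hx0] at this
  have h1 : deriv (fun s : ℝ => f (x + s • ξ)) =ᶠ[𝓝 0] fun s => fderiv ℝ f (x + s • ξ) ξ := by
    filter_upwards [hcont.eventually (eventually_differentiableAt hf)] with s hs
    exact (hs.hasFDerivAt.comp_hasDerivAt s (hl s)).deriv
  have h2 : deriv (deriv (fun s : ℝ => f (x + s • ξ))) 0 = D2 f x ξ ξ := by
    rw [h1.deriv_eq]
    have h3 : HasFDerivAt (fderiv ℝ f) (D2 f x) (x + (0 : ℝ) • ξ) := by
      rw [hx0]; exact (differentiableAt_fderiv hf).hasFDerivAt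
    have h4 := h3.comp_hasDerivAt (0 : ℝ) (hl 0)
    have h5 := h4.clm_apply (hasDerivAt_const (0 : ℝ) ξ)
    simpa using h5.deriv
  rw [← h2]
  apply deriv_deriv_nonneg_of_isLocalMin
  · have := hcont.eventually h
    simpa [IsLocalMin, IsMinFilter] using this
  · have : ContinuousAt f (x + (0 : ℝ) • ξ) := by rw [hx0]; exact hf.continuousAt
    exact ContinuousAt.comp (f := fun s : ℝ => x + s • ξ) this (hl 0).continuousAt

lemma sum_eVec {m : ℕ} (v : Spc m) : ∑ i, v i • eVec m i = v := by
  ext k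
  simp [eVec, Finset.sum_apply, Pi.single_apply]

lemma bilin_sum {m : ℕ} (B : Spc m →L[ℝ] Spc m →L[ℝ] ℝ) (v w : Spc m) :
    B v w = ∑ i, ∑ j, w i * v j * B (eVec m j) (eVec m i) := by
  conv_lhs => rw [← sum_eVec v, ← sum_eVec w]
  simp only [map_sum, map_smul, sum_apply, smul_apply,
    smul_eq_mul, Finset.mul_sum]
  refine Finset.sum_congr rfl fun i _ => Finset.sum_congr rfl fun j _ => by ring

/-- The contraction of two positive semidefinite forms is nonnegative. -/
lemma trF_nonneg {m : ℕ} {M : Matrix (Fin (m + 1)) (Fin (m + 1)) ℝ} (hM : M.PosSemidef)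
    {B : Spc m →L[ℝ] Spc m →L[ℝ] ℝ} (hB : ∀ ξ, 0 ≤ B ξ ξ) : 0 ≤ trF M B := by
  obtain ⟨k, v, rfl⟩ := Matrix.posSemidef_iff_eq_sum_vecMulVec.1 hM
  have : trF (∑ i, Matrix.vecMulVec (v i) (star (v i))) B =
      ∑ l, B (WithLp.toLp 2 (v l)) (WithLp.toLp 2 (v l)) := by
    simp_rw [bilin_sum B (WithLp.toLp 2 (v _))]
    unfold trF
    rw [Finset.sum_comm' (t' := Finset.univ) (s' := fun _ => Finset.univ) (by simp)]
    conv_rhs => rw [Finset.sum_comm]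
    rw [Finset.sum_comm]
    refine Finset.sum_congr rfl fun i _ => ?_
    conv_rhs => rw [Finset.sum_comm]
    refine Finset.sum_congr rfl fun j _ => ?_
    rw [Matrix.sum_apply, Finset.sum_mul]
    refine Finset.sum_congr rfl fun l _ => ?_
    simp [Matrix.vecMulVec_apply]
  rw [this]
  exact Finset.sum_nonneg fun l _ => hB _

/-- The Euclidean inner product as a bilinear form. -/
def innerForm (m : ℕ) : Spc m →L[ℝ] Spc m →L[ℝ] ℝ := innerSL ℝ

@[simp] lemma innerForm_apply {m : ℕ} (v w : Spc m) : innerForm m v w = inner ℝ v w := rfl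

/-- The bilinear form `(a, b) ↦ ⟪w, a⟫ ⟪w, b⟫`. -/
def rankOne {m : ℕ} (w : Spc m) : Spc m →L[ℝ] Spc m →L[ℝ] ℝ :=
  (innerSL ℝ w).smulRight (innerSL ℝ w)

@[simp] lemma rankOne_apply {m : ℕ} (w a b : Spc m) :
    rankOne w a b = inner ℝ w a * inner ℝ w b := rfl

section elliptic
variable {m : ℕ} {lam Lam : ℝ} {A : Spc m → Matrix (Fin (m + 1)) (Fin (m + 1)) ℝ}

lemma posSemidef_of_quadratic {M : Matrix (Fin (m + 1)) (Fin (m + 1)) ℝ} (hs : M.IsSymm)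
    (h : ∀ ξ : Spc m, 0 ≤ ∑ i, ∑ j, ξ i * M i j * ξ j) : M.PosSemidef := by
  rw [Matrix.posSemidef_iff_dotProduct_mulVec]
  refine ⟨by simpa [Matrix.IsHermitian, Matrix.IsSymm] using hs, fun v => ?_⟩
  have := h (WithLp.toLp 2 v)
  simpa [dotProduct, Matrix.mulVec, Finset.mul_sum, mul_assoc] using this

lemma IsElliptic.posSemidef (hA : IsElliptic lam Lam A) (hlam : 0 ≤ lam) (x : Spc m) :
    (A x).PosSemidef :=
  posSemidef_of_quadratic (hA.1 x) fun ξ => (by positivity : 0 ≤ lam * ‖ξ‖ ^ 2).trans (hA.2 x ξ).1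

lemma sum_one_quadratic (ξ : Spc m) (c : ℝ) :
    ∑ i, ∑ j, ξ i * (c • (1 : Matrix (Fin (m + 1)) (Fin (m + 1)) ℝ)) i j * ξ j = c * ‖ξ‖ ^ 2 := by
  rw [EuclideanSpace.norm_sq_eq, Finset.mul_sum]
  refine Finset.sum_congr rfl fun i _ => ?_
  rw [Finset.sum_eq_single i]
  · simp; ring
  · intro j _ hj; simp [Matrix.one_apply_ne hj.symm]
  · simp

/-- Lower ellipticity bound for the contraction with a positive semidefinite form. -/
lemma IsElliptic.le_trF (hA : IsElliptic lam Lam A) (x : Spc m)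
    {B : Spc m →L[ℝ] Spc m →L[ℝ] ℝ} (hB : ∀ ξ, 0 ≤ B ξ ξ) :
    lam * ∑ i, B (eVec m i) (eVec m i) ≤ trF (A x) B := by
  have hM : (A x - lam • (1 : Matrix (Fin (m + 1)) (Fin (m + 1)) ℝ)).PosSemidef := by
    refine posSemidef_of_quadratic ?_ fun ξ => ?_
    · have := hA.1 x
      simp only [Matrix.IsSymm, Matrix.transpose_sub, Matrix.transpose_smul,
        Matrix.transpose_one] at this ⊢
      rw [this]
    · have h1 := (hA.2 x ξ).1
      have h2 := sum_one_quadratic ξ lam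
      simp only [Matrix.sub_apply, mul_sub, sub_mul, Finset.sum_sub_distrib]
      linarith
  have h := trF_nonneg hM hB
  have h2 : trF (A x - lam • (1 : Matrix (Fin (m + 1)) (Fin (m + 1)) ℝ)) B =
      trF (A x) B - lam * ∑ i, B (eVec m i) (eVec m i) := by
    unfold trF
    simp only [Matrix.sub_apply, sub_mul, Finset.sum_sub_distrib, Finset.mul_sum]
    congr 1
    refine Finset.sum_congr rfl fun i _ => ?_
    rw [Finset.sum_eq_single i]
    · simp
    · intro j _ hj; simp [Matrix.one_apply_ne hj.symm]
    · simp
  linarith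

lemma IsElliptic.trF_innerForm_le (hA : IsElliptic lam Lam A) (x : Spc m) :
    trF (A x) (innerForm m) ≤ (m + 1) * Lam := by
  have h1 : trF (A x) (innerForm m) = ∑ i, A x i i := by
    unfold trF
    refine Finset.sum_congr rfl fun i _ => ?_
    rw [Finset.sum_eq_single i]
    · simp [eVec]
    · intro j _ hj; simp [eVec, hj, EuclideanSpace.inner_single_left]
    · simp
  rw [h1]
  have h2 : ∀ i, A x i i ≤ Lam := fun i => by
    have := (hA.2 x (eVec m i)).2
    rw [Finset.sum_eq_single i, Finset.sum_eq_single i] at this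
    · simpa [eVec] using this
    · intro j _ hj; simp [eVec, hj]
    · simp
    · intro j _ hj; simp [eVec, hj]
    · simp
  calc ∑ i, A x i i ≤ ∑ _i : Fin (m + 1), Lam := Finset.sum_le_sum fun i _ => h2 i
    _ = (m + 1) * Lam := by simp

lemma trF_rankOne (M : Matrix (Fin (m + 1)) (Fin (m + 1)) ℝ) (w : Spc m) :
    trF M (rankOne w) = ∑ i, ∑ j, w i * M i j * w j := by
  unfold trF
  refine Finset.sum_congr rfl fun i _ => Finset.sum_congr rfl fun j _ => ?_
  simp [eVec, EuclideanSpace.inner_single_right]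
  ring

lemma trF_innerForm_nonneg (hA : IsElliptic lam Lam A) (hlam : 0 ≤ lam) (x : Spc m) :
    0 ≤ trF (A x) (innerForm m) :=
  trF_nonneg (hA.posSemidef hlam x) fun ξ => by simp

/-- Touching from below compares the operators. -/
lemma trF_D2_le_of_isLocalMin (hA : IsElliptic lam Lam A) (hlam : 0 ≤ lam)
    {f g : Spc m → ℝ} {x : Spc m} (hf : ContDiffAt ℝ 2 f x) (hg : ContDiffAt ℝ 2 g x)
    (h : IsLocalMin (fun y => f y - g y) x) : trF (A x) (D2 g x) ≤ trF (A x) (D2 f x) := by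
  have h1 := trF_nonneg (hA.posSemidef hlam x) (D2_nonneg_of_isLocalMin (hf.sub hg) h)
  rw [D2_sub hf hg, trF_sub] at h1
  linarith

end elliptic

section explicit
variable {m : ℕ}

lemma hasFDerivAt_normSq_sub (x0 x : Spc m) :
    HasFDerivAt (fun y => ‖y - x0‖ ^ 2) ((2 : ℝ) • innerForm m (x - x0)) x := by
  have := ((hasFDerivAt_id x).sub_const x0).norm_sq
  refine this.congr_fderiv ?_
  ext w
  simp [two_smul]

lemma contDiff_normSq_sub (x0 : Spc m) : ContDiff ℝ 2 fun y : Spc m => ‖y - x0‖ ^ 2 :=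
  (contDiff_id.sub contDiff_const).norm_sq ℝ

lemma hasFDerivAt_innerForm_sub (x0 x : Spc m) :
    HasFDerivAt (fun y => innerForm m (y - x0)) (innerForm m) x :=
  (innerForm m).hasFDerivAt.comp x ((hasFDerivAt_id x).sub_const x0)

lemma D2_normSq_sub (x0 x : Spc m) :
    D2 (fun y => ‖y - x0‖ ^ 2) x = (2 : ℝ) • innerForm m := by
  have h : fderiv ℝ (fun y => ‖y - x0‖ ^ 2) = fun y => (2 : ℝ) • innerForm m (y - x0) := by
    funext y; exact (hasFDerivAt_normSq_sub x0 y).fderiv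
  rw [D2, h]
  exact ((hasFDerivAt_innerForm_sub x0 x).const_smul (2 : ℝ)).fderiv

lemma D2_sq_sub_normSq (c : ℝ) (x0 x : Spc m) :
    D2 (fun y => (c - ‖y - x0‖ ^ 2) ^ 2) x =
      (8 : ℝ) • rankOne (x - x0) -
        (4 * (c - ‖x - x0‖ ^ 2)) • innerForm m := by
  have h : fderiv ℝ (fun y => (c - ‖y - x0‖ ^ 2) ^ 2) =
      fun y => (-4 * (c - ‖y - x0‖ ^ 2)) • innerForm m (y - x0) := by
    funext y
    have := ((hasFDerivAt_normSq_sub x0 y).const_sub c).pow 2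
    rw [this.fderiv]
    ext w
    simp
    ring
  have h1 := (((hasFDerivAt_normSq_sub x0 x).const_sub c).const_mul (-4 : ℝ)).smul
    (hasFDerivAt_innerForm_sub x0 x)
  rw [D2, h]
  refine (h1.fderiv).trans ?_
  ext w e
  simp only [rankOne_apply, innerForm_apply, add_apply, sub_apply, smul_apply, smul_eq_mul,
    ContinuousLinearMap.smulRight_apply, neg_apply]
  ring

lemma D2_sub_const_inner {f : Spc m → ℝ} {x : Spc m} (hf : ContDiffAt ℝ 2 f x) (q : Spc m) :
    D2 (fun y => f y - inner ℝ q y) x = D2 f x := by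
  have hq : ContDiffAt ℝ 2 (fun y : Spc m => inner ℝ q y) x := (innerSL ℝ q).contDiff.contDiffAt
  rw [D2_sub hf hq]
  have : D2 (fun y : Spc m => inner ℝ q y) x = 0 := by
    have : fderiv ℝ (fun y : Spc m => inner ℝ q y) = fun _ => innerSL ℝ q := by
      funext y; exact (innerSL ℝ q).fderiv
    rw [D2, this]; simp
  rw [this]
  ext v w; simp

lemma D2_comp_affine (f : Spc m → ℝ) (x0 : Spc m) (r : ℝ) (x : Spc m) :
    D2 (fun y => f (x0 + r • y)) x = (r ^ 2) • D2 f (x0 + r • x) := by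
  have key : ∀ {F : Type} [NormedAddCommGroup F] [NormedSpace ℝ F] (k : Spc m → F) (y : Spc m),
      fderiv ℝ (fun y => k (x0 + r • y)) y = r • fderiv ℝ k (x0 + r • y) := by
    intro F _ _ k y
    have h1 := fderiv_comp_smul (𝕜 := ℝ) (f := fun z => k (x0 + z)) (x := y) r
    rw [fderiv_comp_add_left] at h1
    exact h1
  have h : fderiv ℝ (fun y => f (x0 + r • y)) = fun y => r • fderiv ℝ f (x0 + r • y) :=
    funext fun y => key f y
  rw [D2, h]
  have h2 := congrFun (fderiv_const_smul_field (𝕜 := ℝ)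
    (f := fun y => fderiv ℝ f (x0 + r • y)) r) x
  refine h2.trans ?_
  change r • fderiv ℝ (fun y => fderiv ℝ f (x0 + r • y)) x = _
  rw [key (fderiv ℝ f) x, smul_smul, pow_two]
  rfl

end explicit

/-- The parabolic dilation `(x,t) ↦ (x₀ + r x, t₀ + r² t)`. -/
def pdil {m : ℕ} (p : Spc m × ℝ) (r : ℝ) (q : Spc m × ℝ) : Spc m × ℝ :=
  (p.1 + r • q.1, p.2 + r ^ 2 * q.2)

lemma SolvesL.pdil {m : ℕ} {A : Spc m → Matrix (Fin (m + 1)) (Fin (m + 1)) ℝ}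
    {u : Spc m × ℝ → ℝ} {Ω : Set (Spc m × ℝ)} (h : SolvesL A u Ω) (p : Spc m × ℝ) (r : ℝ) :
    SolvesL (fun x => A (p.1 + r • x)) (fun q => u (_root_.pdil p r q)) (_root_.pdil p r ⁻¹' Ω) := by
  intro q hq
  obtain ⟨h1, h2⟩ := h _ hq
  have hc : ContDiffAt ℝ 2 (fun y => u (_root_.pdil p r (y, q.2))) q.1 :=
    ContDiffAt.comp (f := fun y => p.1 + r • y) q.1 h1
      (by fun_prop)
  refine ⟨hc, ?_⟩
  rw [Lop_eq _ _ _ hc]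
  have e : D2 (fun y => u (_root_.pdil p r (y, q.2))) q.1 = (r ^ 2) •
      D2 (fun y => u (y, (_root_.pdil p r q).2)) (p.1 + r • q.1) :=
    D2_comp_affine (fun y => u (y, (_root_.pdil p r q).2)) p.1 r q.1
  rw [e, trF_smul]
  rw [Lop_eq _ _ _ h1] at h2
  have h3 : HasDerivAt (fun s : ℝ => p.2 + r ^ 2 * s) (r ^ 2) q.2 := by
    simpa using ((hasDerivAt_id q.2).const_mul (r ^ 2)).const_add p.2
  have h4 := HasDerivAt.comp q.2 h2 h3
  rw [mul_comm]
  exact h4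

lemma SolvesL.mono {m : ℕ} {A : Spc m → Matrix (Fin (m + 1)) (Fin (m + 1)) ℝ}
    {u : Spc m × ℝ → ℝ} {Ω Ω' : Set (Spc m × ℝ)} (h : SolvesL A u Ω) (hs : Ω' ⊆ Ω) :
    SolvesL A u Ω' := fun p hp => h p (hs hp)

lemma IsElliptic.affine {m : ℕ} {lam Lam : ℝ} {A : Spc m → Matrix (Fin (m + 1)) (Fin (m + 1)) ℝ}
    (hA : IsElliptic lam Lam A) (x0 : Spc m) (r : ℝ) :
    IsElliptic lam Lam fun x => A (x0 + r • x) :=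
  ⟨fun _ => hA.1 _, fun _ ξ => hA.2 _ ξ⟩

/-- Lower semicontinuity at `p` along points with later (or equal) times. -/
def RLSC {m : ℕ} (u : Spc m × ℝ → ℝ) (p : Spc m × ℝ) : Prop :=
  ∀ c < u p, ∀ᶠ q in 𝓝[{q | p.2 ≤ q.2}] p, c < u q

/-- Nonnegative solutions which are lower semicontinuous forward in time. -/
structure PosSol {m : ℕ} (A : Spc m → Matrix (Fin (m + 1)) (Fin (m + 1)) ℝ)
    (v : Spc m × ℝ → ℝ) (Ω : Set (Spc m × ℝ)) : Prop where
  solves : SolvesL A v Ω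
  nonneg : ∀ p ∈ Ω, 0 ≤ v p
  rlsc : ∀ p ∈ Ω, RLSC v p

lemma RLSC.sub_continuous {m : ℕ} {u φ : Spc m × ℝ → ℝ} {p : Spc m × ℝ} (h : RLSC u p)
    (hφ : ContinuousAt φ p) : RLSC (fun q => u q - φ q) p := by
  intro c hc
  have hε : 0 < (u p - φ p - c) / 2 := by linarith
  have h1 := h (u p - (u p - φ p - c) / 2) (by linarith)
  have h2 : ∀ᶠ q in 𝓝 p, φ q < φ p + (u p - φ p - c) / 2 :=
    hφ.eventually (gt_mem_nhds (by linarith))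
  filter_upwards [h1, nhdsWithin_le_nhds h2] with q h3 h4
  linarith

/-- A function which is lower semicontinuous from the right and locally dominates its left values
is monotone. -/
lemma le_of_left_le {f : ℝ → ℝ} {a b : ℝ} (hab : a ≤ b)
    (hr : ∀ t ∈ Ico a b, ∀ c < f t, ∀ᶠ s in 𝓝[>] t, c < f s)
    (hl : ∀ t ∈ Ioc a b, ∀ᶠ s in 𝓝[<] t, f s ≤ f t) : f a ≤ f b := by
  set S : Set ℝ := {s | s ∈ Icc a b ∧ ∀ r ∈ Icc s b, f r ≤ f b} with hS
  have hbS : b ∈ S := ⟨⟨hab, le_rfl⟩, fun r hr => by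
    rw [le_antisymm hr.2 hr.1]⟩
  have hbdd : BddBelow S := ⟨a, fun s hs => hs.1.1⟩
  set c := sInf S with hc
  have hac : a ≤ c := le_csInf ⟨b, hbS⟩ fun s hs => hs.1.1
  have hcb : c ≤ b := csInf_le hbdd hbS
  have h1 : ∀ r ∈ Ioc c b, f r ≤ f b := fun r hr => by
    obtain ⟨s, hs, hsr⟩ := (csInf_lt_iff hbdd ⟨b, hbS⟩).1 hr.1
    exact hs.2 r ⟨hsr.le, hr.2⟩
  have h2 : f c ≤ f b := by
    rcases hcb.eq_or_lt with h | h
    · rw [h]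
    · by_contra hlt
      push Not at hlt
      have e1 := hr c ⟨hac, h⟩ _ hlt
      have e2 : ∀ᶠ s in 𝓝[>] c, s ∈ Ioc c b := Ioc_mem_nhdsGT h
      obtain ⟨s, hs1, hs2⟩ := (e1.and e2).exists
      linarith [h1 s hs2]
  have h3 : ∀ r ∈ Icc c b, f r ≤ f b := fun r hr => by
    rcases hr.1.eq_or_lt with h | h
    · rwa [← h]
    · exact h1 r ⟨h, hr.2⟩
  rcases hac.eq_or_lt with h | h
  · rwa [← h] at h2
  · exfalso
    obtain ⟨l, hl1, hl2⟩ := (mem_nhdsLT_iff_exists_Ioo_subset' h).1 (hl c ⟨h, hcb⟩)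
    set s := max ((l + c) / 2) ((a + c) / 2) with hs
    have hl1' : l < c := hl1
    have hsc : s < c := max_lt (by linarith) (by linarith)
    have hls : l < s := lt_of_lt_of_le (by linarith) (le_max_left _ _)
    have has : a < s := lt_of_lt_of_le (by linarith) (le_max_right _ _)
    have : s ∈ S := by
      refine ⟨⟨has.le, by linarith⟩, fun r hr => ?_⟩
      rcases lt_or_ge r c with h' | h'
      · have : f r ≤ f c := hl2 ⟨by linarith [hr.1], h'⟩
        linarith
      · exact h3 r ⟨h', hr.2⟩
    linarith [csInf_le hbdd this]

lemma eventually_left_le_add {φ : ℝ → ℝ} {t d η : ℝ} (h : HasDerivAt φ d t) (hd : 0 ≤ d + η)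
    {η' : ℝ} (hη : η < η') : ∀ᶠ s in 𝓝[<] t, φ s + η' * s ≤ φ t + η' * t := by
  have h1 := (hasDerivAt_iff_tendsto_slope.1 h)
  have h2 : ∀ᶠ s in 𝓝[≠] t, -η' < slope φ t s := h1.eventually (lt_mem_nhds (by linarith))
  have h3 : 𝓝[<] t ≤ 𝓝[≠] t := nhdsWithin_mono _ fun s hs => ne_of_lt hs
  filter_upwards [h3 h2, self_mem_nhdsWithin] with s hs hst
  have hst' : s < t := hst
  rw [slope_def_field, lt_div_iff_of_neg (by linarith)] at hs
  linarith

/-- The slice minimum of `z` over a compact set, capped at `0`. -/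
lemma exists_slice_min {m : ℕ} {K : Set (Spc m)} (hK : IsCompact K) (hne : K.Nonempty)
    {z : Spc m × ℝ → ℝ} {t : ℝ}
    (h : ∀ x ∈ K, ∀ c < z (x, t), ∀ᶠ q in 𝓝[K ×ˢ Ici t] (x, t), c < z q) :
    ∃ x ∈ K, ∀ y ∈ K, z (x, t) ≤ z (y, t) := by
  have hl : LowerSemicontinuousOn (fun x => z (x, t)) K := by
    intro x hx c hc
    have ht : Tendsto (fun y : Spc m => (y, t)) (𝓝[K] x) (𝓝[K ×ˢ Ici t] (x, t)) := by
      refine tendsto_nhdsWithin_iff.2 ⟨?_, ?_⟩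
      · exact ((Continuous.prodMk_left t).tendsto x).mono_left nhdsWithin_le_nhds
      · filter_upwards [self_mem_nhdsWithin] with y hy
        exact ⟨hy, le_refl t⟩
    exact ht.eventually (h x hx c hc)
  obtain ⟨x, hx, hmin⟩ := hl.exists_isMinOn hne hK
  exact ⟨x, hx, fun y hy => hmin hy⟩

lemma eventually_right_forall {m : ℕ} {K : Set (Spc m)} (hK : IsCompact K)
    {z : Spc m × ℝ → ℝ} {t c : ℝ} (hc : ∀ x ∈ K, c < z (x, t))
    (h : ∀ x ∈ K, ∀ c < z (x, t), ∀ᶠ q in 𝓝[K ×ˢ Ici t] (x, t), c < z q) :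
    ∀ᶠ s in 𝓝[≥] t, ∀ x ∈ K, c < z (x, s) := by
  have : ∀ x ∈ K, ∀ᶠ q : Spc m × ℝ in 𝓝[K] x ×ˢ 𝓝[≥] t, c < z q := fun x hx => by
    rw [← nhdsWithin_prod_eq]
    exact h x hx c (hc x hx)
  choose! f hf using fun x hx => (eventually_prod_iff.1 (this x hx))
  choose! g hg using fun x hx => (hf x hx).2
  obtain ⟨s, hcov⟩ := hK.elim_nhdsWithin_subcover' (fun x _ => {y | f x y})
    (fun x hx => (hf x hx).1)
  have : ∀ᶠ r in 𝓝[≥] t, ∀ x ∈ s, g x.1 r := by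
    rw [Finset.eventually_all]
    exact fun x _ => (hg x.1 x.2).1
  filter_upwards [this] with r hr x hx
  obtain ⟨i, hi, hi2⟩ := mem_iUnion₂.1 (hcov hx)
  exact (hg i.1 i.2).2 hi2 (hr i hi)

/-- Parabolic minimum principle under one-sided semicontinuity. -/
theorem min_principle {m : ℕ} {K : Set (Spc m)} (hK : IsCompact K) {a b : ℝ}
    {z : Spc m × ℝ → ℝ}
    (h1 : ∀ t ∈ Icc a b, ∀ x ∈ K, ∀ c < z (x, t), ∀ᶠ q in 𝓝[K ×ˢ Ici t] (x, t), c < z q)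
    (h2 : ∀ x ∈ K, 0 ≤ z (x, a))
    (h3 : ∀ t ∈ Ioc a b, ∀ x ∈ K, z (x, t) < 0 → (∀ y ∈ K, z (x, t) ≤ z (y, t)) →
      ∃ d, 0 ≤ d ∧ HasDerivAt (fun s => z (x, s)) d t) :
    ∀ t ∈ Icc a b, ∀ x ∈ K, 0 ≤ z (x, t) := by
  intro T hT X hX
  have hne : K.Nonempty := ⟨X, hX⟩
  have hmin : ∀ t ∈ Icc a b, ∃ x ∈ K, ∀ y ∈ K, z (x, t) ≤ z (y, t) := fun t ht =>
    exists_slice_min hK hne (h1 t ht)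
  choose! ξ hξK hξ using hmin
  set h : ℝ → ℝ := fun t => min (z (ξ t, t)) 0 with hh
  have key : ∀ η > 0, h a + η * a ≤ h T + η * T := by
    intro η hη
    refine le_of_left_le (f := fun t => h t + η * t) hT.1 ?_ ?_
    · intro t ht c hc
      have htI : t ∈ Icc a b := ⟨ht.1, ht.2.le.trans hT.2⟩
      set c' := (c + h t + η * t) / 2 with hc'
      have e1 : ∀ x ∈ K, c' - η * t < z (x, t) := fun x hx => by
        have := hξ t htI x hx
        have h5 : h t ≤ z (ξ t, t) := min_le_left _ _
        linarith
      have e2 : c' - η * t < 0 := by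
        have h5 : h t ≤ 0 := min_le_right _ _
        linarith
      have e3 := eventually_right_forall hK e1 (h1 t htI)
      have e4 : ∀ᶠ s in 𝓝[>] t, s ∈ Ioo t T := Ioo_mem_nhdsGT ht.2
      filter_upwards [nhdsWithin_mono t Ioi_subset_Ici_self e3, e4] with s hs hst
      have hsI : s ∈ Icc a b := ⟨ht.1.trans hst.1.le, hst.2.le.trans hT.2⟩
      have : c' - η * t < h s := lt_min (hs _ (hξK s hsI)) e2
      have : η * t ≤ η * s := mul_le_mul_of_nonneg_left hst.1.le hη.le
      linarith
    · intro t ht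
      have htI : t ∈ Icc a b := ⟨ht.1.le, ht.2.trans hT.2⟩
      have e4 : ∀ᶠ s in 𝓝[<] t, s ∈ Ioo a t := Ioo_mem_nhdsLT ht.1
      rcases lt_or_ge (z (ξ t, t)) 0 with hneg | hpos
      · obtain ⟨d, hd, hder⟩ := h3 t ⟨ht.1, ht.2.trans hT.2⟩ _ (hξK t htI) hneg (hξ t htI)
        have e5 := eventually_left_le_add hder (η := 0) (by linarith) hη
        filter_upwards [e4, e5] with s hs hs2
        have hsI : s ∈ Icc a b := ⟨hs.1.le, hs.2.le.trans htI.2⟩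
        have h6 : h s ≤ z (ξ t, s) := (min_le_left _ _).trans (hξ s hsI _ (hξK t htI))
        have h7 : h t = z (ξ t, t) := min_eq_left hneg.le
        linarith
      · filter_upwards [e4] with s hs
        have h6 : h s ≤ 0 := min_le_right _ _
        have h7 : h t = 0 := min_eq_right hpos
        have : η * s ≤ η * t := mul_le_mul_of_nonneg_left hs.2.le hη.le
        linarith
  have ha : h a = 0 := min_eq_right (h2 _ (hξK a ⟨le_rfl, hT.1.trans hT.2⟩))
  have hT0 : 0 ≤ h T := by
    refine le_of_forall_pos_le_add fun ε hε => ?_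
    rcases hT.1.eq_or_lt with h' | h'
    · rw [← h', ha]; linarith
    · have := key (ε / (T - a)) (div_pos hε (by linarith))
      have e : ε / (T - a) * T - ε / (T - a) * a = ε := by
        field_simp [show T - a ≠ 0 by linarith]
      linarith
  have := hξ T hT X hX
  have h5 : h T ≤ z (ξ T, T) := min_le_left _ _
  linarith

/-- Comparison of a positive solution with a barrier which is a strict or weak subsolution where it
is positive. -/
theorem PosSol.barrier_le {m : ℕ} {lam Lam : ℝ}
    {A : Spc m → Matrix (Fin (m + 1)) (Fin (m + 1)) ℝ}
    (hA : IsElliptic lam Lam A) (hlam : 0 ≤ lam) {v : Spc m × ℝ → ℝ} {Ω : Set (Spc m × ℝ)}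
    (hv : PosSol A v Ω) {K : Set (Spc m)} (hK : IsCompact K) {a b : ℝ}
    (hΩ : ∀ x ∈ K, ∀ t ∈ Icc a b, (x, t) ∈ Ω) {φ : Spc m × ℝ → ℝ} (hφ : Continuous φ)
    (hinit : ∀ x ∈ K, φ (x, a) ≤ v (x, a))
    (hsub : ∀ t ∈ Ioc a b, ∀ x ∈ K, 0 < φ (x, t) → x ∈ interior K ∧
      ContDiffAt ℝ 2 (fun y => φ (y, t)) x ∧
      ∃ d, HasDerivAt (fun s => φ (x, s)) d t ∧ d ≤ trF (A x) (D2 (fun y => φ (y, t)) x)) :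
    ∀ t ∈ Icc a b, ∀ x ∈ K, φ (x, t) ≤ v (x, t) := by
  have := min_principle (z := fun q => v q - φ q) (a := a) (b := b) hK ?_ ?_ ?_
  · intro t ht x hx
    linarith [this t ht x hx]
  · intro t ht x hx c hc
    have h := (hv.rlsc _ (hΩ x hx t ht)).sub_continuous hφ.continuousAt c hc
    exact nhdsWithin_mono _ (fun q hq => hq.2) h
  · intro x hx
    linarith [hinit x hx]
  · intro t ht x hx hneg hmin
    have hp := hΩ x hx t ⟨ht.1.le, ht.2⟩
    have h0 := hv.nonneg _ hp
    obtain ⟨hint, hC, d, hd, hle⟩ := hsub t ht x hx (by linarith)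
    obtain ⟨hs1, hs2⟩ := hv.solves _ hp
    rw [Lop_eq _ _ _ hs1] at hs2
    refine ⟨_, ?_, hs2.sub hd⟩
    have hloc : IsLocalMin (fun y => v (y, t) - φ (y, t)) x := by
      filter_upwards [mem_interior_iff_mem_nhds.1 hint] with y hy
      exact hmin y hy
    have := trF_D2_le_of_isLocalMin hA hlam hs1 hC hloc
    linarith

lemma tendsto_sub_one_div (t : ℝ) :
    Tendsto (fun k : ℕ => t - 1 / ((k : ℝ) + 1)) atTop (𝓝[<] t) := by
  refine tendsto_nhdsWithin_iff.2 ⟨?_, Eventually.of_forall fun k => ?_⟩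
  · simpa using (tendsto_one_div_add_atTop_nhds_zero_nat (𝕜 := ℝ)).const_sub t
  · have : (0 : ℝ) < 1 / ((k : ℝ) + 1) := by positivity
    simp only [mem_Iio]; linarith

lemma tendsto_left_slope {g : ℝ → ℝ} {t d : ℝ} (h : HasDerivAt g d t) :
    Tendsto (fun k : ℕ => slope g t (t - 1 / ((k : ℝ) + 1))) atTop (𝓝 d) :=
  (hasDerivAt_iff_tendsto_slope.1 h).comp
    ((tendsto_sub_one_div t).mono_right (nhdsWithin_mono _ fun _ hs => ne_of_lt hs))

lemma left_slope_ge {g : ℝ → ℝ} {t s c : ℝ} (hs : s < t) :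
    c ≤ slope g t s ↔ g s ≤ g t - c * (t - s) := by
  rw [slope_def_field, le_div_iff_of_neg (by linarith)]
  constructor <;> intro h <;> linarith

/-- The times at which `f` frequently lies strictly below its recent past. -/
def dropSet (f : ℝ → ℝ) : Set ℝ := {t | ∃ᶠ k : ℕ in atTop, f t < f (t - 1 / ((k : ℝ) + 1))}

/-- A function whose decrease is at most linear needs many dropping times to decrease. -/
lemma drop_le_measure {f : ℝ → ℝ} {C : ℝ}
    (hmono : MonotoneOn (fun t => f t + C * t) (Icc (-1) 0))
    (hmeas : MeasurableSet (dropSet f)) :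
    f (-1) - f 0 ≤ C * (volume (dropSet f ∩ Ioo (-1) 0)).toReal := by
  set g : ℝ → ℝ := fun t => f t + C * t with hg
  have hmono' : MonotoneOn g (uIcc (-1) 0) := by rwa [uIcc_of_le (by norm_num)]
  have h1 : ∫ x in (-1 : ℝ)..0, deriv g x ≤ g 0 - g (-1) := by
    have := hmono'.intervalIntegral_deriv_mem_uIcc
    rw [uIcc_of_le (by
      have := hmono (show (-1 : ℝ) ∈ Icc (-1) 0 by simp) (show (0 : ℝ) ∈ Icc (-1) 0 by simp)
        (by norm_num)
      simpa using this)] at this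
    exact this.2
  have hint : IntervalIntegrable (deriv g) volume (-1) 0 := hmono'.intervalIntegrable_deriv
  have hlow : ∀ᵐ t, t ∈ Ioo (-1 : ℝ) 0 → (dropSet f)ᶜ.indicator (fun _ => C) t ≤ deriv g t := by
    filter_upwards [hmono.ae_differentiableWithinAt_of_mem] with t ht htI
    have hd : HasDerivAt g (deriv g t) t :=
      ((ht (Ioo_subset_Icc_self htI)).differentiableAt (Icc_mem_nhds htI.1 htI.2)).hasDerivAt
    have hev : ∀ᶠ k : ℕ in atTop, t - 1 / ((k : ℝ) + 1) ∈ Ioo (-1) t :=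
      (tendsto_sub_one_div t).eventually (Ioo_mem_nhdsLT htI.1)
    refine ge_of_tendsto (tendsto_left_slope hd) ?_
    by_cases hD : t ∈ dropSet f
    · rw [indicator_of_notMem (by simpa using hD)]
      filter_upwards [hev] with k hk
      rw [left_slope_ge hk.2]
      have := hmono ⟨hk.1.le, hk.2.le.trans htI.2.le⟩ (Ioo_subset_Icc_self htI) hk.2.le
      simpa using this
    · rw [indicator_of_mem (by simpa using hD)]
      have hD' : ∀ᶠ k : ℕ in atTop, ¬ f t < f (t - 1 / ((k : ℝ) + 1)) := by
        simpa [dropSet, not_frequently] using hD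
      filter_upwards [hev, hD'] with k hk hk2
      rw [left_slope_ge hk.2]
      simp only [hg]
      linarith
  have h2 : ∫ x in (-1 : ℝ)..0, (dropSet f)ᶜ.indicator (fun _ => C) x ≤
      ∫ x in (-1 : ℝ)..0, deriv g x := by
    refine intervalIntegral.integral_mono_ae_restrict (by norm_num) ?_ hint ?_
    · rw [intervalIntegrable_iff]
      refine Integrable.indicator ?_ hmeas.compl
      exact integrableOn_const (by simp [uIoc_of_le])
    · rw [← restrict_Ioo_eq_restrict_Icc]
      exact (ae_restrict_iff' measurableSet_Ioo).2 hlow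
  have h3 : ∫ x in (-1 : ℝ)..0, (dropSet f)ᶜ.indicator (fun _ => C) x =
      C * (1 - (volume (dropSet f ∩ Ioo (-1) 0)).toReal) := by
    rw [intervalIntegral.integral_of_le (by norm_num), integral_Ioc_eq_integral_Ioo,
      integral_indicator hmeas.compl, setIntegral_const, smul_eq_mul, mul_comm]
    congr 1
    rw [measureReal_def, Measure.restrict_apply hmeas.compl]
    have h4 : volume (Ioo (-1 : ℝ) 0) = 1 := by simp
    have h5 := measure_inter_add_sdiff (μ := volume) (Ioo (-1 : ℝ) 0) hmeas
    rw [h4, inter_comm] at h5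
    have h6 : (dropSet f)ᶜ ∩ Ioo (-1) 0 = Ioo (-1) 0 \ dropSet f := by
      rw [sdiff_eq, inter_comm]
    rw [h6]
    have h7 := congrArg ENNReal.toReal h5
    rw [ENNReal.toReal_add (ne_top_of_le_ne_top (by simp [h4]) (measure_mono inter_subset_right))
      (ne_top_of_le_ne_top (by simp [h4]) (measure_mono sdiff_subset))] at h7
    simp only [ENNReal.toReal_one] at h7
    linarith
  simp only [hg] at h1
  nlinarith

/-- A positive symmetric operator has determinant at most the power of its trace. -/
lemma abs_det_le_trace_pow {m : ℕ} (T : Spc m →L[ℝ] Spc m)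
    (hs : ∀ v w, inner ℝ (T v) w = inner ℝ v (T w)) (hp : ∀ v, 0 ≤ inner ℝ (T v) v) {c : ℝ}
    (hc : ∑ i, inner ℝ (T (eVec m i)) (eVec m i) ≤ c) : |T.det| ≤ c ^ (m + 1) := by
  have hS : (T : Spc m →ₗ[ℝ] Spc m).IsSymmetric := fun v w => hs v w
  have hn : Module.finrank ℝ (Spc m) = m + 1 := by simp
  have hpos : ∀ i, 0 ≤ hS.eigenvalues hn i := fun i => by
    have h1 := hp (hS.eigenvectorBasis hn i)
    have h2 := hS.apply_eigenvectorBasis hn i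
    rw [show T (hS.eigenvectorBasis hn i) = _ from h2, inner_smul_left] at h1
    simpa using h1
  have htr : ∑ i, hS.eigenvalues hn i ≤ c := by
    have h1 := hS.trace_eq_sum_eigenvalues hn
    rw [LinearMap.trace_eq_sum_inner _ (EuclideanSpace.basisFun (Fin (m + 1)) ℝ)] at h1
    have h2 : ∑ i, hS.eigenvalues hn i = ∑ i, inner ℝ (T (eVec m i)) (eVec m i) := by
      have h3 : ∑ i, hS.eigenvalues hn i = ∑ i, inner ℝ (eVec m i) (T (eVec m i)) := by
        simpa [eVec] using h1.symm
      rw [h3]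
      exact Finset.sum_congr rfl fun i _ => real_inner_comm _ _
    rw [h2]; exact hc
  have hle : ∀ i, hS.eigenvalues hn i ≤ c := fun i =>
    (Finset.single_le_sum (fun j _ => hpos j) (Finset.mem_univ i)).trans htr
  have hdet : T.det = ∏ i, hS.eigenvalues hn i := by
    have := hS.det_eq_prod_eigenvalues hn
    simpa using this
  rw [hdet, abs_of_nonneg (Finset.prod_nonneg fun i _ => hpos i)]
  calc ∏ i, hS.eigenvalues hn i ≤ ∏ _i : Fin (m + 1), c :=
        Finset.prod_le_prod (fun i _ => hpos i) fun i _ => hle i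
    _ = c ^ (m + 1) := by simp

/-- The Riesz map from the dual. -/
def sharp (m : ℕ) : (Spc m →L[ℝ] ℝ) →L[ℝ] Spc m :=
  ∑ i, (ContinuousLinearMap.apply ℝ ℝ (eVec m i)).smulRight (eVec m i)

lemma inner_sharp {m : ℕ} (l : Spc m →L[ℝ] ℝ) (v : Spc m) : inner ℝ (sharp m l) v = l v := by
  conv_rhs => rw [← sum_eVec v]
  simp only [sharp, sum_apply, ContinuousLinearMap.smulRight_apply,
    ContinuousLinearMap.apply_apply, sum_inner, inner_smul_left, map_sum, map_smul, smul_eq_mul]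
  refine Finset.sum_congr rfl fun i _ => ?_
  simp [eVec, EuclideanSpace.inner_single_left, mul_comm]

lemma sharp_innerSL {m : ℕ} (p : Spc m) : sharp m (innerSL ℝ p) = p :=
  ext_inner_right ℝ fun v => by rw [inner_sharp]; rfl

lemma abs_det_sharp_le {m : ℕ} (B : Spc m →L[ℝ] Spc m →L[ℝ] ℝ) (hs : ∀ v w, B v w = B w v)
    (hp : ∀ v, 0 ≤ B v v) {c : ℝ} (hc : ∑ i, B (eVec m i) (eVec m i) ≤ c) :
    |((sharp m).comp B).det| ≤ c ^ (m + 1) := by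
  refine abs_det_le_trace_pow _ (fun v w => ?_) (fun v => ?_) ?_
  · have h1 := inner_sharp (B v) w
    have h2 := inner_sharp (B w) v
    rw [real_inner_comm] at h2
    exact h1.trans ((hs v w).trans h2.symm)
  · simpa only [ContinuousLinearMap.comp_apply, inner_sharp] using hp v
  · simpa only [ContinuousLinearMap.comp_apply, inner_sharp] using hc

section envelope
variable {m : ℕ}

def clampT (t : ℝ) : ℝ := max (-1) (min t 0)

lemma clampT_mem (t : ℝ) : clampT t ∈ Icc (-1 : ℝ) 0 :=
  ⟨le_max_left _ _, max_le (by norm_num) (min_le_right _ _)⟩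

lemma clampT_of_mem {t : ℝ} (h : t ∈ Icc (-1 : ℝ) 0) : clampT t = t := by
  rw [clampT, min_eq_left h.2, max_eq_right h.1]

lemma clampT_continuous : Continuous clampT := by unfold clampT; fun_prop

/-- The tilted function whose minimum defines the envelope. -/
def tilt (v : Spc m × ℝ → ℝ) (p : Spc m) (q : Spc m × ℝ) : ℝ :=
  v q + ‖q.1‖ ^ 2 - q.2 - inner ℝ p q.1

/-- The capped lower envelope of the tilted function over the unit ball. -/
def env (v : Spc m × ℝ → ℝ) (p : Spc m) (t : ℝ) : ℝ :=
  ⨅ x : Metric.closedBall (0 : Spc m) 1, min (7 / 8) (tilt v p (x.1, clampT t))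

variable {lam Lam : ℝ} {A : Spc m → Matrix (Fin (m + 1)) (Fin (m + 1)) ℝ}
  {v : Spc m × ℝ → ℝ} {Ω : Set (Spc m × ℝ)}

lemma tilt_rlsc (hv : PosSol A v Ω) (p : Spc m) {q : Spc m × ℝ} (hq : q ∈ Ω) :
    RLSC (tilt v p) q := by
  have := (hv.rlsc q hq).sub_continuous (φ := fun q => -‖q.1‖ ^ 2 + q.2 + inner ℝ p q.1)
    (by fun_prop)
  refine (congrArg (fun f => RLSC f q) ?_).mp this
  funext r
  simp only [tilt]; ring

lemma tilt_lower (hv : PosSol A v Ω) (hΩ : Metric.closedBall 0 1 ×ˢ Icc (-1) 0 ⊆ Ω)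
    {p : Spc m} (hp : ‖p‖ < 1 / 8) {x : Spc m} (hx : ‖x‖ ≤ 1) {t : ℝ} (ht : t ∈ Icc (-1 : ℝ) 0) :
    v (x, t) + ‖x‖ ^ 2 - t - 1 / 8 ≤ tilt v p (x, t) ∧ 0 ≤ v (x, t) := by
  have h1 : inner ℝ p x ≤ 1 / 8 := by
    have := real_inner_le_norm p x
    have := mul_le_mul hp.le hx (norm_nonneg x) (by norm_num)
    linarith
  exact ⟨by simp only [tilt]; linarith, hv.nonneg _ (hΩ ⟨by simpa using hx, ht⟩)⟩

lemma tilt_exists_min (hv : PosSol A v Ω) (hΩ : Metric.closedBall 0 1 ×ˢ Icc (-1) 0 ⊆ Ω)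
    (p : Spc m) {t : ℝ} (ht : t ∈ Icc (-1 : ℝ) 0) :
    ∃ x ∈ Metric.closedBall (0 : Spc m) 1, ∀ y ∈ Metric.closedBall (0 : Spc m) 1,
      tilt v p (x, t) ≤ tilt v p (y, t) := by
  refine exists_slice_min (isCompact_closedBall 0 1) ⟨0, by simp⟩ fun x hx c hc => ?_
  have h1 : (x, t) ∈ Ω := hΩ (mk_mem_prod hx ht)
  have h2 := tilt_rlsc hv p h1 c hc
  exact h2.filter_mono (nhdsWithin_mono _ fun q hq => hq.2)

lemma env_bdd (hv : PosSol A v Ω) (hΩ : Metric.closedBall 0 1 ×ˢ Icc (-1) 0 ⊆ Ω)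
    (p : Spc m) (t : ℝ) :
    BddBelow (range fun x : Metric.closedBall (0 : Spc m) 1 =>
      min (7 / 8) (tilt v p (x.1, clampT t))) := by
  obtain ⟨x, hx, hmin⟩ := tilt_exists_min hv hΩ p (clampT_mem t)
  refine ⟨min (7 / 8) (tilt v p (x, clampT t)), ?_⟩
  rintro _ ⟨y, rfl⟩
  exact min_le_min le_rfl (hmin y.1 y.2)

lemma env_le (hv : PosSol A v Ω) (hΩ : Metric.closedBall 0 1 ×ˢ Icc (-1) 0 ⊆ Ω)
    (p : Spc m) (t : ℝ) {x : Spc m} (hx : ‖x‖ ≤ 1) :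
    env v p t ≤ min (7 / 8) (tilt v p (x, clampT t)) :=
  ciInf_le (env_bdd hv hΩ p t) ⟨x, by simpa using hx⟩

lemma env_attained (hv : PosSol A v Ω) (hΩ : Metric.closedBall 0 1 ×ˢ Icc (-1) 0 ⊆ Ω)
    (p : Spc m) {t : ℝ} (ht : t ∈ Icc (-1 : ℝ) 0) :
    ∃ x : Spc m, ‖x‖ ≤ 1 ∧ (∀ y : Spc m, ‖y‖ ≤ 1 → tilt v p (x, t) ≤ tilt v p (y, t)) ∧
      env v p t = min (7 / 8) (tilt v p (x, t)) := by
  obtain ⟨x, hx, hmin⟩ := tilt_exists_min hv hΩ p ht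
  have hx' : ‖x‖ ≤ 1 := by simpa using hx
  refine ⟨x, hx', fun y hy => hmin y (by simpa using hy), ?_⟩
  have : Nonempty (Metric.closedBall (0 : Spc m) 1) := ⟨⟨x, hx⟩⟩
  refine le_antisymm ?_ (le_ciInf fun y => ?_)
  · simpa [clampT_of_mem ht] using env_le hv hΩ p t hx'
  · rw [clampT_of_mem ht]
    exact min_le_min le_rfl (hmin y.1 y.2)

lemma env_measurable (hv : PosSol A v Ω) (hΩ : Metric.closedBall 0 1 ×ˢ Icc (-1) 0 ⊆ Ω) :
    Measurable fun q : Spc m × ℝ => env v q.1 q.2 := by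
  refine UpperSemicontinuous.measurable ?_
  refine upperSemicontinuous_ciInf (fun q => env_bdd hv hΩ q.1 q.2) fun x => ?_
  refine Continuous.upperSemicontinuous ?_
  have h1 : Continuous fun s : ℝ => v (x.1, clampT s) := by
    refine continuous_iff_continuousAt.2 fun s => ?_
    exact ContinuousAt.comp (f := clampT) (g := fun r => v (x.1, r))
      (hv.solves (x.1, clampT s) (hΩ ⟨x.2, clampT_mem s⟩)).2.continuousAt
      clampT_continuous.continuousAt
  have h2 := clampT_continuous
  have h3 : Continuous fun q : Spc m × ℝ => v (x.1, clampT q.2) := h1.comp continuous_snd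
  have h4 : Continuous fun q : Spc m × ℝ => clampT q.2 := h2.comp continuous_snd
  have h5 : Continuous fun q : Spc m × ℝ => inner ℝ q.1 x.1 := by fun_prop
  refine continuous_const.min ?_
  have h6 := ((h3.add (continuous_const (y := ‖x.1‖ ^ 2))).sub h4).sub h5
  exact h6

lemma env_eq_cap (hv : PosSol A v Ω) (hΩ : Metric.closedBall 0 1 ×ˢ Icc (-1) 0 ⊆ Ω)
    {p : Spc m} (hp : ‖p‖ < 1 / 8) : env v p (-1) = 7 / 8 := by
  obtain ⟨x, hx, -, he⟩ := env_attained hv hΩ p (t := -1) (by simp)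
  rw [he, min_eq_left]
  obtain ⟨h1, h2⟩ := tilt_lower hv hΩ hp hx (t := -1) (by simp)
  nlinarith [sq_nonneg ‖x‖]

/-- Information at a contact point of the envelope. -/
lemma env_contact (hA : IsElliptic lam Lam A) (hlam : 0 < lam) (hv : PosSol A v Ω)
    (hΩ : Metric.closedBall 0 1 ×ˢ Icc (-1) 0 ⊆ Ω)
    {p : Spc m} (hp : ‖p‖ < 1 / 8) {t : ℝ} (ht : t ∈ Icc (-1 : ℝ) 0) (hlt : env v p t < 7 / 8) :
    ∃ x d : _, ‖x‖ < 1 ∧ v (x, t) < 1 ∧ env v p t = tilt v p (x, t) ∧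
      HasDerivAt (fun s => tilt v p (x, s)) d t ∧ -(2 * ((m + 1) * Lam) + 1) ≤ d ∧
      fderiv ℝ (fun y => v (y, t) + ‖y‖ ^ 2) x = innerSL ℝ p ∧
      (d ≤ 0 → |((sharp m).comp (D2 (fun y => v (y, t) + ‖y‖ ^ 2) x)).det| ≤
        ((2 * ((m + 1) * Lam) + 1) / lam) ^ (m + 1)) ∧
      ContDiffAt ℝ 2 (fun y => v (y, t) + ‖y‖ ^ 2) x := by
  obtain ⟨x, hx, hmin, he⟩ := env_attained hv hΩ p ht
  obtain ⟨h1, h2⟩ := tilt_lower hv hΩ hp hx ht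
  have hz : tilt v p (x, t) < 7 / 8 := by
    by_contra h; rw [he, min_eq_left (not_lt.1 h)] at hlt; exact lt_irrefl _ hlt
  have hx1 : ‖x‖ < 1 := by
    refine lt_of_le_of_ne hx fun h => ?_
    rw [h] at h1; linarith [ht.2]
  have hΩx : (x, t) ∈ Ω := hΩ ⟨by simpa using hx, ht⟩
  obtain ⟨hs1, hs2⟩ := hv.solves _ hΩx
  rw [Lop_eq _ _ _ hs1] at hs2
  have hn : ContDiffAt ℝ 2 (fun y : Spc m => ‖y‖ ^ 2) x := (contDiff_norm_sq ℝ).contDiffAt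
  have hw : ContDiffAt ℝ 2 (fun y => v (y, t) + ‖y‖ ^ 2) x := hs1.add hn
  have hloc : IsLocalMin (fun y => (v (y, t) + ‖y‖ ^ 2) - inner ℝ p y) x := by
    have : Metric.ball (0 : Spc m) 1 ∈ 𝓝 x := Metric.isOpen_ball.mem_nhds (by simpa using hx1)
    filter_upwards [this] with y hy
    have := hmin y (by simpa using (mem_ball_zero_iff.1 hy).le)
    simp only [tilt] at this
    linarith
  have hD2 : D2 (fun y => v (y, t) + ‖y‖ ^ 2) x = D2 (fun y => v (y, t)) x +
      (2 : ℝ) • innerForm m := by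
    rw [D2_add hs1 hn]
    congr 1
    simpa using D2_normSq_sub 0 x
  have hpos : ∀ ξ, 0 ≤ D2 (fun y => v (y, t) + ‖y‖ ^ 2) x ξ ξ := fun ξ => by
    have := D2_nonneg_of_isLocalMin (hw.sub (innerSL ℝ p).contDiff.contDiffAt) hloc ξ
    rwa [show D2 (fun y => (v (y, t) + ‖y‖ ^ 2) - innerSL ℝ p y) x = _ from
      D2_sub_const_inner hw p] at this
  have htr0 := trF_nonneg (hA.posSemidef hlam.le x) hpos
  have htrA := hA.trF_innerForm_le x
  have htr := hA.le_trF x hpos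
  have htrE : trF (A x) (D2 (fun y => v (y, t) + ‖y‖ ^ 2) x) =
      trF (A x) (D2 (fun y => v (y, t)) x) + 2 * trF (A x) (innerForm m) := by
    rw [hD2, trF_add, trF_smul]
  refine ⟨x, trF (A x) (D2 (fun y => v (y, t)) x) - 1, hx1, ?_, ?_, ?_, ?_, ?_, ?_, hw⟩
  · nlinarith [sq_nonneg ‖x‖, ht.2]
  · rw [he, min_eq_right hz.le]
  · have := ((hs2.add_const (‖x‖ ^ 2)).sub (hasDerivAt_id t)).sub_const (inner ℝ p x)
    exact this
  · linarith
  · have h0 := hloc.fderiv_eq_zero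
    have h3 : fderiv ℝ (fun y => (v (y, t) + ‖y‖ ^ 2) - innerSL ℝ p y) x =
        fderiv ℝ (fun y => v (y, t) + ‖y‖ ^ 2) x - innerSL ℝ p := by
      rw [fderiv_fun_sub (hw.differentiableAt (by norm_num)) (innerSL ℝ p).differentiableAt]
      congr 1
      exact (innerSL ℝ p).fderiv
    have h4 : fderiv ℝ (fun y => (v (y, t) + ‖y‖ ^ 2) - innerSL ℝ p y) x = 0 := h0
    rw [h3] at h4
    exact sub_eq_zero.1 h4
  · intro hd
    refine abs_det_sharp_le _ (fun a b => ?_) hpos ?_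
    · exact (hw.isSymmSndFDerivAt (by simp)) a b
    · rw [le_div_iff₀ hlam]
      linarith

end envelope

section envelope
variable {m : ℕ} {lam Lam : ℝ} {A : Spc m → Matrix (Fin (m + 1)) (Fin (m + 1)) ℝ}
  {v : Spc m × ℝ → ℝ} {Ω : Set (Spc m × ℝ)}

lemma env_monotoneOn (hA : IsElliptic lam Lam A) (hlam : 0 < lam) (hv : PosSol A v Ω)
    (hΩ : Metric.closedBall 0 1 ×ˢ Icc (-1) 0 ⊆ Ω) {p : Spc m} (hp : ‖p‖ < 1 / 8) {C : ℝ}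
    (hC0 : 0 < C) (hC : 2 * ((m + 1) * Lam) + 1 < C) :
    MonotoneOn (fun t => env v p t + C * t) (Icc (-1) 0) := by
  intro a ha b hb hab
  refine le_of_left_le (f := fun t => env v p t + C * t) hab ?_ ?_
  · intro t ht c hc
    have htI : t ∈ Icc (-1 : ℝ) 0 := ⟨ha.1.trans ht.1, ht.2.le.trans hb.2⟩
    obtain ⟨x, hx, hmin, he⟩ := env_attained hv hΩ p htI
    have e0 : c - C * t < env v p t := by linarith
    rw [he, lt_min_iff] at e0
    have e1 : ∀ y ∈ Metric.closedBall (0 : Spc m) 1, c - C * t < tilt v p (y, t) := fun y hy =>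
      e0.2.trans_le (hmin y (by simpa using hy))
    have e2 := eventually_right_forall (isCompact_closedBall (0 : Spc m) 1) e1 (fun y hy c hc => by
      have h1 : (y, t) ∈ Ω := hΩ (mk_mem_prod hy htI)
      exact (tilt_rlsc hv p h1 c hc).filter_mono (nhdsWithin_mono _ fun q hq => hq.2))
    have e3 : ∀ᶠ s in 𝓝[>] t, s ∈ Ioo t b := Ioo_mem_nhdsGT ht.2
    filter_upwards [e2.filter_mono (nhdsWithin_mono t Ioi_subset_Ici_self), e3] with s hs hst
    obtain ⟨x', hx', -, he'⟩ := env_attained hv hΩ p (t := s)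
      ⟨htI.1.trans hst.1.le, hst.2.le.trans hb.2⟩
    have : c - C * t < env v p s := by
      rw [he', lt_min_iff]
      exact ⟨e0.1, hs x' (by simpa using hx')⟩
    have : C * t ≤ C * s := mul_le_mul_of_nonneg_left hst.1.le hC0.le
    linarith
  · intro t ht
    have htI : t ∈ Icc (-1 : ℝ) 0 := ⟨ha.1.trans ht.1.le, ht.2.trans hb.2⟩
    have e4 : ∀ᶠ s in 𝓝[<] t, s ∈ Ioo a t := Ioo_mem_nhdsLT ht.1
    rcases lt_or_ge (env v p t) (7 / 8) with hlt | hge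
    · obtain ⟨x, d, hx, -, he, hd, hdC, -, -⟩ := env_contact hA hlam hv hΩ hp htI hlt
      have e5 := eventually_left_le_add hd (η := 2 * ((m + 1) * Lam) + 1) (by linarith) hC
      filter_upwards [e4, e5] with s hs hs2
      have h1 := env_le hv hΩ p s hx.le
      rw [clampT_of_mem ⟨ha.1.trans hs.1.le, hs.2.le.trans htI.2⟩] at h1
      have := h1.trans (min_le_right _ _)
      linarith
    · filter_upwards [e4] with s hs
      have h1 := (env_le hv hΩ p s (x := 0) (by simp)).trans (min_le_left _ _)
      have : C * s ≤ C * t := mul_le_mul_of_nonneg_left hs.2.le hC0.le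
      linarith

/-- The pairs (slope, time) for which the envelope drops. -/
def dropPairs (v : Spc m × ℝ → ℝ) : Set (Spc m × ℝ) := {q | q.2 ∈ dropSet (env v q.1)}

lemma measurableSet_frequently_lt_shift {F : Spc m × ℝ → ℝ} (h : Measurable F) :
    MeasurableSet {q : Spc m × ℝ | ∃ᶠ k : ℕ in atTop, F q < F (q.1, q.2 - 1 / ((k : ℝ) + 1))} := by
  have : {q : Spc m × ℝ | ∃ᶠ k : ℕ in atTop, F q < F (q.1, q.2 - 1 / ((k : ℝ) + 1))} =
      ⋂ N : ℕ, ⋃ k : ℕ, ⋃ _ : N ≤ k,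
      {q : Spc m × ℝ | F q < F (q.1, q.2 - 1 / ((k : ℝ) + 1))} := by
    ext q
    simp [frequently_atTop]
  rw [this]
  refine MeasurableSet.iInter fun N => MeasurableSet.iUnion fun k => MeasurableSet.iUnion fun _ => ?_
  have h2 : Measurable fun q : Spc m × ℝ => (q.1, q.2 - 1 / ((k : ℝ) + 1)) := by fun_prop
  have h3 : Measurable fun q : Spc m × ℝ => F (q.1, q.2 - 1 / ((k : ℝ) + 1)) := h.comp h2
  exact measurableSet_lt h h3

lemma dropPairs_measurable (hv : PosSol A v Ω)
    (hΩ : Metric.closedBall 0 1 ×ˢ Icc (-1) 0 ⊆ Ω) : MeasurableSet (dropPairs v) :=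
  measurableSet_frequently_lt_shift (env_measurable hv hΩ)

/-- Slopes for which the envelope drops at time `t` are covered by the gradient image of the
sublevel set. -/
lemma volume_dropPairs_slice_le (hA : IsElliptic lam Lam A) (hlam : 0 < lam) (hv : PosSol A v Ω)
    (hΩ : Metric.closedBall 0 1 ×ˢ Icc (-1) 0 ⊆ Ω) {t : ℝ} (ht : t ∈ Ioo (-1 : ℝ) 0) :
    volume {p : Spc m | ‖p‖ < 1 / 8 ∧ (p, t) ∈ dropPairs v} ≤
      ENNReal.ofReal (((2 * ((m + 1) * Lam) + 1) / lam) ^ (m + 1)) *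
        volume {x : Spc m | ‖x‖ < 1 ∧ v (x, t) < 1} := by
  have htI : t ∈ Icc (-1 : ℝ) 0 := Ioo_subset_Icc_self ht
  set C := ((2 * ((m + 1) * Lam) + 1) / lam) ^ (m + 1)
  set w : Spc m → ℝ := fun y => v (y, t) + ‖y‖ ^ 2 with hw
  have hC2 : ∀ x ∈ Metric.ball (0 : Spc m) 1, ContDiffAt ℝ 2 w x := fun x hx =>
    (hv.solves (x, t) (hΩ ⟨Metric.ball_subset_closedBall hx, htI⟩)).1.add
      (contDiff_norm_sq ℝ).contDiffAt
  set O : Set (Spc m) := {x | ‖x‖ < 1 ∧ v (x, t) < 1} with hO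
  have hOopen : IsOpen O := by
    have hc : ContinuousOn (fun x => v (x, t)) (Metric.ball (0 : Spc m) 1) := fun x hx =>
      ((hv.solves (x, t) (hΩ ⟨Metric.ball_subset_closedBall hx, htI⟩)).1.continuousAt
        ).continuousWithinAt
    have := hc.isOpen_inter_preimage Metric.isOpen_ball (isOpen_Iio (a := (1 : ℝ)))
    convert this using 1
    ext x; simp [hO]
  set S : Set (Spc m) := O ∩ {x | |((sharp m).comp (D2 w x)).det| ≤ C} with hS
  have hmD : Measurable (D2 w) := measurable_fderiv ℝ (fderiv ℝ w)
  have hSm : MeasurableSet S := by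
    refine hOopen.measurableSet.inter ?_
    have h1 : Continuous fun B : Spc m →L[ℝ] Spc m →L[ℝ] ℝ => |((sharp m).comp B).det| := by
      refine continuous_abs.comp (ContinuousLinearMap.continuous_det.comp ?_)
      exact (ContinuousLinearMap.compL ℝ (Spc m) (Spc m →L[ℝ] ℝ) (Spc m) (sharp m)).continuous
    exact measurableSet_le (h1.measurable.comp hmD) measurable_const
  have hder : ∀ x ∈ S, HasFDerivWithinAt (fun y => sharp m (fderiv ℝ w y))
      ((sharp m).comp (D2 w x)) S x := fun x hx => by
    have := (differentiableAt_fderiv (hC2 x (by simpa using hx.1.1))).hasFDerivAt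
    exact ((sharp m).hasFDerivAt.comp x this).hasFDerivWithinAt
  have himg := addHaar_image_le_lintegral_abs_det_fderiv volume hSm hder
  have hsub : {p : Spc m | ‖p‖ < 1 / 8 ∧ (p, t) ∈ dropPairs v} ⊆
      (fun y => sharp m (fderiv ℝ w y)) '' S := by
    rintro p ⟨hp, hd⟩
    have hd' : ∃ᶠ k : ℕ in atTop, env v p t < env v p (t - 1 / ((k : ℝ) + 1)) := hd
    have hlt : env v p t < 7 / 8 := by
      obtain ⟨k, hk⟩ := hd'.exists
      exact hk.trans_le ((env_le hv hΩ p _ (x := 0) (by simp)).trans (min_le_left _ _))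
    obtain ⟨x, d, hx, hv1, he, hder', -, hgrad, hdet, -⟩ := env_contact hA hlam hv hΩ hp htI hlt
    have hd0 : d ≤ 0 := by
      by_contra hpos
      push Not at hpos
      have h1 := (tendsto_left_slope hder').eventually (lt_mem_nhds hpos)
      have h2 : ∀ᶠ k : ℕ in atTop, t - 1 / ((k : ℝ) + 1) ∈ Ioo (-1) t :=
        (tendsto_sub_one_div t).eventually (Ioo_mem_nhdsLT ht.1)
      obtain ⟨k, hk1, hk2, hk3⟩ := (hd'.and_eventually (h1.and h2)).exists
      have h3 := (left_slope_ge hk3.2).1 hk2.le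
      have h4 := env_le hv hΩ p (t - 1 / ((k : ℝ) + 1)) hx.le
      rw [clampT_of_mem ⟨hk3.1.le, hk3.2.le.trans htI.2⟩] at h4
      have := h4.trans (min_le_right _ _)
      linarith
    refine ⟨x, ⟨⟨hx, hv1⟩, hdet hd0⟩, ?_⟩
    simp only [hw]
    rw [hgrad, sharp_innerSL]
  calc volume {p : Spc m | ‖p‖ < 1 / 8 ∧ (p, t) ∈ dropPairs v}
      ≤ volume ((fun y => sharp m (fderiv ℝ w y)) '' S) := measure_mono hsub
    _ ≤ ∫⁻ x in S, ENNReal.ofReal |((sharp m).comp (D2 w x)).det| := himg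
    _ ≤ ∫⁻ _ in S, ENNReal.ofReal C :=
        setLIntegral_mono measurable_const fun x hx => ENNReal.ofReal_le_ofReal hx.2
    _ = ENNReal.ofReal C * volume S := by simp
    _ ≤ ENNReal.ofReal C * volume O := by gcongr; exact inter_subset_left

end envelope

lemma lintegral_slice_le_prod {α : Type*} [MeasurableSpace α] {μ : Measure α} [SFinite μ]
    (s : Set (α × ℝ)) :
    ∫⁻ t : ℝ, μ ((fun x => (x, t)) ⁻¹' s) ≤ (μ.prod volume) s := by
  rw [← measure_toMeasurable s, Measure.prod_apply_symm (measurableSet_toMeasurable _ _)]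
  exact lintegral_mono fun t => measure_mono (preimage_mono (subset_toMeasurable _ _))

/-- The measure-to-point estimate. -/
theorem exists_measure_to_point (m : ℕ) {lam Lam : ℝ} (hlam : 0 < lam) (hLam : lam ≤ Lam) :
    ∃ μ₀ : ℝ, 0 < μ₀ ∧ ∀ (A : Spc m → Matrix (Fin (m + 1)) (Fin (m + 1)) ℝ),
      IsElliptic lam Lam A → ∀ (v : Spc m × ℝ → ℝ) (Ω : Set (Spc m × ℝ)), PosSol A v Ω →
      Metric.closedBall 0 1 ×ˢ Icc (-1) 0 ⊆ Ω →
      volume ((Metric.ball (0 : Spc m) 1 ×ˢ Ioo (-1 : ℝ) 0) ∩ {q | v q < 1}) ≤ ENNReal.ofReal μ₀ →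
      1 / 2 ≤ v (0, 0) := by
  have hLam0 : 0 < Lam := hlam.trans_le hLam
  set C₁ : ℝ := 2 * ((m + 1) * Lam) + 2 with hC₁
  have hC₁0 : 0 < C₁ := by positivity
  set C₂ : ℝ := ((2 * ((m + 1) * Lam) + 1) / lam) ^ (m + 1) with hC₂
  have hC₂0 : 0 < C₂ := by positivity
  set V : ℝ := (volume (Metric.ball (0 : Spc m) (1 / 8))).toReal with hV
  have hVfin : volume (Metric.ball (0 : Spc m) (1 / 8)) ≠ ⊤ := measure_ball_lt_top.ne
  have hV0 : 0 < V := ENNReal.toReal_pos (Metric.measure_ball_pos _ _ (by norm_num)).ne' hVfin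
  refine ⟨V * (1 / (8 * C₁)) / C₂, by positivity, fun A hA v Ω hv hΩ hμ => ?_⟩
  by_contra hlt
  push Not at hlt
  have hfib : ∀ p ∈ Metric.ball (0 : Spc m) (1 / 8), ENNReal.ofReal (3 / (8 * C₁)) ≤
      volume (dropSet (env v p) ∩ Ioo (-1) 0) := fun p hp => by
    have hp' : ‖p‖ < 1 / 8 := by simpa using hp
    have hmeas : MeasurableSet (dropSet (env v p)) :=
      (dropPairs_measurable hv hΩ).preimage (f := fun t : ℝ => (p, t)) (by fun_prop)
    have h1 := drop_le_measure (env_monotoneOn hA hlam hv hΩ hp' hC₁0 (by linarith)) hmeas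
    rw [env_eq_cap hv hΩ hp'] at h1
    have h2 : env v p 0 ≤ 1 / 2 := by
      have := (env_le hv hΩ p 0 (x := 0) (by simp)).trans (min_le_right _ _)
      rw [clampT_of_mem (by simp)] at this
      simp only [tilt, norm_zero, inner_zero_right] at this
      linarith
    refine ENNReal.ofReal_le_of_le_toReal ?_
    rw [div_le_iff₀ (by positivity)]
    linarith
  set Θ : Set (Spc m × ℝ) := dropPairs v ∩ Metric.ball (0 : Spc m) (1 / 8) ×ˢ Ioo (-1 : ℝ) 0 with hΘ
  have hΘm : MeasurableSet Θ := (dropPairs_measurable hv hΩ).inter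
    (measurableSet_ball.prod measurableSet_Ioo)
  have hlow : ENNReal.ofReal (V * (3 / (8 * C₁))) ≤ volume Θ := by
    rw [Measure.volume_eq_prod, Measure.prod_apply hΘm]
    calc ENNReal.ofReal (V * (3 / (8 * C₁)))
        = ∫⁻ _ in Metric.ball (0 : Spc m) (1 / 8), ENNReal.ofReal (3 / (8 * C₁)) := by
          rw [setLIntegral_const, ENNReal.ofReal_mul hV0.le, hV, ENNReal.ofReal_toReal hVfin,
            mul_comm]
      _ ≤ ∫⁻ p in Metric.ball (0 : Spc m) (1 / 8), volume (Prod.mk p ⁻¹' Θ) := by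
          refine setLIntegral_mono' measurableSet_ball fun p hp => (hfib p hp).trans ?_
          refine measure_mono fun t ht => ?_
          exact ⟨ht.1, hp, ht.2⟩
      _ ≤ _ := setLIntegral_le_lintegral _ _
  have hup : volume Θ ≤ ENNReal.ofReal C₂ *
      volume ((Metric.ball (0 : Spc m) 1 ×ˢ Ioo (-1 : ℝ) 0) ∩ {q | v q < 1}) := by
    rw [Measure.volume_eq_prod, Measure.prod_apply_symm hΘm]
    refine le_trans ?_ (mul_le_mul_right (lintegral_slice_le_prod _) _)
    rw [← lintegral_const_mul' _ _ ENNReal.ofReal_ne_top]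
    refine lintegral_mono fun t => ?_
    by_cases ht : t ∈ Ioo (-1 : ℝ) 0
    · refine le_trans (measure_mono ?_) ((volume_dropPairs_slice_le hA hlam hv hΩ ht).trans
        (mul_le_mul_right (measure_mono ?_) _))
      · intro p hp
        exact ⟨by simpa using hp.2.1, hp.1⟩
      · intro x hx
        exact ⟨⟨by simpa using hx.1, ht⟩, hx.2⟩
    · have : (fun x => (x, t)) ⁻¹' Θ = ∅ := by
        ext x; simp only [hΘ, mem_preimage, mem_inter_iff, mem_prod, mem_empty_iff_false, iff_false]
        exact fun h => ht h.2.2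
      rw [this]; simp
  have hfin := hlow.trans (hup.trans (mul_le_mul_right hμ _))
  rw [← ENNReal.ofReal_mul hC₂0.le, ENNReal.ofReal_le_ofReal_iff (by positivity)] at hfin
  have e : C₂ * (V * (1 / (8 * C₁)) / C₂) = V * (1 / (8 * C₁)) := by field_simp
  rw [e] at hfin
  have : 1 / (8 * C₁) < 3 / (8 * C₁) := by gcongr; norm_num
  nlinarith

section barrier
variable {m : ℕ} {lam Lam : ℝ} {A : Spc m → Matrix (Fin (m + 1)) (Fin (m + 1)) ℝ}

/-- Self-similar barrier with support in an expanding paraboloid. -/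
def bar (M : ℝ) (γ : ℕ) (r : ℝ) (x0 : Spc m) (t0 : ℝ) (q : Spc m × ℝ) : ℝ :=
  (max (r ^ 2 + M * (q.2 - t0) - ‖q.1 - x0‖ ^ 2) 0) ^ 2 / (max (r ^ 2 + M * (q.2 - t0)) (r ^ 2)) ^ γ

lemma bar_continuous {M r : ℝ} (γ : ℕ) (hr : 0 < r) (x0 : Spc m) (t0 : ℝ) :
    Continuous (bar M γ r x0 t0) := by
  unfold bar
  refine Continuous.div (by fun_prop) (by fun_prop) fun q => ?_
  have : 0 < max (r ^ 2 + M * (q.2 - t0)) (r ^ 2) := lt_max_of_lt_right (by positivity)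
  positivity

lemma bar_nonneg {M r : ℝ} (γ : ℕ) (hr : 0 < r) (x0 : Spc m) (t0 : ℝ) (q : Spc m × ℝ) :
    0 ≤ bar M γ r x0 t0 q := by
  unfold bar
  have : 0 < max (r ^ 2 + M * (q.2 - t0)) (r ^ 2) := lt_max_of_lt_right (by positivity)
  positivity

lemma bar_eq {M r : ℝ} (hM : 0 < M) (γ : ℕ) (x0 : Spc m) {t0 : ℝ} {q : Spc m × ℝ}
    (ht : t0 ≤ q.2) (hw : ‖q.1 - x0‖ ^ 2 ≤ r ^ 2 + M * (q.2 - t0)) :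
    bar M γ r x0 t0 q =
      (r ^ 2 + M * (q.2 - t0) - ‖q.1 - x0‖ ^ 2) ^ 2 / (r ^ 2 + M * (q.2 - t0)) ^ γ := by
  unfold bar
  have : 0 ≤ M * (q.2 - t0) := mul_nonneg hM.le (by linarith)
  rw [max_eq_left (by linarith), max_eq_left (by linarith)]

lemma bar_pos_iff {M r : ℝ} (γ : ℕ) (hr : 0 < r) (x0 : Spc m) {t0 : ℝ} {q : Spc m × ℝ} :
    0 < bar M γ r x0 t0 q ↔ ‖q.1 - x0‖ ^ 2 < r ^ 2 + M * (q.2 - t0) := by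
  have h2 : 0 < max (r ^ 2 + M * (q.2 - t0)) (r ^ 2) := lt_max_of_lt_right (by positivity)
  constructor
  · intro h
    by_contra hc
    unfold bar at h
    rw [max_eq_right (by linarith)] at h
    simp at h
  · intro h
    unfold bar
    have : 0 < max (r ^ 2 + M * (q.2 - t0) - ‖q.1 - x0‖ ^ 2) 0 := lt_max_of_lt_left (by linarith)
    positivity

lemma bar_le_init {M r : ℝ} (γ : ℕ) (hr : 0 < r) (x0 : Spc m) (t0 : ℝ) (x : Spc m) :
    bar M γ r x0 t0 (x, t0) ≤ r ^ 4 / (r ^ 2) ^ γ := by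
  unfold bar
  simp only [sub_self, mul_zero, add_zero, max_self]
  gcongr
  have : max (r ^ 2 - ‖x - x0‖ ^ 2) 0 ≤ r ^ 2 :=
    max_le (by linarith [sq_nonneg ‖x - x0‖]) (by positivity)
  calc _ ≤ (r ^ 2) ^ 2 := pow_le_pow_left₀ (le_max_right _ _) this 2
    _ = _ := by ring

lemma hasDerivAt_sq_div_pow {f g : ℝ → ℝ} {M t : ℝ} (hf : HasDerivAt f M t)
    (hg : HasDerivAt g M t) (h0 : 0 < g t) (γ : ℕ) :
    HasDerivAt (fun s => f s ^ 2 / g s ^ γ)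
      ((1 / g t ^ γ) * ((2 * f t * M * g t - γ * M * f t ^ 2) / g t)) t := by
  have h := (hf.fun_pow 2).fun_div (hg.fun_pow γ) (by positivity)
  refine h.congr_deriv ?_
  generalize g t = b at h0
  generalize f t = a
  rcases γ with _ | k
  · simp
    field_simp
  · simp only [Nat.cast_add, Nat.cast_one, add_tsub_cancel_right]
    field_simp
    ring

lemma bar_subsolution (hA : IsElliptic lam Lam A) (hlam : 0 < lam) {M r : ℝ} (hM : 0 < M) {γ : ℕ}
    (hγ : (2 * M + 8 * lam + 4 * ((m + 1) * Lam)) ^ 2 ≤ γ * M * (32 * lam)) (hr : 0 < r)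
    (x0 : Spc m) {t0 t : ℝ} {x : Spc m} (ht : t0 < t) (hpos : 0 < bar M γ r x0 t0 (x, t)) :
    ContDiffAt ℝ 2 (fun y => bar M γ r x0 t0 (y, t)) x ∧
      ∃ d, HasDerivAt (fun s => bar M γ r x0 t0 (x, s)) d t ∧
        d ≤ trF (A x) (D2 (fun y => bar M γ r x0 t0 (y, t)) x) := by
  rw [bar_pos_iff γ hr] at hpos
  simp only at hpos
  set τ := r ^ 2 + M * (t - t0) with hτ
  have hMt : 0 < M * (t - t0) := mul_pos hM (by linarith)
  have hτ0 : 0 < τ := by positivity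
  have e1 : (fun y => bar M γ r x0 t0 (y, t)) =ᶠ[𝓝 x]
      fun y => (1 / τ ^ γ) * (τ - ‖y - x0‖ ^ 2) ^ 2 := by
    have : ∀ᶠ y in 𝓝 x, ‖y - x0‖ ^ 2 < τ :=
      ((by fun_prop : Continuous fun y : Spc m => ‖y - x0‖ ^ 2).tendsto x).eventually_lt_const hpos
    filter_upwards [this] with y hy
    rw [bar_eq (q := (y, t)) hM γ x0 ht.le hy.le]
    simp only [← hτ]
    ring
  have e2 : (fun s => bar M γ r x0 t0 (x, s)) =ᶠ[𝓝 t]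
      fun s => (r ^ 2 + M * (s - t0) - ‖x - x0‖ ^ 2) ^ 2 / (r ^ 2 + M * (s - t0)) ^ γ := by
    have : ∀ᶠ s in 𝓝 t, ‖x - x0‖ ^ 2 < r ^ 2 + M * (s - t0) :=
      ((by fun_prop : Continuous fun s => r ^ 2 + M * (s - t0)).tendsto t).eventually_const_lt hpos
    filter_upwards [this, lt_mem_nhds ht] with s hs hs2
    rw [bar_eq (q := (x, s)) hM γ x0 hs2.le hs.le]
  set w := τ - ‖x - x0‖ ^ 2 with hw
  have hw0 : 0 < w := by simp only [hw]; linarith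
  have hsm : ContDiff ℝ 2 fun y : Spc m => (τ - ‖y - x0‖ ^ 2) ^ 2 :=
    (contDiff_const.sub (contDiff_normSq_sub x0)).pow 2
  refine ⟨((contDiff_const.mul hsm).contDiffAt).congr_of_eventuallyEq e1, ?_⟩
  have hD : D2 (fun y => bar M γ r x0 t0 (y, t)) x = (1 / τ ^ γ) •
      ((8 : ℝ) • rankOne (x - x0) - (4 * w) • innerForm m) := by
    have : D2 (fun y => bar M γ r x0 t0 (y, t)) x =
        D2 (fun y => (1 / τ ^ γ) * (τ - ‖y - x0‖ ^ 2) ^ 2) x := by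
      unfold D2
      exact (e1.fderiv (𝕜 := ℝ)).fderiv_eq
    rw [this, D2_const_mul, D2_sq_sub_normSq]
  have hl : HasDerivAt (fun s => r ^ 2 + M * (s - t0)) M t := by
    simpa using (((hasDerivAt_id t).sub_const t0).const_mul M).const_add (r ^ 2)
  have hd := hasDerivAt_sq_div_pow (hl.sub_const (‖x - x0‖ ^ 2)) hl (show 0 < τ from hτ0) γ
  refine ⟨_, hd.congr_of_eventuallyEq e2, ?_⟩
  simp only [← hτ, ← hw]
  rw [hD, trF_smul, trF_sub, trF_smul, trF_smul, trF_rankOne]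
  have h1 := (hA.2 x (x - x0)).1
  have h2 := hA.trF_innerForm_le x
  have hn : ‖x - x0‖ ^ 2 = τ - w := by simp [hw]
  rw [hn] at h1
  set S := ∑ i, ∑ j, (x - x0) i * A x i j * (x - x0) j
  have h3 : 8 * (lam * (τ - w)) - 4 * w * ((m + 1) * Lam) ≤
      8 * S - 4 * w * trF (A x) (innerForm m) := by
    have := mul_le_mul_of_nonneg_left h2 (by positivity : 0 ≤ 4 * w)
    linarith
  set B := 2 * M + 8 * lam + 4 * ((m + 1) * Lam) with hB
  have hquad : 0 ≤ γ * M * w ^ 2 - B * w * τ + 8 * lam * τ ^ 2 := by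
    have : 0 ≤ (32 * lam) * (γ * M * w ^ 2 - B * w * τ + 8 * lam * τ ^ 2) := by
      nlinarith [sq_nonneg (B * w - 16 * lam * τ), mul_le_mul_of_nonneg_right hγ (sq_nonneg w)]
    exact nonneg_of_mul_nonneg_right this (by positivity)
  have h4 : (2 * w * M * τ - γ * M * w ^ 2) / τ ≤
      8 * (lam * (τ - w)) - 4 * w * ((m + 1) * Lam) := by
    rw [div_le_iff₀ hτ0]
    nlinarith
  exact
    mul_le_mul_of_nonneg_left (h4.trans h3) (by positivity)

lemma exists_bar_exponent (hlam : 0 < lam) (B : ℝ) {M : ℝ} (hM : 0 < M) :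
    ∃ γ : ℕ, B ≤ γ * M * (32 * lam) := by
  obtain ⟨γ, hγ⟩ := exists_nat_ge (B / (M * (32 * lam)))
  refine ⟨γ, ?_⟩
  rw [div_le_iff₀ (by positivity)] at hγ
  linarith

/-- Propagation of positivity from a ball, with polynomial loss. -/
theorem exists_propagation (m : ℕ) {lam Lam : ℝ} (hlam : 0 < lam) {M : ℝ} (hM : 0 < M) :
    ∃ γ : ℕ, ∀ (A : Spc m → Matrix (Fin (m + 1)) (Fin (m + 1)) ℝ),
      IsElliptic lam Lam A → ∀ (v : Spc m × ℝ → ℝ) (Ω : Set (Spc m × ℝ)), PosSol A v Ω →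
      ∀ (x0 : Spc m) (t0 r T R k : ℝ), 0 < r → 0 ≤ k → r ^ 2 + M * T ≤ R ^ 2 → 0 ≤ R →
      Metric.closedBall x0 R ×ˢ Icc t0 (t0 + T) ⊆ Ω →
      (∀ y ∈ Metric.closedBall x0 r, k ≤ v (y, t0)) →
      ∀ s ∈ Icc t0 (t0 + T), ∀ y, ‖y - x0‖ ^ 2 ≤ M * (s - t0) →
        k * (r ^ 2 / (r ^ 2 + M * (s - t0))) ^ γ ≤ v (y, s) := by
  obtain ⟨γ, hγ⟩ := exists_bar_exponent hlam ((2 * M + 8 * lam + 4 * ((m + 1) * Lam)) ^ 2) hM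
  refine ⟨γ, fun A hA v Ω hv x0 t0 r T R k hr hk hR hR0 hΩ hini s hs y hy => ?_⟩
  set c : ℝ := k * (r ^ 2) ^ γ / r ^ 4 with hc
  have hc0 : 0 ≤ c := by positivity
  have hsM : M * (s - t0) ≤ M * T := by
    apply mul_le_mul_of_nonneg_left _ hM.le
    linarith [hs.2]
  have key := hv.barrier_le hA hlam.le (isCompact_closedBall x0 R) (a := t0) (b := t0 + T)
    (fun x hx t ht => hΩ (mk_mem_prod hx ht)) (φ := fun q => c * bar M γ r x0 t0 q)
    (continuous_const.mul (bar_continuous γ hr x0 t0)) ?_ ?_ s hs y ?_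
  · refine le_trans ?_ key
    have hy' : ‖y - x0‖ ^ 2 ≤ r ^ 2 + M * (s - t0) := by nlinarith
    have hM0 : 0 ≤ M * (s - t0) := mul_nonneg hM.le (by linarith [hs.1])
    rw [bar_eq (q := (y, s)) hM γ x0 hs.1 hy']
    simp only
    set τ := r ^ 2 + M * (s - t0) with hτ
    have hτ0 : 0 < τ := by positivity
    have h5 : r ^ 4 ≤ (τ - ‖y - x0‖ ^ 2) ^ 2 := by
      calc r ^ 4 = (r ^ 2) ^ 2 := by ring
        _ ≤ _ := pow_le_pow_left₀ (by positivity) (by linarith) 2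
    calc _ = c * (r ^ 4 / τ ^ γ) := by
          rw [hc, div_pow]; field_simp
      _ ≤ _ := by gcongr
  · intro x hx
    by_cases hxr : x ∈ Metric.closedBall x0 r
    · refine le_trans ?_ (hini x hxr)
      calc c * bar M γ r x0 t0 (x, t0) ≤ c * (r ^ 4 / (r ^ 2) ^ γ) :=
            mul_le_mul_of_nonneg_left (bar_le_init γ hr x0 t0 x) hc0
        _ = k := by rw [hc]; field_simp
    · have h6 : ¬ 0 < bar M γ r x0 t0 (x, t0) := by
        rw [bar_pos_iff γ hr]
        rw [mem_closedBall_iff_norm] at hxr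
        push Not at hxr ⊢
        simp only [sub_self, mul_zero, add_zero]
        gcongr
      have h7 : bar M γ r x0 t0 (x, t0) = 0 := le_antisymm (not_lt.1 h6) (bar_nonneg γ hr _ _ _)
      simp only [h7, mul_zero]
      exact hv.nonneg _ (hΩ (mk_mem_prod hx ⟨le_rfl, hs.1.trans hs.2⟩))
  · intro t ht x hx hpos
    have hcp : 0 < c := lt_of_le_of_ne hc0 fun h => by simp [← h] at hpos
    have hbp : 0 < bar M γ r x0 t0 (x, t) := pos_of_mul_pos_right hpos hc0
    obtain ⟨h1, d, h2, h3⟩ := bar_subsolution hA hlam hM hγ hr x0 ht.1 hbp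
    rw [bar_pos_iff γ hr] at hbp
    refine ⟨?_, contDiffAt_const.mul h1, c * d, h2.const_mul c, ?_⟩
    · apply Metric.ball_subset_interior_closedBall
      rw [mem_ball_iff_norm]
      refine lt_of_pow_lt_pow_left₀ 2 hR0 (hbp.trans_le ?_)
      have : M * (t - t0) ≤ M * T := mul_le_mul_of_nonneg_left (by linarith [ht.2]) hM.le
      simp only
      linarith
    · rw [D2_const_mul, trF_smul]
      exact mul_le_mul_of_nonneg_left h3 hc0
  · rw [mem_closedBall_iff_norm]
    refine le_of_sq_le_sq ?_ hR0
    nlinarith [sq_nonneg r]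

end barrier

section covering
variable {m : ℕ} {lam Lam : ℝ} {A : Spc m → Matrix (Fin (m + 1)) (Fin (m + 1)) ℝ}

lemma volume_preimage_pdil_le (p : Spc m × ℝ) {r : ℝ} (hr : 0 < r) (S : Set (Spc m × ℝ)) :
    volume (pdil p r ⁻¹' S) ≤ ENNReal.ofReal ((r ^ (m + 3))⁻¹) * volume S := by
  have e : pdil p r = Prod.map ((fun x => p.1 + x) ∘ fun x : Spc m => r • x)
      ((fun t => p.2 + t) ∘ fun t : ℝ => r ^ 2 • t) := by
    rfl
  have h1 : Measure.map (pdil p r) volume = ENNReal.ofReal ((r ^ (m + 3))⁻¹) •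
      (volume : Measure (Spc m × ℝ)) := by
    rw [e, Measure.volume_eq_prod, ← Measure.map_prod_map _ _ (by fun_prop) (by fun_prop),
      ← Measure.map_map (by fun_prop) (by fun_prop), ← Measure.map_map (by fun_prop) (by fun_prop),
      Measure.map_addHaar_smul _ hr.ne', Measure.map_addHaar_smul _ (by positivity : r ^ 2 ≠ 0),
      Measure.map_smul, Measure.map_smul, map_add_left_eq_self, map_add_left_eq_self,
      Measure.prod_smul_left, Measure.prod_smul_right, smul_smul,
      ← ENNReal.ofReal_mul (by positivity)]
    congr 2
    rw [abs_of_pos (by positivity), abs_of_pos (by positivity), ← mul_inv]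
    simp
    ring
  calc _ ≤ Measure.map (pdil p r) volume S :=
        Measure.le_map_apply (by unfold pdil; fun_prop) S
    _ = _ := by rw [h1]; simp

lemma pdil_continuous (p : Spc m × ℝ) (r : ℝ) : Continuous (pdil p r) := by
  unfold pdil; fun_prop

lemma RLSC.pdil {u : Spc m × ℝ → ℝ} {p q : Spc m × ℝ} {r : ℝ} (h : RLSC u (pdil p r q)) :
    RLSC (fun q => u (_root_.pdil p r q)) q := by
  intro c hc
  have ht : Tendsto (_root_.pdil p r) (𝓝[{z | q.2 ≤ z.2}] q)
      (𝓝[{z | (_root_.pdil p r q).2 ≤ z.2}] (_root_.pdil p r q)) := by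
    refine tendsto_nhdsWithin_iff.2
      ⟨((pdil_continuous p r).tendsto q).mono_left nhdsWithin_le_nhds, ?_⟩
    filter_upwards [self_mem_nhdsWithin] with z hz
    have : q.2 ≤ z.2 := hz
    simp only [_root_.pdil]
    gcongr
  exact ht.eventually (h c hc)

lemma PosSol.pdil {v : Spc m × ℝ → ℝ} {Ω : Set (Spc m × ℝ)} (h : PosSol A v Ω) (p : Spc m × ℝ)
    (r : ℝ) : PosSol (fun x => A (p.1 + r • x)) (fun q => v (_root_.pdil p r q))
      (_root_.pdil p r ⁻¹' Ω) :=
  ⟨h.solves.pdil p r, fun _ hq => h.nonneg _ hq, fun _ hq => (h.rlsc _ hq).pdil⟩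

lemma PosSol.const_mul {v : Spc m × ℝ → ℝ} {Ω : Set (Spc m × ℝ)} (h : PosSol A v Ω) {c : ℝ}
    (hc : 0 < c) : PosSol A (fun q => c * v q) Ω := by
  refine ⟨fun p hp => ?_, fun p hp => mul_nonneg hc.le (h.nonneg p hp), fun p hp b hb => ?_⟩
  · obtain ⟨h1, h2⟩ := h.solves p hp
    have h3 : ContDiffAt ℝ 2 (fun y => c * v (y, p.2)) p.1 := contDiffAt_const.mul h1
    refine ⟨h3, ?_⟩
    rw [Lop_eq _ _ _ h3, D2_const_mul, trF_smul]
    rw [Lop_eq _ _ _ h1] at h2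
    exact h2.const_mul c
  · have := h.rlsc p hp (b / c) (by rw [div_lt_iff₀ hc]; linarith)
    filter_upwards [this] with q hq
    rw [div_lt_iff₀ hc] at hq
    linarith

theorem exists_measure_to_point_scaled (m : ℕ) {lam Lam : ℝ} (hlam : 0 < lam) (hLam : lam ≤ Lam) :
    ∃ μ₀ : ℝ, 0 < μ₀ ∧ ∀ (A : Spc m → Matrix (Fin (m + 1)) (Fin (m + 1)) ℝ),
      IsElliptic lam Lam A → ∀ (v : Spc m × ℝ → ℝ) (Ω : Set (Spc m × ℝ)), PosSol A v Ω →
      ∀ (x0 : Spc m) (t0 r k : ℝ), 0 < r → 0 < k →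
      Metric.closedBall x0 r ×ˢ Icc (t0 - r ^ 2) t0 ⊆ Ω →
      volume ((Metric.ball x0 r ×ˢ Ioo (t0 - r ^ 2) t0) ∩ {q | v q < k}) ≤
        ENNReal.ofReal (μ₀ * r ^ (m + 3)) →
      k / 2 ≤ v (x0, t0) := by
  obtain ⟨μ₀, hμ, H⟩ := exists_measure_to_point m hlam hLam
  refine ⟨μ₀, hμ, fun A hA v Ω hv x0 t0 r k hr hk hΩ hvol => ?_⟩
  have key := H _ (hA.affine x0 r) _ _ ((hv.const_mul (inv_pos.2 hk)).pdil (x0, t0) r) ?_ ?_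
  · simp only [pdil, smul_zero, add_zero, mul_zero] at key
    rw [inv_mul_eq_div, le_div_iff₀ hk] at key
    linarith
  · rintro ⟨x, t⟩ ⟨hx, ht⟩
    apply hΩ
    simp only [mem_closedBall_zero_iff, mem_Icc] at hx ht
    refine ⟨?_, ?_, ?_⟩
    · simp only [pdil, mem_closedBall_iff_norm, add_sub_cancel_left, norm_smul, Real.norm_eq_abs,
        abs_of_pos hr]
      nlinarith
    · simp only [pdil]; nlinarith [sq_nonneg r]
    · simp only [pdil]; nlinarith [sq_nonneg r]
  · refine (measure_mono ?_).trans ((volume_preimage_pdil_le (x0, t0) hr _).trans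
      ((mul_le_mul_right hvol _).trans ?_))
    · rintro ⟨x, t⟩ ⟨⟨hx, ht⟩, hv1⟩
      simp only [mem_ball_zero_iff, mem_Ioo] at hx ht
      have hr2 : 0 < r ^ 2 := by positivity
      refine ⟨⟨?_, ?_, ?_⟩, ?_⟩
      · simp only [pdil, mem_ball_iff_norm, add_sub_cancel_left, norm_smul, Real.norm_eq_abs,
          abs_of_pos hr]
        nlinarith
      · simp only [pdil]; nlinarith
      · simp only [pdil]; nlinarith
      · simp only [mem_ofPred_eq, inv_mul_eq_div, div_lt_one hk] at hv1 ⊢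
        exact hv1
    · rw [← ENNReal.ofReal_mul (by positivity)]
      apply ENNReal.ofReal_le_ofReal
      apply le_of_eq
      field_simp

/-- A set which misses a forward half-neighbourhood of each of its points is null. -/
lemma volume_eq_zero_of_forward_gap {N : Set (Spc m × ℝ)}
    (h : ∀ p ∈ N, ∃ ε > 0, Disjoint (Metric.ball p.1 ε ×ˢ Ioo p.2 (p.2 + ε)) N) :
    volume N = 0 := by
  have hae := Besicovitch.ae_tendsto_measure_inter_div (volume : Measure (Spc m × ℝ)) N
  rw [ae_iff] at hae
  refine (Measure.restrict_apply_superset fun p hp => ?_).symm.trans hae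
  intro hlim
  obtain ⟨ε, hε, hd⟩ := h p hp
  have hle : ∀ᶠ r in 𝓝[>] (0 : ℝ), volume (N ∩ Metric.closedBall p r) /
      volume (Metric.closedBall p r) ≤ 1 / 2 := by
    filter_upwards [Ioo_mem_nhdsGT hε] with r hr
    have hsub : N ∩ Metric.closedBall p r ⊆ Metric.closedBall p.1 r ×ˢ Icc (p.2 - r) p.2 := by
      rintro q ⟨hqN, hq⟩
      rw [← closedBall_prod_same] at hq
      obtain ⟨hq1, hq2⟩ := hq
      rw [Real.closedBall_eq_Icc] at hq2
      refine ⟨hq1, hq2.1, ?_⟩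
      by_contra hc
      push Not at hc
      refine disjoint_left.1 hd ⟨?_, hc, ?_⟩ hqN
      · exact Metric.closedBall_subset_ball hr.2 hq1
      · linarith [hq2.2, hr.2]
    have h1 : volume (Metric.closedBall p r) = volume (Metric.closedBall p.1 r) *
        (2 * ENNReal.ofReal r) := by
      rw [← closedBall_prod_same, Measure.volume_eq_prod, Measure.prod_prod, Real.volume_closedBall,
        ENNReal.ofReal_mul (by norm_num)]
      simp
    have h2 : volume (Metric.closedBall p.1 r ×ˢ Icc (p.2 - r) p.2) =
        volume (Metric.closedBall p.1 r) * ENNReal.ofReal r := by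
      rw [Measure.volume_eq_prod, Measure.prod_prod, Real.volume_Icc]
      congr 2; ring
    refine ENNReal.div_le_of_le_mul ((measure_mono hsub).trans (le_of_eq ?_))
    rw [h1, h2, mul_left_comm _ 2, ← mul_assoc (1 / 2), one_div,
      ENNReal.inv_mul_cancel (by norm_num) (by norm_num), one_mul]
  have := le_of_tendsto hlim hle
  norm_num at this

/-- Extending finitely many intervals backwards by a fraction `1 / M` of their length increases the
measure of the union at most by the factor `1 + 1 / M`. -/
lemma volume_iUnion_extended_le {ι : Type*} {M : ℝ} (hM : 0 < M) (s : Finset ι) (l a b : ι → ℝ)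
    (hla : ∀ i ∈ s, l i ≤ a i) (hab : ∀ i ∈ s, a i ≤ b i)
    (h : ∀ i ∈ s, M * (a i - l i) ≤ b i - a i) :
    volume (⋃ i ∈ s, Ioo (l i) (b i)) ≤
      ENNReal.ofReal (1 + 1 / M) * volume (⋃ i ∈ s, Ioo (a i) (b i)) := by
  induction hn : s.card generalizing s l a b with
  | zero =>
    rw [Finset.card_eq_zero] at hn
    simp [hn]
  | succ n ih =>
    have hne : s.Nonempty := Finset.card_pos.1 (by omega)
    obtain ⟨i, hi, hmin⟩ := s.exists_min_image l hne
    set B := b i with hB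
    have key := ih (s.erase i) (fun j => max (l j) B) (fun j => max (a j) B) (fun j => max (b j) B)
      (fun j hj => max_le_max_right _ (hla j (Finset.mem_of_mem_erase hj)))
      (fun j hj => max_le_max_right _ (hab j (Finset.mem_of_mem_erase hj))) ?_
      (by rw [Finset.card_erase_of_mem hi, hn]; rfl)
    · have h1 : ⋃ j ∈ s, Ioo (l j) (b j) ⊆ Icc (l i) B ∪
          ⋃ j ∈ s.erase i, Ioo (max (l j) B) (max (b j) B) := by
        intro x hx
        obtain ⟨j, hj, hxj⟩ := mem_iUnion₂.1 hx
        rcases le_or_gt x B with hxB | hxB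
        · exact Or.inl ⟨(hmin j hj).trans hxj.1.le, hxB⟩
        · refine Or.inr (mem_iUnion₂.2 ⟨j, Finset.mem_erase.2 ⟨?_, hj⟩, max_lt hxj.1 hxB,
            lt_max_of_lt_left hxj.2⟩)
          rintro rfl
          exact absurd hxj.2 (not_lt.2 hxB.le)
      have h2 : Ioo (a i) B ∪ ⋃ j ∈ s.erase i, Ioo (max (a j) B) (max (b j) B) ⊆
          ⋃ j ∈ s, Ioo (a j) (b j) := by
        rintro x (hx | hx)
        · exact mem_iUnion₂.2 ⟨i, hi, hx⟩
        · obtain ⟨j, hj, hxj⟩ := mem_iUnion₂.1 hx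
          have hBx : B < x := (le_max_right _ _).trans_lt hxj.1
          refine mem_iUnion₂.2 ⟨j, Finset.mem_of_mem_erase hj, (le_max_left _ _).trans_lt hxj.1, ?_⟩
          rcases lt_max_iff.1 hxj.2 with h' | h'
          · exact h'
          · exact absurd h' (not_lt.2 hBx.le)
      have h3 : Disjoint (Ioo (a i) B) (⋃ j ∈ s.erase i, Ioo (max (a j) B) (max (b j) B)) := by
        rw [disjoint_left]
        intro x hx hx2
        obtain ⟨j, hj, hxj⟩ := mem_iUnion₂.1 hx2
        exact absurd ((le_max_right _ _).trans_lt hxj.1) (not_lt.2 hx.2.le)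
      have hm2 : MeasurableSet (⋃ j ∈ s.erase i, Ioo (max (a j) B) (max (b j) B)) :=
        Finset.measurableSet_biUnion _ fun _ _ => measurableSet_Ioo
      refine (measure_mono h1).trans ((measure_union_le _ _).trans ?_)
      refine le_trans ?_ (mul_le_mul_right (measure_mono h2) _)
      rw [measure_union h3 hm2, mul_add]
      refine add_le_add ?_ key
      rw [Real.volume_Icc, Real.volume_Ioo, ← ENNReal.ofReal_mul (by positivity)]
      apply ENNReal.ofReal_le_ofReal
      have h4 := h i hi
      have h5 : a i - l i ≤ (b i - a i) / M := by rw [le_div_iff₀ hM]; linarith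
      have h6 : (1 + 1 / M) * (B - a i) = (b i - a i) + (b i - a i) / M := by rw [hB]; ring
      rw [h6]; linarith
    · intro j hj
      have hj' := Finset.mem_of_mem_erase hj
      have h1 := hla j hj'
      have h2 := hab j hj'
      have h3 := h j hj'
      rcases le_total (a j) B with h4 | h4
      · simp only [max_eq_right h4, max_eq_right (h1.trans h4), sub_self, mul_zero]
        have := le_max_right (b j) B
        linarith
      · rw [max_eq_left h4, max_eq_left (h4.trans h2)]
        refine le_trans ?_ h3
        have := le_max_left (l j) B
        nlinarith

end covering

section growth
variable {m : ℕ}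

/-- Forward parabolic cylinder. -/
def fcyl (p : Spc m × ℝ) (r : ℝ) : Set (Spc m × ℝ) := Metric.ball p.1 r ×ˢ Ioo p.2 (p.2 + r ^ 2)

/-- The stack of height `M` above the forward cylinder. -/
def stack (M : ℝ) (p : Spc m × ℝ) (r : ℝ) : Set (Spc m × ℝ) :=
  Metric.ball p.1 r ×ˢ Ioo (p.2 + r ^ 2) (p.2 + (1 + M) * r ^ 2)

lemma fcyl_isOpen (p : Spc m × ℝ) (r : ℝ) : IsOpen (fcyl p r) := Metric.isOpen_ball.prod isOpen_Ioo

lemma stack_isOpen (M : ℝ) (p : Spc m × ℝ) (r : ℝ) : IsOpen (stack M p r) :=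
  Metric.isOpen_ball.prod isOpen_Ioo

lemma fcyl_nonempty (p : Spc m × ℝ) {r : ℝ} (hr : 0 < r) : (fcyl p r).Nonempty :=
  ⟨(p.1, p.2 + r ^ 2 / 2), Metric.mem_ball_self hr, by
    have : 0 < r ^ 2 := by positivity
    constructor <;> simp only <;> linarith⟩

lemma volume_fcyl (p : Spc m × ℝ) {r : ℝ} (hr : 0 < r) :
    volume (fcyl p r) = ENNReal.ofReal (r ^ (m + 3)) * volume (Metric.ball (0 : Spc m) 1) := by
  rw [fcyl, Measure.volume_eq_prod, Measure.prod_prod, Real.volume_Ioo,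
    Measure.addHaar_ball _ _ hr.le, mul_right_comm, ← ENNReal.ofReal_mul (by positivity)]
  congr 2
  simp
  ring

lemma volume_box (x : Spc m) (t : ℝ) {r : ℝ} (hr : 0 < r) :
    volume (Metric.ball x (3 * r) ×ˢ Icc (t - 4 * r ^ 2) (t + 4 * r ^ 2)) =
      ENNReal.ofReal (8 * 3 ^ (m + 1)) * volume (fcyl (x, t) r) := by
  rw [volume_fcyl _ hr, Measure.volume_eq_prod, Measure.prod_prod, Real.volume_Icc,
    Measure.addHaar_ball _ _ (by positivity), mul_right_comm, ← ENNReal.ofReal_mul (by positivity),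
    ← mul_assoc, ← ENNReal.ofReal_mul (by positivity)]
  congr 2
  simp
  ring

lemma volume_biUnion_fcyl_le {M : ℝ} (hM : 0 < M) (F : Finset (Spc m × ℝ)) (r : Spc m × ℝ → ℝ) :
    volume (⋃ p ∈ F, fcyl p (r p)) ≤
      ENNReal.ofReal (1 + 1 / M) * volume (⋃ p ∈ F, stack M p (r p)) := by
  have ho : IsOpen (⋃ p ∈ F, stack M p (r p)) := isOpen_biUnion fun p _ => stack_isOpen M p _
  have ho' : IsOpen (⋃ p ∈ F, fcyl p (r p)) := isOpen_biUnion fun p _ => fcyl_isOpen p _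
  rw [Measure.volume_eq_prod, Measure.prod_apply ho.measurableSet,
    Measure.prod_apply ho'.measurableSet, ← lintegral_const_mul' _ _ ENNReal.ofReal_ne_top]
  refine lintegral_mono fun x => ?_
  have h := volume_iUnion_extended_le hM (F.filter fun p => x ∈ Metric.ball p.1 (r p))
    (fun p => p.2) (fun p => p.2 + r p ^ 2) (fun p => p.2 + (1 + M) * r p ^ 2)
    (fun p _ => by have := sq_nonneg (r p); linarith)
    (fun p _ => by have := mul_nonneg hM.le (sq_nonneg (r p)); linarith)
    (fun p _ => by linarith)
  refine (measure_mono ?_).trans (h.trans (mul_le_mul_right (measure_mono ?_) _))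
  · intro t ht
    obtain ⟨p, hp, hpt⟩ := mem_iUnion₂.1 ht
    refine mem_iUnion₂.2 ⟨p, Finset.mem_filter.2 ⟨hp, hpt.1⟩, hpt.2.1, hpt.2.2.trans_le ?_⟩
    have := mul_nonneg hM.le (sq_nonneg (r p))
    linarith
  · intro t ht
    obtain ⟨p, hp, hpt⟩ := mem_iUnion₂.1 ht
    rw [Finset.mem_filter] at hp
    exact mem_iUnion₂.2 ⟨p, hp.1, hp.2, hpt⟩

/-- Growth of open sets by stacks of cylinders in which they are dense. -/
theorem exists_stacks {μ : ℝ} (hμ : 0 < μ) (hμ1 : μ < 1) {E : Set (Spc m × ℝ)} (hE : IsOpen E)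
    (hEv : volume E ≠ ⊤) (hE0 : volume E ≠ 0) {ρ : ℝ} (hρ : 0 < ρ)
    (hsparse : ∀ p ∈ E, ENNReal.ofReal μ * volume (fcyl p ρ) < volume (fcyl p ρ \ E)) :
    ∃ (F : Finset (Spc m × ℝ)) (r : Spc m × ℝ → ℝ),
      (∀ p ∈ F, p ∈ E ∧ 0 < r p ∧ r p ≤ ρ ∧
        volume (fcyl p (r p / 2) \ E) ≤ ENNReal.ofReal μ * volume (fcyl p (r p / 2))) ∧
      ENNReal.ofReal (1 + μ / (64 * 3 ^ (m + 1))) * volume E ≤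
        volume (⋃ p ∈ F, stack (32 * 3 ^ (m + 1) / μ) p (r p)) := by
  have hk : ∀ p ∈ E, ∃ k : ℕ,
      volume (fcyl p (ρ / 2 ^ k) \ E) ≤ ENNReal.ofReal μ * volume (fcyl p (ρ / 2 ^ k)) := by
    intro p hp
    obtain ⟨ε, hε, hb⟩ := Metric.isOpen_iff.1 hE p hp
    have ht : Tendsto (fun k : ℕ => ρ / 2 ^ k) atTop (𝓝 0) := by
      have := (tendsto_pow_atTop_nhds_zero_of_lt_one (r := (1 / 2 : ℝ)) (by norm_num)
        (by norm_num)).const_mul ρ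
      simpa [div_eq_mul_inv] using this
    obtain ⟨k, hk1, hk2⟩ := ((ht.eventually (gt_mem_nhds hε)).and
      (ht.eventually (gt_mem_nhds one_pos))).exists
    refine ⟨k, ?_⟩
    have h0 : 0 < ρ / 2 ^ k := by positivity
    have : fcyl p (ρ / 2 ^ k) ⊆ E := by
      refine Subset.trans ?_ hb
      rw [← ball_prod_same]
      rintro q ⟨hq1, hq2⟩
      refine ⟨Metric.ball_subset_ball hk1.le hq1, ?_⟩
      rw [Real.ball_eq_Ioo]
      have : (ρ / 2 ^ k) ^ 2 < ε := by nlinarith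
      exact ⟨by linarith [hq2.1], by linarith [hq2.2]⟩
    rw [sdiff_eq_bot_iff.2 this]
    simp
  choose! k hkP hkmin using fun p hp => (⟨Nat.find (hk p hp), Nat.find_spec (hk p hp),
    fun j hj => Nat.find_min (hk p hp) hj⟩ : ∃ k : ℕ,
      (volume (fcyl p (ρ / 2 ^ k) \ E) ≤ ENNReal.ofReal μ * volume (fcyl p (ρ / 2 ^ k))) ∧
      ∀ j < k, ¬ volume (fcyl p (ρ / 2 ^ j) \ E) ≤ ENNReal.ofReal μ * volume (fcyl p (ρ / 2 ^ j)))
  set r : Spc m × ℝ → ℝ := fun p => 2 * (ρ / 2 ^ (k p)) with hr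
  have hr0 : ∀ p, 0 < r p := fun p => by simp only [hr]; positivity
  have hk1 : ∀ p ∈ E, 1 ≤ k p := by
    intro p hp
    by_contra hc
    have h0 : k p = 0 := by omega
    have := hkP p hp
    rw [h0] at this
    simp only [pow_zero, div_one] at this
    exact absurd (hsparse p hp) (not_lt.2 this)
  have hrk : ∀ p ∈ E, r p = ρ / 2 ^ (k p - 1) := by
    intro p hp
    obtain ⟨j, hj⟩ := Nat.exists_eq_add_of_le (hk1 p hp)
    simp only [hr, hj, Nat.add_sub_cancel_left, pow_add, pow_one]
    field_simp
  have hrρ : ∀ p ∈ E, r p ≤ ρ := fun p hp => by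
    rw [hrk p hp]
    exact div_le_self hρ.le (one_le_pow₀ (by norm_num))
  have hsp : ∀ p ∈ E, ENNReal.ofReal μ * volume (fcyl p (r p)) ≤ volume (fcyl p (r p) \ E) := by
    intro p hp
    have := hkmin p hp (k p - 1) (by have := hk1 p hp; omega)
    rw [← hrk p hp] at this
    exact (not_le.1 this).le
  have hdense : ∀ p ∈ E,
      volume (fcyl p (r p / 2) \ E) ≤ ENNReal.ofReal μ * volume (fcyl p (r p / 2)) := by
    intro p hp
    have : r p / 2 = ρ / 2 ^ k p := by simp only [hr]; ring
    rw [this]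
    exact hkP p hp
  obtain ⟨u, huE, hud, hucov⟩ := Vitali.exists_disjoint_subfamily_covering_enlargement
    (fun p => fcyl p (r p)) E r 2 (by norm_num) (fun p _ => (hr0 p).le) ρ hrρ
    (fun p _ => fcyl_nonempty p (hr0 p))
  have hucount : u.Countable := hud.countable_of_isOpen (fun p _ => fcyl_isOpen p _)
    (fun p _ => fcyl_nonempty p (hr0 p))
  set G := ⋃ p ∈ E, fcyl p (r p) with hG
  have hGo : IsOpen G := isOpen_biUnion fun p _ => fcyl_isOpen p _
  have hEG : volume (E \ G) = 0 := by
    apply volume_eq_zero_of_forward_gap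
    intro p hp
    refine ⟨min (r p) (r p ^ 2), lt_min (hr0 p) (pow_pos (hr0 p) 2), ?_⟩
    rw [disjoint_left]
    intro q hq hq2
    refine hq2.2 (mem_iUnion₂.2 ⟨p, hp.1, ?_, hq.2.1, ?_⟩)
    · exact Metric.ball_subset_ball (min_le_left _ _) hq.1
    · have := min_le_right (r p) (r p ^ 2)
      linarith [hq.2.2]
  set c8 : ℝ := 8 * 3 ^ (m + 1) with hc8
  have hc80 : 0 < c8 := by positivity
  have hc8_1 : 8 ≤ c8 := by
    have : (1 : ℝ) ≤ 3 ^ (m + 1) := one_le_pow₀ (by norm_num)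
    linarith
  have hcover : volume E ≤ ENNReal.ofReal c8 * ∑' p : u, volume (fcyl p.1 (r p)) := by
    have h1 : E ⊆ ⋃ p ∈ u,
        Metric.ball p.1 (3 * r p) ×ˢ Icc (p.2 - 4 * r p ^ 2) (p.2 + 4 * r p ^ 2) := by
      intro a ha
      obtain ⟨b, hb, ⟨q, hqa, hqb⟩, hle⟩ := hucov a ha
      have ha0 := hr0 a
      have hb0 := hr0 b
      have hsq : r a ^ 2 ≤ 4 * r b ^ 2 := by nlinarith
      have hsq0 := sq_nonneg (r b)
      refine mem_iUnion₂.2 ⟨b, hb, ?_, ?_, ?_⟩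
      · have h1 : dist q.1 a.1 < r a := hqa.1
        have h2 : dist q.1 b.1 < r b := hqb.1
        rw [Metric.mem_ball]
        have := dist_triangle_left a.1 b.1 q.1
        linarith
      · linarith [hqa.2.2, hqb.2.1]
      · linarith [hqa.2.1, hqb.2.2]
    refine (measure_mono h1).trans ((measure_biUnion_le _ hucount _).trans ?_)
    rw [← ENNReal.tsum_mul_left]
    refine le_of_eq (tsum_congr fun p => ?_)
    exact volume_box p.1.1 p.1.2 (hr0 p)
  have hGE : ENNReal.ofReal (μ / c8) * volume E ≤ volume (G \ E) := by
    have h1 : (⋃ p ∈ u, (fcyl p (r p) \ E)) ⊆ G \ E := by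
      intro q hq
      obtain ⟨p, hp, hpq⟩ := mem_iUnion₂.1 hq
      exact ⟨mem_iUnion₂.2 ⟨p, huE hp, hpq.1⟩, hpq.2⟩
    refine le_trans ?_ (measure_mono h1)
    rw [measure_biUnion hucount (hud.mono_on fun p _ => sdiff_subset)
      fun p _ => (fcyl_isOpen p _).measurableSet.diff hE.measurableSet]
    calc _ ≤ ENNReal.ofReal (μ / c8) * (ENNReal.ofReal c8 * ∑' p : u, volume (fcyl p.1 (r p))) :=
          mul_le_mul_right hcover _
      _ = ∑' p : u, ENNReal.ofReal μ * volume (fcyl p.1 (r p)) := by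
          rw [← mul_assoc, ← ENNReal.ofReal_mul (by positivity), div_mul_cancel₀ _ hc80.ne',
            ENNReal.tsum_mul_left]
      _ ≤ _ := ENNReal.tsum_le_tsum fun p => hsp p (huE p.2)
  have hGbig : ENNReal.ofReal (1 + μ / c8) * volume E ≤ volume G := by
    rw [ENNReal.ofReal_add (by norm_num) (by positivity), add_mul, ENNReal.ofReal_one, one_mul]
    have h1 := measure_inter_add_sdiff (μ := volume) E hGo.measurableSet
    have h2 := measure_inter_add_sdiff (μ := volume) G hE.measurableSet
    rw [hEG, add_zero] at h1
    calc volume E + ENNReal.ofReal (μ / c8) * volume E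
        ≤ volume (E ∩ G) + volume (G \ E) := add_le_add h1.ge hGE
      _ = volume G := by rw [← h2, inter_comm]
  have hη : 0 < μ / c8 := by positivity
  have hη1 : μ / c8 < 1 := by rw [div_lt_one hc80]; linarith
  have hlt : ENNReal.ofReal (1 + μ / c8 / 2) * volume E < volume G := by
    refine lt_of_lt_of_le ?_ hGbig
    refine (ENNReal.mul_lt_mul_iff_left hE0 hEv).2 ?_
    rw [ENNReal.ofReal_lt_ofReal_iff (by positivity)]
    linarith
  obtain ⟨Kc, hKG, hKc, hKv⟩ := hGo.exists_lt_isCompact hlt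
  obtain ⟨F, hFE, hF⟩ := hKc.elim_finite_subcover_image (fun p _ => fcyl_isOpen p (r p)) hKG
  obtain ⟨hFfin, hFcov⟩ := hF
  refine ⟨hFfin.toFinset, r, fun p hp => ?_, ?_⟩
  · have hpE := hFE (hFfin.mem_toFinset.1 hp)
    exact ⟨hpE, hr0 p, hrρ p hpE, hdense p hpE⟩
  · have h1 : ENNReal.ofReal (1 + μ / c8 / 2) * volume E ≤
        volume (⋃ p ∈ hFfin.toFinset, fcyl p (r p)) := by
      refine hKv.le.trans (measure_mono fun q hq => ?_)
      obtain ⟨p, hp, hpq⟩ := mem_iUnion₂.1 (hFcov hq)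
      exact mem_iUnion₂.2 ⟨p, hFfin.mem_toFinset.2 hp, hpq⟩
    have h2 := h1.trans (volume_biUnion_fcyl_le (M := 32 * 3 ^ (m + 1) / μ) (by positivity) _ r)
    have e1 : 1 + 1 / (32 * 3 ^ (m + 1) / μ) = 1 + μ / c8 / 4 := by
      rw [hc8]; field_simp; ring
    have e2 : 1 + μ / (64 * 3 ^ (m + 1)) = 1 + μ / c8 / 8 := by
      rw [hc8]; field_simp; ring
    rw [e1] at h2
    rw [e2]
    have h3 : ENNReal.ofReal (1 + μ / c8 / 4) * (ENNReal.ofReal (1 + μ / c8 / 8) * volume E) ≤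
        ENNReal.ofReal (1 + μ / c8 / 2) * volume E := by
      rw [← mul_assoc, ← ENNReal.ofReal_mul (by positivity)]
      refine mul_le_mul_left (ENNReal.ofReal_le_ofReal ?_) _
      nlinarith
    refine (ENNReal.mul_le_mul_iff_right ?_ ENNReal.ofReal_ne_top).1 (h3.trans h2)
    simp only [ne_eq, ENNReal.ofReal_eq_zero, not_le]
    positivity

end growth

section spread
variable {m : ℕ} {lam Lam : ℝ}

lemma closedBall_prod_subset {x x' : Spc m} {r r' a b a' b' : ℝ} (h : dist x x' + r ≤ r')
    (ha : a' ≤ a) (hb : b ≤ b') :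
    Metric.closedBall x r ×ˢ Icc a b ⊆ Metric.closedBall x' r' ×ˢ Icc a' b' :=
  prod_mono (Metric.closedBall_subset_closedBall' (by linarith)) (Icc_subset_Icc ha hb)

theorem exists_dense_to_ball (m : ℕ) (hlam : 0 < lam) (hLam : lam ≤ Lam) :
    ∃ μ : ℝ, 0 < μ ∧ μ < 1 ∧ ∀ (A : Spc m → Matrix (Fin (m + 1)) (Fin (m + 1)) ℝ),
      IsElliptic lam Lam A → ∀ (v : Spc m × ℝ → ℝ) (Ω : Set (Spc m × ℝ)), PosSol A v Ω →
      ∀ (E : Set (Spc m × ℝ)) (p : Spc m × ℝ) (ρ k : ℝ), 0 < ρ → 0 < k →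
      Metric.closedBall p.1 ρ ×ˢ Icc p.2 (p.2 + ρ ^ 2) ⊆ Ω → (∀ q ∈ E, k ≤ v q) →
      volume (fcyl p ρ \ E) ≤ ENNReal.ofReal μ * volume (fcyl p ρ) →
      ∀ y ∈ Metric.closedBall p.1 (ρ / 2), k / 2 ≤ v (y, p.2 + ρ ^ 2 / 2) := by
  obtain ⟨μ₀, hμ₀, H⟩ := exists_measure_to_point_scaled m hlam hLam
  set ω : ℝ := (volume (Metric.ball (0 : Spc m) 1)).toReal with hω
  have hω0 : 0 ≤ ω := ENNReal.toReal_nonneg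
  have hωe : volume (Metric.ball (0 : Spc m) 1) = ENNReal.ofReal ω :=
    (ENNReal.ofReal_toReal Metric.isBounded_ball.measure_lt_top.ne).symm
  refine ⟨min (1 / 2) (μ₀ / (2 ^ (m + 3) * (ω + 1))), by positivity,
    (min_le_left _ _).trans_lt (by norm_num), fun A hA v Ω hv E p ρ k hρ hk hΩ hE hvol y hy => ?_⟩
  have hd : dist y p.1 ≤ ρ / 2 := hy
  have hρ2 : 0 < ρ ^ 2 := by positivity
  have e4 : (ρ / 2) ^ 2 = ρ ^ 2 / 4 := by ring
  refine H A hA v Ω hv y _ (ρ / 2) k (by positivity) hk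
    ((closedBall_prod_subset (by linarith) (by linarith) (by linarith)).trans hΩ) ?_
  refine (measure_mono ?_).trans (hvol.trans ?_)
  · rintro ⟨x, t⟩ ⟨⟨hx, ht⟩, hv1⟩
    refine ⟨⟨Metric.ball_subset_ball' (by linarith) hx, ?_, ?_⟩, fun hxE => ?_⟩
    · linarith [ht.1]
    · linarith [ht.2]
    · exact absurd (hE _ hxE) (not_le.2 hv1)
  · rw [volume_fcyl p hρ, hωe, ← ENNReal.ofReal_mul (by positivity),
      ← ENNReal.ofReal_mul (by positivity)]
    apply ENNReal.ofReal_le_ofReal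
    have h1 : min (1 / 2) (μ₀ / (2 ^ (m + 3) * (ω + 1))) * (ρ ^ (m + 3) * ω) ≤
        μ₀ / (2 ^ (m + 3) * (ω + 1)) * (ρ ^ (m + 3) * ω) :=
      mul_le_mul_of_nonneg_right (min_le_right _ _) (by positivity)
    refine h1.trans ?_
    rw [div_pow, div_mul_eq_mul_div, div_le_iff₀ (by positivity)]
    field_simp
    linarith

set_option maxHeartbeats 1000000 in
/-- Positivity on a set of positive measure propagates to a ball at a later time. -/
theorem exists_measure_to_ball (m : ℕ) (hlam : 0 < lam) (hLam : lam ≤ Lam) {ν : ℝ} (hν : 0 < ν) :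
    ∃ c : ℝ, 0 < c ∧ ∀ (A : Spc m → Matrix (Fin (m + 1)) (Fin (m + 1)) ℝ),
      IsElliptic lam Lam A → ∀ (v : Spc m × ℝ → ℝ) (Ω : Set (Spc m × ℝ)), PosSol A v Ω →
      Metric.closedBall 0 9 ×ˢ Icc 0 4 ⊆ Ω → ∀ E : Set (Spc m × ℝ), IsOpen E →
      E ⊆ Metric.ball 0 1 ×ˢ Ioo 0 1 → ENNReal.ofReal ν ≤ volume E → (∀ p ∈ E, 1 ≤ v p) →
      ∀ y ∈ Metric.closedBall (0 : Spc m) 1, c ≤ v (y, 4) := by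
  obtain ⟨μ, hμ, hμ1, Hμ⟩ := exists_dense_to_ball m hlam hLam
  obtain ⟨γ, Hγ⟩ := exists_propagation m (Lam := Lam) hlam (M := 9) (by norm_num)
  obtain ⟨h, hh⟩ : ∃ h : ℝ, h = 32 * 3 ^ (m + 1) / μ := ⟨_, rfl⟩
  have hh0 : 0 < h := by rw [hh]; positivity
  obtain ⟨η, hη⟩ : ∃ η : ℝ, η = μ / (64 * 3 ^ (m + 1)) := ⟨_, rfl⟩
  have hη0 : 0 < η := by rw [hη]; positivity
  obtain ⟨V, hV⟩ : ∃ V : ENNReal, V = volume (Metric.ball (0 : Spc m) 2 ×ˢ Ioo (0 : ℝ) 2) := ⟨_, rfl⟩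
  have hVt : V ≠ ⊤ := hV ▸ (Metric.isBounded_ball.prod (Metric.isBounded_Ioo 0 2)).measure_lt_top.ne
  obtain ⟨N, hN⟩ : ∃ N : ℕ, V < ENNReal.ofReal ((1 + η) ^ N * ν) := by
    have ht : Tendsto (fun N : ℕ => (1 + η) ^ N * ν) atTop atTop :=
      (tendsto_pow_atTop_atTop_of_one_lt (by linarith)).atTop_mul_const hν
    obtain ⟨N, hN⟩ := (ht.eventually (eventually_gt_atTop V.toReal)).exists
    exact ⟨N, by rwa [← ENNReal.ofReal_toReal hVt, ENNReal.ofReal_lt_ofReal_iff (by positivity)]⟩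
  obtain ⟨ρ, hρ⟩ : ∃ ρ : ℝ, ρ = 1 / ((h + 1) * (N + 1)) := ⟨_, rfl⟩
  have hρ0 : 0 < ρ := by rw [hρ]; positivity
  have hρN : (h + 1) * (N + 1) * ρ = 1 := by rw [hρ]; field_simp
  have hN0 : (0 : ℝ) ≤ N := Nat.cast_nonneg N
  have hρ1 : ρ ≤ 1 := by rw [hρ, div_le_one (by positivity)]; nlinarith
  have hstep : ∀ j : ℕ, j ≤ N → (j * ρ ≤ 1 ∧ j * ((h + 1) * ρ ^ 2) ≤ 1) ∧ (h + 1) * ρ ^ 2 ≤ 1 := by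
    intro j hj
    have hj' : (j : ℝ) ≤ N := by exact_mod_cast hj
    have h1 : (h + 1) * (N + 1) * ρ * ρ = ρ := by rw [hρN, one_mul]
    have h2 : 0 ≤ (h + 1) * ρ ^ 2 := by positivity
    have h3 : 0 ≤ h * ((N + 1) * ρ) := by positivity
    refine ⟨⟨?_, ?_⟩, ?_⟩ <;> nlinarith
  obtain ⟨κ, hκ⟩ : ∃ κ : ℝ, κ = 1 / 2 * (1 / (1 + 144 * (1 + h))) ^ γ := ⟨_, rfl⟩
  have hκ0 : 0 < κ := by rw [hκ]; positivity
  have hκ1 : κ ≤ 1 := by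
    have : (1 / (1 + 144 * (1 + h))) ^ γ ≤ 1 := pow_le_one₀ (by positivity)
      ((div_le_one (by positivity)).2 (by linarith))
    rw [hκ]; linarith
  obtain ⟨c, hc⟩ : ∃ c : ℝ, c = κ ^ N * (1 / 2 * ((ρ / 2) ^ 2 / ((ρ / 2) ^ 2 + 36)) ^ γ) := ⟨_, rfl⟩
  refine ⟨c, by rw [hc]; positivity, fun A hA v Ω hv hΩ E hEo hEs hEν hEv y hy => ?_⟩
  by_contra hcon
  push Not at hcon
  have hind : ∀ j : ℕ, j ≤ N → ∃ E : Set (Spc m × ℝ), IsOpen E ∧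
      E ⊆ Metric.ball 0 (1 + j * ρ) ×ˢ Ioo 0 (1 + j * ((h + 1) * ρ ^ 2)) ∧
      ENNReal.ofReal ((1 + η) ^ j * ν) ≤ volume E ∧ ∀ p ∈ E, κ ^ j ≤ v p := by
    intro j
    induction j with
    | zero =>
      intro _
      refine ⟨E, hEo, ?_, by simpa using hEν, by simpa using hEv⟩
      simpa using hEs
    | succ j ih =>
      intro hj
      obtain ⟨E, hEo, hEs, hEν, hEv⟩ := ih (by omega)
      obtain ⟨⟨hj1, hj2⟩, hj3⟩ := hstep j (by omega)
      have hkj : 0 < κ ^ j := by positivity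
      have hpE : ∀ p ∈ E, ‖p.1‖ < 2 ∧ 0 < p.2 ∧ p.2 < 2 := fun p hp => by
        obtain ⟨h1, h2, h3⟩ := hEs hp
        rw [mem_ball_zero_iff] at h1
        exact ⟨by linarith, h2, by linarith⟩
      have hdense : ∀ p ∈ E, ∀ r, 0 < r → r ≤ ρ →
          volume (fcyl p r \ E) ≤ ENNReal.ofReal μ * volume (fcyl p r) →
          ∀ s ∈ Icc (p.2 + r ^ 2 / 2) 4, ∀ y, ‖y - p.1‖ ^ 2 ≤ 9 * (s - (p.2 + r ^ 2 / 2)) →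
          κ ^ j / 2 * ((r / 2) ^ 2 / ((r / 2) ^ 2 + 9 * (s - (p.2 + r ^ 2 / 2)))) ^ γ
            ≤ v (y, s) := by
        intro p hp r hr hrρ hvol s hs y hys
        obtain ⟨h1, h2, h3⟩ := hpE p hp
        have hr2 : r ^ 2 ≤ 1 := by nlinarith
        have hr3 : 0 ≤ r ^ 2 := sq_nonneg r
        have hd0 : dist p.1 0 = ‖p.1‖ := dist_zero_right _
        have := Hμ A hA v Ω hv E p r _ hr hkj ((closedBall_prod_subset (by linarith) (by linarith)
          (by linarith)).trans hΩ) hEv hvol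
        refine Hγ A hA v Ω hv p.1 (p.2 + r ^ 2 / 2) (r / 2) (s - (p.2 + r ^ 2 / 2)) 7 (κ ^ j / 2)
          (by positivity) (by positivity) ?_ (by norm_num)
          ((closedBall_prod_subset (by linarith) (by linarith) ?_).trans hΩ) this s
          ⟨hs.1, by linarith⟩ y hys
        · nlinarith [hs.2]
        · linarith [hs.2]
      have hsparse : ∀ p ∈ E, ENNReal.ofReal μ * volume (fcyl p ρ) < volume (fcyl p ρ \ E) := by
        intro p hp
        by_contra hn
        push Not at hn
        obtain ⟨h1, h2, h3⟩ := hpE p hp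
        have hρ2 : ρ ^ 2 ≤ 1 := by nlinarith
        have hy1 : ‖y‖ ≤ 1 := by simpa using hy
        have h4 : ‖y - p.1‖ ≤ 3 := (norm_sub_le _ _).trans (by linarith)
        have := hdense p hp ρ hρ0 le_rfl hn 4 ⟨by linarith, le_rfl⟩ y
          (by nlinarith [norm_nonneg (y - p.1)])
        refine absurd (this.trans_lt hcon) (not_lt.2 ?_)
        rw [hc, ← mul_assoc, mul_one_div]
        have h5 : κ ^ N ≤ κ ^ j := pow_le_pow_of_le_one hκ0.le hκ1 (by omega)
        have h6 : 0 ≤ ρ ^ 2 := sq_nonneg ρ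
        have h7 : 0 ≤ 4 - (p.2 + ρ ^ 2 / 2) := by linarith
        refine mul_le_mul (by linarith) (pow_le_pow_left₀ (by positivity)
          (div_le_div_of_nonneg_left (by positivity) (by positivity) (by linarith)) γ)
          (by positivity) (by positivity)
      have hEvt : volume E ≠ ⊤ := ((Metric.isBounded_ball.prod (Metric.isBounded_Ioo _ _)).subset
        hEs).measure_lt_top.ne
      have hEv0 : volume E ≠ 0 := fun h0 => by
        rw [h0, nonpos_iff_eq_zero, ENNReal.ofReal_eq_zero] at hEν
        exact absurd hEν (not_le.2 (by positivity))
      obtain ⟨F, r, hF, hFv⟩ := exists_stacks hμ hμ1 hEo hEvt hEv0 hρ0 hsparse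
      rw [← hh, ← hη] at hFv
      refine ⟨⋃ p ∈ F, stack h p (r p), isOpen_biUnion fun p _ => stack_isOpen _ _ _, ?_, ?_, ?_⟩
      · intro q hq
        obtain ⟨p, hp, hpq⟩ := mem_iUnion₂.1 hq
        obtain ⟨hpE', hr0, hrρ, -⟩ := hF p hp
        obtain ⟨h1, h2, h3⟩ := hEs hpE'
        obtain ⟨h4, h5, h6⟩ := hpq
        have hrr : (1 + h) * r p ^ 2 ≤ (h + 1) * ρ ^ 2 := by
          rw [add_comm]; gcongr
        push_cast
        refine ⟨?_, ?_, ?_⟩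
        · rw [Metric.mem_ball] at h1 h4 ⊢
          linarith [dist_triangle q.1 p.1 0]
        · linarith [sq_nonneg (r p)]
        · linarith
      · refine le_trans ?_ hFv
        rw [pow_succ', mul_assoc, ENNReal.ofReal_mul (by positivity)]
        exact mul_le_mul_right hEν _
      · intro q hq
        obtain ⟨p, hp, hpq⟩ := mem_iUnion₂.1 hq
        obtain ⟨hpE', hr0, hrρ, hden⟩ := hF p hp
        obtain ⟨h1, h2, h3⟩ := hpE p hpE'
        obtain ⟨h4, h5, h6⟩ := hpq
        have hrr : (1 + h) * r p ^ 2 ≤ (h + 1) * ρ ^ 2 := by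
          rw [add_comm]; gcongr
        have h4' : ‖q.1 - p.1‖ < r p := by rwa [mem_ball_iff_norm] at h4
        have hr2 : 0 < r p ^ 2 := by positivity
        have e1 : (r p / 2) ^ 2 = r p ^ 2 / 4 := by ring
        have e2 : (r p / 2 / 2) ^ 2 = r p ^ 2 / 16 := by ring
        have := hdense p hpE' (r p / 2) (by positivity) (by linarith) hden q.2
          ⟨by rw [e1]; linarith, by linarith⟩ q.1
          (by rw [e1]; nlinarith [norm_nonneg (q.1 - p.1)])
        refine le_trans ?_ this
        rw [e1, e2, pow_succ, hκ, ← mul_assoc, mul_one_div]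
        gcongr ?_ * ?_ ^ γ
        rw [div_le_div_iff₀ (by positivity) (by nlinarith)]
        nlinarith
  obtain ⟨E', -, hEs', hEν', -⟩ := hind N le_rfl
  obtain ⟨⟨hj1, hj2⟩, hj3⟩ := hstep N le_rfl
  refine absurd (hN.trans_le hEν') (not_lt.2 (hV ▸ measure_mono (hEs'.trans (prod_mono ?_ ?_))))
  · exact Metric.ball_subset_ball (by linarith)
  · exact Ioo_subset_Ioo le_rfl (by linarith)

end spread

section harnack
variable {m : ℕ} {lam Lam : ℝ} {A : Spc m → Matrix (Fin (m + 1)) (Fin (m + 1)) ℝ}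

lemma ContinuousAt.rlsc {u : Spc m × ℝ → ℝ} {p : Spc m × ℝ} (h : ContinuousAt u p) : RLSC u p :=
  fun _ hc => nhdsWithin_le_nhds (h.eventually (lt_mem_nhds hc))

lemma SolvesL.const_add_mul {u : Spc m × ℝ → ℝ} {Ω : Set (Spc m × ℝ)} (h : SolvesL A u Ω)
    (a b : ℝ) : SolvesL A (fun q => a + b * u q) Ω := by
  intro p hp
  obtain ⟨h1, h2⟩ := h p hp
  have h4 : ContDiffAt ℝ 2 (fun y => b * u (y, p.2)) p.1 := contDiffAt_const.mul h1
  have h3 : ContDiffAt ℝ 2 (fun y => a + b * u (y, p.2)) p.1 := contDiffAt_const.add h4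
  refine ⟨h3, ?_⟩
  have h0 : trF (A p.1) 0 = 0 := by simp [trF]
  rw [Lop_eq _ _ _ h3, D2_add contDiffAt_const h4, trF_add, D2_const, h0, zero_add, D2_const_mul,
    trF_smul]
  rw [Lop_eq _ _ _ h1] at h2
  exact (h2.const_mul b).const_add a

lemma SolvesL.const_sub {u : Spc m × ℝ → ℝ} {Ω : Set (Spc m × ℝ)} (h : SolvesL A u Ω)
    (a : ℝ) : SolvesL A (fun q => a - u q) Ω := by
  have := h.const_add_mul a (-1)
  simpa only [neg_one_mul, ← sub_eq_add_neg] using this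

lemma le_volume_preimage_pdil (p : Spc m × ℝ) {r ν : ℝ} (hr : 0 < r) {E : Set (Spc m × ℝ)}
    (hE : ENNReal.ofReal (ν * r ^ (m + 3)) ≤ volume E) :
    ENNReal.ofReal ν ≤ volume (pdil p r ⁻¹' E) := by
  have h1 := volume_preimage_pdil_le (-(r⁻¹ • p.1), -((r⁻¹) ^ 2 * p.2)) (inv_pos.2 hr)
    (pdil p r ⁻¹' E)
  have h2 : pdil (-(r⁻¹ • p.1), -((r⁻¹) ^ 2 * p.2)) r⁻¹ ⁻¹' (pdil p r ⁻¹' E) = E := by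
    rw [← preimage_comp]
    convert preimage_id
    funext q
    refine Prod.ext ?_ ?_
    · simp [pdil, smul_smul, hr.ne']
    · simp only [pdil, Function.comp, id]
      field_simp
      ring
  rw [h2] at h1
  have hr3 : 0 < r ^ (m + 3) := by positivity
  have h3 := hE.trans h1
  rw [inv_pow, inv_inv, mul_comm ν, ENNReal.ofReal_mul hr3.le] at h3
  exact (ENNReal.mul_le_mul_iff_right (by simpa using hr3) ENNReal.ofReal_ne_top).1 h3

theorem exists_measure_to_ball_scaled (m : ℕ) (hlam : 0 < lam) (hLam : lam ≤ Lam) {ν : ℝ}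
    (hν : 0 < ν) :
    ∃ c : ℝ, 0 < c ∧ ∀ (A : Spc m → Matrix (Fin (m + 1)) (Fin (m + 1)) ℝ),
      IsElliptic lam Lam A → ∀ (v : Spc m × ℝ → ℝ) (Ω : Set (Spc m × ℝ)), PosSol A v Ω →
      ∀ (x0 : Spc m) (t0 r k : ℝ), 0 < r → 0 < k →
      Metric.closedBall x0 (9 * r) ×ˢ Icc t0 (t0 + 4 * r ^ 2) ⊆ Ω →
      ∀ E : Set (Spc m × ℝ), IsOpen E → E ⊆ Metric.ball x0 r ×ˢ Ioo t0 (t0 + r ^ 2) →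
      ENNReal.ofReal (ν * r ^ (m + 3)) ≤ volume E → (∀ p ∈ E, k ≤ v p) →
      ∀ y ∈ Metric.closedBall x0 r, c * k ≤ v (y, t0 + 4 * r ^ 2) := by
  obtain ⟨c, hc, H⟩ := exists_measure_to_ball m hlam hLam hν
  refine ⟨c, hc, fun A hA v Ω hv x0 t0 r k hr hk hΩ E hE hEs hEν hEv y hy => ?_⟩
  have hr2 : 0 < r ^ 2 := by positivity
  have key := H _ (hA.affine x0 r) _ _ ((hv.const_mul (inv_pos.2 hk)).pdil (x0, t0) r) ?_
    (pdil (x0, t0) r ⁻¹' E) (hE.preimage (pdil_continuous _ _)) ?_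
    (le_volume_preimage_pdil _ hr hEν) ?_ (r⁻¹ • (y - x0)) ?_
  · simp only [pdil, smul_smul, mul_inv_cancel₀ hr.ne', one_smul, add_sub_cancel] at key
    rw [inv_mul_eq_div, le_div_iff₀ hk, mul_comm (r ^ 2)] at key
    exact key
  · rintro ⟨x, t⟩ ⟨hx, ht⟩
    apply hΩ
    simp only [mem_closedBall_zero_iff, mem_Icc] at hx ht
    refine ⟨?_, ?_, ?_⟩
    · simp only [pdil, mem_closedBall_iff_norm, add_sub_cancel_left, norm_smul, Real.norm_eq_abs,
        abs_of_pos hr]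
      nlinarith
    · simp only [pdil]; nlinarith
    · simp only [pdil]; nlinarith
  · rintro ⟨x, t⟩ hq
    obtain ⟨h1, h2, h3⟩ := hEs hq
    simp only [pdil, mem_ball_iff_norm, add_sub_cancel_left, norm_smul, Real.norm_eq_abs,
      abs_of_pos hr] at h1 h2 h3
    refine ⟨?_, ?_, ?_⟩
    · rw [mem_ball_zero_iff]
      by_contra hcon
      push Not at hcon
      nlinarith
    · by_contra hcon
      push Not at hcon
      nlinarith
    · by_contra hcon
      push Not at hcon
      nlinarith
  · intro q hq
    rw [inv_mul_eq_div, one_le_div hk]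
    exact hEv _ hq
  · rw [mem_closedBall_zero_iff, norm_smul, norm_inv, Real.norm_eq_abs, abs_of_pos hr,
      inv_mul_le_iff₀ hr, mul_one]
    rwa [mem_closedBall_iff_norm] at hy

theorem exists_superlevel_estimate (m : ℕ) (hlam : 0 < lam) (hLam : lam ≤ Lam) {ν : ℝ}
    (hν : 0 < ν) :
    ∃ (C : ℝ) (γ : ℕ), 0 < C ∧ ∀ (A : Spc m → Matrix (Fin (m + 1)) (Fin (m + 1)) ℝ),
      IsElliptic lam Lam A → ∀ (v : Spc m × ℝ → ℝ) (Ω : Set (Spc m × ℝ)), PosSol A v Ω →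
      Metric.closedBall 0 10 ×ˢ Icc (-2) 4 ⊆ Ω →
      ∀ y ∈ Metric.closedBall (0 : Spc m) 2, v (y, 4) ≤ 1 →
      ∀ x ∈ Metric.closedBall (0 : Spc m) 1, ∀ t ∈ Icc (-1 : ℝ) 0, ∀ r s : ℝ, 0 < r → r ≤ 1 →
      0 < s → ∀ E : Set (Spc m × ℝ), IsOpen E →
      E ⊆ Metric.ball x r ×ˢ Ioo (t - r ^ 2) t → ENNReal.ofReal (ν * r ^ (m + 3)) ≤ volume E →
      (∀ p ∈ E, s ≤ v p) → s * (r ^ 2) ^ γ ≤ C := by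
  obtain ⟨c, hc, H⟩ := exists_measure_to_ball_scaled m hlam hLam hν
  obtain ⟨γ, Hγ⟩ := exists_propagation m (Lam := Lam) hlam (M := 9) (by norm_num)
  refine ⟨46 ^ γ / c, γ, by positivity, fun A hA v Ω hv hΩ y hy hvy x hx t ht r s hr hr1 hs E hE
    hEs hEν hEv => ?_⟩
  have hr2 : r ^ 2 ≤ 1 := by nlinarith
  have hr3 : 0 < r ^ 2 := by positivity
  rw [mem_closedBall_zero_iff] at hx hy
  obtain ⟨ht1, ht2⟩ := ht
  have hd0 : dist x 0 = ‖x‖ := dist_zero_right _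
  have h1 := H A hA v Ω hv x (t - r ^ 2) r s hr hs ((closedBall_prod_subset (by linarith)
    (by linarith) (by linarith)).trans hΩ) E hE (by simpa using hEs) hEν hEv
  have e : t - r ^ 2 + 4 * r ^ 2 = t + 3 * r ^ 2 := by ring
  rw [e] at h1
  have h4 : ‖y - x‖ ≤ 3 := (norm_sub_le _ _).trans (by linarith)
  have h2 := Hγ A hA v Ω hv x (t + 3 * r ^ 2) r (4 - (t + 3 * r ^ 2)) 7 (c * s) hr (by positivity)
    (by linarith) (by norm_num) ((closedBall_prod_subset (by linarith) (by linarith)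
    (by linarith)).trans hΩ) h1 4 ⟨by linarith, by linarith⟩ y
    (by nlinarith [norm_nonneg (y - x)])
  have h3 : c * s * (r ^ 2 / 46) ^ γ ≤ 1 := by
    refine le_trans (mul_le_mul_of_nonneg_left (pow_le_pow_left₀ (by positivity) ?_ γ)
      (by positivity)) (h2.trans hvy)
    exact div_le_div_of_nonneg_left (by positivity) (by linarith) (by linarith)
  rw [div_pow] at h3
  rw [le_div_iff₀ hc]
  rw [← mul_div_assoc, div_le_iff₀ (by positivity)] at h3
  linarith

end harnack

section harnack
variable {m : ℕ} {lam Lam : ℝ} {A : Spc m → Matrix (Fin (m + 1)) (Fin (m + 1)) ℝ}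

/-- A continuous nonnegative solution which is large at a point is larger at a nearby one. -/
theorem exists_growth (m : ℕ) (hlam : 0 < lam) (hLam : lam ≤ Lam) :
    ∃ (C : ℝ) (γ : ℕ), 0 < C ∧ ∀ (A : Spc m → Matrix (Fin (m + 1)) (Fin (m + 1)) ℝ),
      IsElliptic lam Lam A → ∀ (v : Spc m × ℝ → ℝ) (Ω Ω' : Set (Spc m × ℝ)), PosSol A v Ω →
      IsOpen Ω' → ContinuousOn v Ω' →
      Metric.closedBall 0 10 ×ˢ Icc (-2) 4 ⊆ Ω →
      ∀ y ∈ Metric.closedBall (0 : Spc m) 2, v (y, 4) ≤ 1 →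
      ∀ x ∈ Metric.closedBall (0 : Spc m) 1, ∀ t ∈ Icc (-1 : ℝ) 0, ∀ r a : ℝ, 0 < r → r ≤ 1 →
      0 < a → C < a * (r ^ 2) ^ γ → a ≤ v (x, t) →
      Metric.closedBall x r ×ˢ Icc (t - r ^ 2) t ⊆ Ω' →
      ∃ q ∈ Metric.closedBall x r ×ˢ Icc (t - r ^ 2) t, 5 / 4 * a ≤ v q := by
  obtain ⟨μ, hμ, H1⟩ := exists_measure_to_point_scaled m hlam hLam
  obtain ⟨C, γ, hC, H2⟩ := exists_superlevel_estimate m hlam hLam hμ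
  refine ⟨2 * C, γ, by positivity, fun A hA v Ω Ω' hv hΩo hvc hΩ y hy hvy x hx t ht r a hr hr1 ha
    har hav hbox' => ?_⟩
  by_contra hcon
  push Not at hcon
  have hr2 : r ^ 2 ≤ 1 := by nlinarith
  have hd0 : dist x 0 ≤ 1 := hx
  have hbox : Metric.closedBall x r ×ˢ Icc (t - r ^ 2) t ⊆ Ω :=
    (closedBall_prod_subset (by linarith) (by linarith [ht.1]) (by linarith [ht.2])).trans hΩ
  have hw : PosSol A (fun q => 5 / 4 * a - v q) ((Ω ∩ Ω') ∩ v ⁻¹' Iio (5 / 4 * a)) := by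
    refine ⟨(hv.solves.mono fun p hp => hp.1.1).const_sub _,
      fun p hp => sub_nonneg.2 (le_of_lt hp.2), fun p hp => ContinuousAt.rlsc ?_⟩
    exact continuousAt_const.sub (hvc.continuousAt (hΩo.mem_nhds hp.1.2))
  have hsub : Metric.ball x r ×ˢ Ioo (t - r ^ 2) t ⊆ Ω' :=
    (Set.prod_mono Metric.ball_subset_closedBall Ioo_subset_Icc_self).trans hbox'
  by_cases hvol : volume ((Metric.ball x r ×ˢ Ioo (t - r ^ 2) t) ∩
      {q | 5 / 4 * a - v q < 3 / 4 * a}) ≤ ENNReal.ofReal (μ * r ^ (m + 3))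
  · have := H1 A hA _ _ hw x t r (3 / 4 * a) hr (by positivity)
      (fun q hq => ⟨⟨hbox hq, hbox' hq⟩, hcon q hq⟩) hvol
    linarith
  · have hE : (Metric.ball x r ×ˢ Ioo (t - r ^ 2) t) ∩ {q | 5 / 4 * a - v q < 3 / 4 * a} =
        (Metric.ball x r ×ˢ Ioo (t - r ^ 2) t) ∩ v ⁻¹' Ioi (a / 2) := by
      ext q
      simp only [mem_inter_iff, mem_ofPred_eq, mem_preimage, mem_Ioi]
      refine and_congr_right fun _ => ⟨fun h => by linarith, fun h => by linarith⟩
    rw [hE] at hvol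
    have := H2 A hA v Ω hv hΩ y hy
      hvy x hx t ht r (a / 2) hr hr1 (by positivity) _
      ((hvc.mono hsub).isOpen_inter_preimage (Metric.isOpen_ball.prod isOpen_Ioo) isOpen_Ioi)
      inter_subset_left (not_le.1 hvol).le (fun p hp => le_of_lt hp.2)
    linarith

theorem exists_harnack_normalized (m : ℕ) (hlam : 0 < lam) (hLam : lam ≤ Lam) :
    ∃ C : ℝ, 0 < C ∧ ∀ (A : Spc m → Matrix (Fin (m + 1)) (Fin (m + 1)) ℝ),
      IsElliptic lam Lam A → ∀ (v : Spc m × ℝ → ℝ) (Ω Ω' : Set (Spc m × ℝ)), PosSol A v Ω →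
      IsOpen Ω' → ContinuousOn v Ω' →
      Metric.closedBall 0 10 ×ˢ Icc (-2) 4 ⊆ Ω →
      Metric.closedBall 0 1 ×ˢ Icc (-1) 0 ⊆ Ω' →
      ∀ y ∈ Metric.closedBall (0 : Spc m) 2, v (y, 4) ≤ 1 → v (0, 0) ≤ C := by
  obtain ⟨C, γ, hC, H⟩ := exists_growth m hlam hLam
  obtain ⟨q, hq0, hq1, hq⟩ : ∃ q : ℝ, 0 < q ∧ q < 1 ∧ 1 ≤ 5 / 4 * (q ^ 2) ^ γ := by
    have hd : (0 : ℝ) < 1 / (10 * (γ + 1)) := by positivity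
    have hd1 : (1 : ℝ) / (10 * (γ + 1)) ≤ 1 / 10 :=
      div_le_div_of_nonneg_left (by norm_num) (by norm_num) (by linarith [(Nat.cast_nonneg γ : (0 : ℝ) ≤ γ)])
    have hd2 : (γ : ℝ) * (1 / (10 * (γ + 1))) ≤ 1 / 10 := by
      rw [mul_one_div, div_le_div_iff₀ (by positivity) (by norm_num)]; linarith
    refine ⟨1 - 1 / (10 * (γ + 1)), by linarith, by linarith, ?_⟩
    have := one_add_mul_le_pow (a := -(1 / (10 * ((γ : ℝ) + 1)))) (by linarith) (2 * γ)
    rw [← pow_mul, sub_eq_add_neg]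
    push_cast at this
    linarith
  have hp0 : 0 < ((1 - q) ^ 2) ^ γ := pow_pos (pow_pos (by linarith) 2) γ
  refine ⟨2 * C / ((1 - q) ^ 2) ^ γ, by positivity, fun A hA v Ω Ω' hv hΩo hvc hΩ hΩ'
    y hy hvy => ?_⟩
  by_contra hcon
  push Not at hcon
  have hv00 : 0 < v (0, 0) := lt_trans (by positivity) hcon
  rw [div_lt_iff₀ hp0] at hcon
  have hind : ∀ k : ℕ, ∃ p : Spc m × ℝ, ‖p.1‖ ≤ 1 - q ^ k ∧ -(1 - q ^ k) ≤ p.2 ∧ p.2 ≤ 0 ∧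
      (5 / 4) ^ k * v (0, 0) ≤ v p := by
    intro k
    induction k with
    | zero => exact ⟨(0, 0), by simp⟩
    | succ k ih =>
      obtain ⟨⟨x, t⟩, h1, h2, h3, h4⟩ := ih
      have hqk : 0 < q ^ k := pow_pos hq0 k
      have hqk1 : q ^ k ≤ 1 := pow_le_one₀ hq0.le hq1.le
      have hr : 0 < (1 - q) * q ^ k := mul_pos (by linarith) hqk
      have hr1 : (1 - q) * q ^ k ≤ 1 := by nlinarith
      have hbig : C < (5 / 4) ^ k * v (0, 0) * (((1 - q) * q ^ k) ^ 2) ^ γ := by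
        have e : (5 / 4) ^ k * v (0, 0) * (((1 - q) * q ^ k) ^ 2) ^ γ =
            (5 / 4 * (q ^ 2) ^ γ) ^ k * (v (0, 0) * ((1 - q) ^ 2) ^ γ) := by
          rw [mul_pow, mul_pow, mul_pow]; ring
        rw [e]
        have h5 : 1 ≤ (5 / 4 * (q ^ 2) ^ γ) ^ k := one_le_pow₀ hq
        nlinarith
      obtain ⟨⟨x', t'⟩, ⟨hx', ht1, ht2⟩, hv'⟩ := H A hA v Ω Ω' hv hΩo hvc hΩ y hy hvy x
        (by rw [mem_closedBall_zero_iff]; linarith) t ⟨by linarith, h3⟩ _ _ hr hr1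
        (by positivity) hbig h4 ((closedBall_prod_subset
          (by rw [dist_zero_right]; simp only at h1; nlinarith [mul_pos hq0 hqk]) (by simp only at h2; nlinarith)
          h3).trans hΩ')
      refine ⟨(x', t'), ?_, ?_, ht2.trans h3, ?_⟩
      · rw [mem_closedBall_iff_norm] at hx'
        have := norm_add_le x (x' - x)
        rw [add_sub_cancel] at this
        rw [pow_succ]
        simp only at h1 ⊢
        linarith
      · rw [pow_succ]
        simp only at h2 ht1 ⊢
        nlinarith
      · rw [pow_succ]
        linarith
  have hK : IsCompact (Metric.closedBall (0 : Spc m) 1 ×ˢ Icc (-1 : ℝ) 0) :=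
    (isCompact_closedBall _ _).prod isCompact_Icc
  obtain ⟨B, hB⟩ := hK.bddAbove_image (hvc.mono hΩ')
  obtain ⟨k, hk⟩ := ((tendsto_pow_atTop_atTop_of_one_lt (r := (5 / 4 : ℝ)) (by norm_num)).eventually
    (eventually_gt_atTop (B / v (0, 0)))).exists
  obtain ⟨p, h1, h2, h3, h4⟩ := hind k
  have hqk : 0 < q ^ k := pow_pos hq0 k
  have := hB (mem_image_of_mem v (show p ∈ _ from
    ⟨by rw [mem_closedBall_zero_iff]; linarith, by linarith, by linarith⟩))
  rw [div_lt_iff₀ hv00] at hk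
  linarith

/-- The parabolic Harnack inequality for continuous nonnegative solutions. -/
theorem exists_harnack (m : ℕ) (hlam : 0 < lam) (hLam : lam ≤ Lam) :
    ∃ C : ℝ, 0 < C ∧ ∀ (A : Spc m → Matrix (Fin (m + 1)) (Fin (m + 1)) ℝ),
      IsElliptic lam Lam A → ∀ (v : Spc m × ℝ → ℝ) (Ω Ω' : Set (Spc m × ℝ)), PosSol A v Ω →
      IsOpen Ω' → ContinuousOn v Ω' →
      ∀ (x0 : Spc m) (t0 r : ℝ), 0 < r →
      Metric.closedBall x0 (10 * r) ×ˢ Icc (t0 - 2 * r ^ 2) (t0 + 4 * r ^ 2) ⊆ Ω →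
      Metric.closedBall x0 r ×ˢ Icc (t0 - r ^ 2) t0 ⊆ Ω' →
      ∀ y ∈ Metric.closedBall x0 (2 * r), v (x0, t0) ≤ C * v (y, t0 + 4 * r ^ 2) := by
  obtain ⟨C, hC, H⟩ := exists_harnack_normalized m hlam hLam
  refine ⟨C, hC, fun A hA v Ω Ω' hv hΩo hvc x0 t0 r hr hΩ hΩ' y hy => ?_⟩
  have hr2 : 0 < r ^ 2 := by positivity
  have hyΩ : (y, t0 + 4 * r ^ 2) ∈ Ω := hΩ ⟨Metric.closedBall_subset_closedBall (by linarith) hy,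
    by linarith, le_rfl⟩
  suffices h : ∀ a > v (y, t0 + 4 * r ^ 2), v (x0, t0) ≤ C * a by
    have hlim : Tendsto (fun a => C * a) (𝓝[>] v (y, t0 + 4 * r ^ 2))
        (𝓝 (C * v (y, t0 + 4 * r ^ 2))) :=
      (tendsto_id.const_mul C).mono_left nhdsWithin_le_nhds
    exact ge_of_tendsto hlim (by filter_upwards [self_mem_nhdsWithin] with a ha using h a ha)
  intro a ha
  have ha0 : 0 < a := (hv.nonneg _ hyΩ).trans_lt ha
  have key := H _ (hA.affine x0 r) (fun q => a⁻¹ * v (pdil (x0, t0) r q)) _ _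
    ((hv.const_mul (inv_pos.2 ha0)).pdil (x0, t0) r)
    (hΩo.preimage (pdil_continuous (x0, t0) r)) ?_ ?_ ?_ (r⁻¹ • (y - x0)) ?_ ?_
  · simp only [pdil, smul_zero, add_zero, mul_zero] at key
    rw [inv_mul_eq_div, div_le_iff₀ ha0] at key
    exact key
  · exact continuousOn_const.mul
      (hvc.comp (pdil_continuous (x0, t0) r).continuousOn fun q hq => hq)
  · rintro ⟨x, t⟩ ⟨hx, ht⟩
    apply hΩ
    simp only [mem_closedBall_zero_iff, mem_Icc] at hx ht
    refine ⟨?_, ?_, ?_⟩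
    · simp only [pdil, mem_closedBall_iff_norm, add_sub_cancel_left, norm_smul, Real.norm_eq_abs,
        abs_of_pos hr]
      nlinarith
    · simp only [pdil]; nlinarith
    · simp only [pdil]; nlinarith
  · rintro ⟨x, t⟩ ⟨hx, ht⟩
    apply hΩ'
    simp only [mem_closedBall_zero_iff, mem_Icc] at hx ht
    refine ⟨?_, ?_, ?_⟩
    · simp only [pdil, mem_closedBall_iff_norm, add_sub_cancel_left, norm_smul, Real.norm_eq_abs,
        abs_of_pos hr]
      nlinarith
    · simp only [pdil]; nlinarith
    · simp only [pdil]; nlinarith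
  · rw [mem_closedBall_zero_iff, norm_smul, norm_inv, Real.norm_eq_abs, abs_of_pos hr,
      inv_mul_le_iff₀ hr, mul_comm]
    rwa [mem_closedBall_iff_norm] at hy
  · simp only [pdil, smul_smul, mul_inv_cancel₀ hr.ne', one_smul, add_sub_cancel]
    rw [inv_mul_eq_div, div_le_one ha0, mul_comm (r ^ 2)]
    exact ha.le

end harnack

section oscillation
variable {m : ℕ} {lam Lam : ℝ} {A : Spc m → Matrix (Fin (m + 1)) (Fin (m + 1)) ℝ}

lemma volume_interior_superlevel {v : Spc m × ℝ → ℝ} {U : Set (Spc m × ℝ)} (hU : IsOpen U)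
    (hv : ∀ p ∈ U, RLSC v p) (k : ℝ) :
    volume (U ∩ {q | k < v q}) ≤ volume (interior (U ∩ {q | k < v q})) := by
  have h0 : volume ((U ∩ {q | k < v q}) \ interior (U ∩ {q | k < v q})) = 0 := by
    refine volume_eq_zero_of_forward_gap fun p hp => ?_
    have h1 := hv p hp.1.1 k hp.1.2
    have h2 : ∀ᶠ q in 𝓝[{q | p.2 ≤ q.2}] p, q ∈ U ∩ {q | k < v q} := by
      filter_upwards [h1, nhdsWithin_le_nhds (hU.mem_nhds hp.1.1)] with q h3 h4 using ⟨h4, h3⟩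
    rw [eventually_nhdsWithin_iff, Metric.eventually_nhds_iff_ball] at h2
    obtain ⟨ε, hε, h3⟩ := h2
    refine ⟨ε, hε, disjoint_left.2 fun q hq hqN => hqN.2 ?_⟩
    refine interior_maximal (t := Metric.ball p.1 ε ×ˢ Ioo p.2 (p.2 + ε)) ?_
      (Metric.isOpen_ball.prod isOpen_Ioo) hq
    rintro ⟨y, s⟩ ⟨hy, hs1, hs2⟩
    refine h3 (y, s) ?_ hs1.le
    rw [← ball_prod_same]
    refine ⟨hy, ?_⟩
    simp only at hs1 hs2
    rw [Metric.mem_ball, Real.dist_eq, abs_lt]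
    exact ⟨by linarith, by linarith⟩
  calc volume (U ∩ {q | k < v q})
      ≤ volume (interior (U ∩ {q | k < v q}) ∪
          ((U ∩ {q | k < v q}) \ interior (U ∩ {q | k < v q}))) := by
        rw [union_sdiff_self]; exact measure_mono subset_union_right
    _ ≤ _ := (measure_union_le _ _).trans (by rw [h0, add_zero])

theorem exists_measure_to_box (m : ℕ) (hlam : 0 < lam) (hLam : lam ≤ Lam) {ν : ℝ} (hν : 0 < ν) :
    ∃ c : ℝ, 0 < c ∧ ∀ (A : Spc m → Matrix (Fin (m + 1)) (Fin (m + 1)) ℝ),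
      IsElliptic lam Lam A → ∀ (v : Spc m × ℝ → ℝ) (Ω : Set (Spc m × ℝ)), PosSol A v Ω →
      ∀ (x0 : Spc m) (t0 r k : ℝ), 0 < r → 0 < k →
      Metric.closedBall x0 (9 * r) ×ˢ Icc t0 (t0 + 6 * r ^ 2) ⊆ Ω →
      ENNReal.ofReal (ν * r ^ (m + 3)) ≤ volume (fcyl (x0, t0) r ∩ {q | k < v q}) →
      ∀ y ∈ Metric.closedBall x0 r, ∀ s ∈ Icc (t0 + 5 * r ^ 2) (t0 + 6 * r ^ 2),
        c * k ≤ v (y, s) := by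
  obtain ⟨c, hc, H⟩ := exists_measure_to_ball_scaled m hlam hLam hν
  obtain ⟨γ, Hγ⟩ := exists_propagation m (Lam := Lam) hlam (M := 1) (by norm_num)
  refine ⟨c * (1 / 3) ^ γ, by positivity, fun A hA v Ω hv x0 t0 r k hr hk hΩ hvol y hy s hs => ?_⟩
  have hr2 : 0 < r ^ 2 := by positivity
  obtain ⟨hs1, hs2⟩ := hs
  have hd : dist x0 x0 = 0 := dist_self _
  have hsub : fcyl (x0, t0) r ⊆ Ω := by
    rintro ⟨z, τ⟩ ⟨hz, h1, h2⟩
    simp only at hz h1 h2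
    exact hΩ ⟨Metric.ball_subset_closedBall (Metric.ball_subset_ball (by linarith) hz),
      by linarith, by linarith⟩
  have h1 := H A hA v Ω hv x0 t0 r k hr hk ((closedBall_prod_subset (by linarith) (by linarith)
    (by linarith)).trans hΩ) (interior (fcyl (x0, t0) r ∩ {q | k < v q})) isOpen_interior
    (interior_subset.trans inter_subset_left)
    (hvol.trans (volume_interior_superlevel (fcyl_isOpen _ _) (fun p hp => hv.rlsc p (hsub hp)) k))
    (fun p hp => le_of_lt (interior_subset hp).2)
  rw [mem_closedBall_iff_norm] at hy
  have h2 := Hγ A hA v Ω hv x0 (t0 + 4 * r ^ 2) r (2 * r ^ 2) (2 * r) (c * k) hr (by positivity)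
    (by nlinarith) (by positivity) ((closedBall_prod_subset (by linarith) (by linarith)
    (by linarith)).trans hΩ) h1 s ⟨by linarith, by linarith⟩ y
    (by nlinarith [norm_nonneg (y - x0)])
  refine le_trans ?_ h2
  have h3 : (1 / 3 : ℝ) ≤ r ^ 2 / (r ^ 2 + 1 * (s - (t0 + 4 * r ^ 2))) := by
    rw [div_le_div_iff₀ (by norm_num) (by nlinarith)]; linarith
  have h4 := pow_le_pow_left₀ (by norm_num) h3 γ
  have h5 := mul_le_mul_of_nonneg_left h4 (mul_pos hc hk).le
  linarith

theorem exists_osc_decay (m : ℕ) (hlam : 0 < lam) (hLam : lam ≤ Lam) :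
    ∃ θ : ℝ, 0 ≤ θ ∧ θ < 1 ∧ ∀ (A : Spc m → Matrix (Fin (m + 1)) (Fin (m + 1)) ℝ),
      IsElliptic lam Lam A → ∀ (u : Spc m × ℝ → ℝ) (Ω : Set (Spc m × ℝ)), SolvesL A u Ω →
      (∀ p ∈ Ω, RLSC u p) → (∀ p ∈ Ω, RLSC (fun q => -u q) p) →
      ∀ a b : ℝ, (∀ p ∈ Ω, a ≤ u p ∧ u p ≤ b) → ∀ (x0 : Spc m) (t0 r : ℝ), 0 < r →
      Metric.closedBall x0 (9 * r) ×ˢ Icc t0 (t0 + 6 * r ^ 2) ⊆ Ω →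
      ∃ a' b' : ℝ, b' - a' ≤ θ * (b - a) ∧
        ∀ y ∈ Metric.closedBall x0 r, ∀ s ∈ Icc (t0 + 5 * r ^ 2) (t0 + 6 * r ^ 2),
          a' ≤ u (y, s) ∧ u (y, s) ≤ b' := by
  have hV0 : 0 < volume (Metric.ball (0 : Spc m) 1) := Metric.measure_ball_pos _ _ one_pos
  have hVt : volume (Metric.ball (0 : Spc m) 1) ≠ ⊤ := measure_ball_lt_top.ne
  have hV : 0 < (volume (Metric.ball (0 : Spc m) 1)).toReal := ENNReal.toReal_pos hV0.ne' hVt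
  obtain ⟨c, hc, H⟩ := exists_measure_to_box m hlam hLam (half_pos hV)
  have hθ : min (c / 3) 1 ≤ c / 3 := min_le_left _ _
  refine ⟨1 - min (c / 3) 1, by linarith [min_le_right (c / 3) (1 : ℝ)],
    by linarith [lt_min (by positivity : 0 < c / 3) one_pos], fun A hA u Ω hu h1 h2 a b hab x0 t0 r
    hr hΩ => ?_⟩
  have hr2 : 0 < r ^ 2 := by positivity
  have hsub : ∀ y ∈ Metric.closedBall x0 r, ∀ s ∈ Icc (t0 + 5 * r ^ 2) (t0 + 6 * r ^ 2),
      (y, s) ∈ Ω := fun y hy s hs => hΩ ⟨Metric.closedBall_subset_closedBall (by linarith) hy,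
        by linarith [hs.1], hs.2⟩
  have hx0 : (x0, t0) ∈ Ω := hΩ ⟨Metric.mem_closedBall_self (by positivity), le_rfl, by linarith⟩
  have hle : a ≤ b := (hab _ hx0).1.trans (hab _ hx0).2
  rcases hle.eq_or_lt with rfl | hlt
  · exact ⟨a, a, by simp, fun y hy s hs => hab _ (hsub y hy s hs)⟩
  have hp1 : PosSol A (fun q => u q - a) Ω :=
    ⟨by simpa [sub_eq_add_neg, add_comm] using hu.const_add_mul (-a) 1,
      fun p hp => sub_nonneg.2 (hab p hp).1,
      fun p hp => (h1 p hp).sub_continuous (φ := fun _ => a) continuousAt_const⟩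
  have hp2 : PosSol A (fun q => b - u q) Ω :=
    ⟨hu.const_sub b, fun p hp => sub_nonneg.2 (hab p hp).2, fun p hp => by
      have := (h2 p hp).sub_continuous (φ := fun _ => -b) continuousAt_const
      have e : (fun q => b - u q) = fun q => -u q - -b := by funext q; ring
      rw [e]; exact this⟩
  have hk : 0 < (b - a) / 3 := by linarith
  by_cases hE : ENNReal.ofReal ((volume (Metric.ball (0 : Spc m) 1)).toReal / 2 * r ^ (m + 3)) ≤
      volume (fcyl (x0, t0) r ∩ {q | (b - a) / 3 < u q - a})
  · refine ⟨a + c * ((b - a) / 3), b, ?_, fun y hy s hs => ⟨?_, (hab _ (hsub y hy s hs)).2⟩⟩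
    · nlinarith
    · have := H A hA _ Ω hp1 x0 t0 r _ hr hk hΩ hE y hy s hs
      linarith
  · have hE2 : ENNReal.ofReal ((volume (Metric.ball (0 : Spc m) 1)).toReal / 2 * r ^ (m + 3)) ≤
        volume (fcyl (x0, t0) r ∩ {q | (b - a) / 3 < b - u q}) := by
      by_contra hE2
      push Not at hE hE2
      have h3 : volume (fcyl (x0, t0) r) ≤ volume (fcyl (x0, t0) r ∩ {q | (b - a) / 3 < u q - a}) +
          volume (fcyl (x0, t0) r ∩ {q | (b - a) / 3 < b - u q}) := by
        refine (measure_mono fun q hq => ?_).trans (measure_union_le _ _)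
        by_cases h : (b - a) / 3 < u q - a
        · exact Or.inl ⟨hq, h⟩
        · refine Or.inr ⟨hq, ?_⟩
          simp only [mem_ofPred_eq]
          linarith
      have h4 := h3.trans_lt (ENNReal.add_lt_add hE hE2)
      rw [volume_fcyl _ hr, ← ENNReal.ofReal_add (by positivity) (by positivity),
        ← ENNReal.ofReal_toReal hVt, ← ENNReal.ofReal_mul (by positivity),
        ENNReal.toReal_ofReal hV.le] at h4
      exact absurd h4 (not_lt.2 (ENNReal.ofReal_le_ofReal (by linarith)))
    refine ⟨a, b - c * ((b - a) / 3), ?_, fun y hy s hs => ⟨(hab _ (hsub y hy s hs)).1, ?_⟩⟩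
    · nlinarith
    · have := H A hA _ Ω hp2 x0 t0 r _ hr hk hΩ hE2 y hy s hs
      linarith

/-- Bounded solutions which are continuous forward in time are continuous. -/
theorem continuousAt_of_rlsc (hlam : 0 < lam) (hA : IsElliptic lam Lam A) {u : Spc m × ℝ → ℝ}
    {Ω : Set (Spc m × ℝ)} (hΩ : IsOpen Ω) (hu : SolvesL A u Ω) (h1 : ∀ p ∈ Ω, RLSC u p)
    (h2 : ∀ p ∈ Ω, RLSC (fun q => -u q) p) {a b : ℝ} (hab : ∀ p ∈ Ω, a ≤ u p ∧ u p ≤ b)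
    {p : Spc m × ℝ} (hp : p ∈ Ω) : ContinuousAt u p := by
  have hLam : lam ≤ Lam := by
    have h := hA.2 0 (eVec m 0)
    have h3 : ‖eVec m 0‖ = 1 := by simp [eVec]
    rw [h3] at h
    linarith
  obtain ⟨θ, hθ0, hθ1, H⟩ := exists_osc_decay m hlam hLam
  obtain ⟨x, t⟩ := p
  obtain ⟨ε, hε, hball⟩ := Metric.isOpen_iff.1 hΩ _ hp
  obtain ⟨r0, hr0⟩ : ∃ r0 : ℝ, r0 = min (ε / 10) 1 := ⟨_, rfl⟩
  have hr00 : 0 < r0 := hr0 ▸ lt_min (by linarith) one_pos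
  have hr01 : r0 ≤ 1 := hr0 ▸ min_le_right _ _
  have hr02 : r0 ≤ ε / 10 := hr0 ▸ min_le_left _ _
  have hind : ∀ k : ℕ, ∃ a' b' : ℝ, b' - a' ≤ θ ^ k * (b - a) ∧
      ∀ q ∈ Metric.ball x (10 * (r0 / 12 ^ k)) ×ˢ
        Ioo (t - 6 * (r0 / 12 ^ k) ^ 2) (t + (r0 / 12 ^ k) ^ 2), q ∈ Ω ∧ a' ≤ u q ∧ u q ≤ b' := by
    intro k
    induction k with
    | zero =>
      refine ⟨a, b, by simp, fun q hq => ?_⟩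
      have hq' : q ∈ Ω := by
        apply hball
        rw [← ball_prod_same]
        obtain ⟨h3, h4, h5⟩ := hq
        rw [pow_zero, div_one] at h3 h4 h5
        refine ⟨Metric.ball_subset_ball (by linarith) h3, ?_⟩
        rw [Metric.mem_ball, Real.dist_eq, abs_lt]
        constructor <;> nlinarith
      exact ⟨hq', hab q hq'⟩
    | succ k ih =>
      obtain ⟨a', b', hab', hq⟩ := ih
      have e : r0 / 12 ^ (k + 1) = r0 / 12 ^ k / 12 := by rw [pow_succ]; field_simp
      have hr : 0 < r0 / 12 ^ k := by positivity
      rw [e]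
      generalize r0 / 12 ^ k = r at hq hr
      have hr2 : 0 < r ^ 2 := by positivity
      obtain ⟨a'', b'', h3, h4⟩ := H A hA u _ (hu.mono fun q hq' => (hq q hq').1)
        (fun q hq' => h1 q (hq q hq').1) (fun q hq' => h2 q (hq q hq').1) a' b'
        (fun q hq' => (hq q hq').2) x (t - 11 / 2 * r ^ 2) r hr (by
          rintro ⟨y, s⟩ ⟨hy, hs1, hs2⟩
          exact ⟨Metric.closedBall_subset_ball (by linarith) hy, by simp only at hs1 ⊢; linarith,
            by simp only at hs2 ⊢; linarith⟩)
      refine ⟨a'', b'', ?_, ?_⟩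
      · rw [pow_succ', mul_assoc]
        exact h3.trans (mul_le_mul_of_nonneg_left hab' hθ0)
      · rintro ⟨y, s⟩ ⟨hy, hs1, hs2⟩
        simp only at hy hs1 hs2
        rw [div_pow] at hs1 hs2
        exact ⟨(hq (y, s) ⟨Metric.ball_subset_ball (by linarith) hy, by simp only; linarith,
            by simp only; linarith⟩).1,
          h4 y (Metric.ball_subset_closedBall (Metric.ball_subset_ball (by linarith) hy)) s
            ⟨by linarith, by linarith⟩⟩
  rw [Metric.continuousAt_iff']
  intro δ hδ
  have hlim : Tendsto (fun k : ℕ => θ ^ k * (b - a)) atTop (𝓝 0) := by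
    simpa using (tendsto_pow_atTop_nhds_zero_of_lt_one hθ0 hθ1).mul_const (b - a)
  obtain ⟨k, hk⟩ := (hlim.eventually_lt_const hδ).exists
  obtain ⟨a', b', h3, h4⟩ := hind k
  have hr : 0 < r0 / 12 ^ k := by positivity
  generalize r0 / 12 ^ k = r at h4 hr
  have hr2 : 0 < r ^ 2 := by positivity
  have hmem : (x, t) ∈ Metric.ball x (10 * r) ×ˢ Ioo (t - 6 * r ^ 2) (t + r ^ 2) :=
    ⟨Metric.mem_ball_self (by linarith), by simp only; linarith, by simp only; linarith⟩
  filter_upwards [(Metric.isOpen_ball.prod isOpen_Ioo).mem_nhds hmem] with q hq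
  obtain ⟨-, h5, h6⟩ := h4 q hq
  obtain ⟨-, h7, h8⟩ := h4 _ hmem
  rw [Real.dist_eq, abs_lt]
  constructor <;> linarith

end oscillation

section timeAverage
variable {m : ℕ} {lam Lam : ℝ} {A : Spc m → Matrix (Fin (m + 1)) (Fin (m + 1)) ℝ}

lemma D2_sum {ι : Type*} (s : Finset ι) (f : ι → Spc m → ℝ) (x : Spc m)
    (hf : ∀ i ∈ s, ContDiffAt ℝ 2 (f i) x) :
    D2 (fun y => ∑ i ∈ s, f i y) x = ∑ i ∈ s, D2 (f i) x := by
  induction s using Finset.induction_on with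
  | empty => simpa using D2_const (m := m) 0 x
  | insert i s hi ih =>
    have h1 : (fun y => ∑ j ∈ insert i s, f j y) = fun y => f i y + ∑ j ∈ s, f j y := by
      funext y; rw [Finset.sum_insert hi]
    rw [h1, Finset.sum_insert hi, D2_add (hf i (Finset.mem_insert_self _ _))
      (ContDiffAt.sum fun j hj => hf j (Finset.mem_insert_of_mem hj)),
      ih fun j hj => hf j (Finset.mem_insert_of_mem hj)]

lemma trF_sum {ι : Type*} (s : Finset ι) (M : Matrix (Fin (m + 1)) (Fin (m + 1)) ℝ)
    (B : ι → Spc m →L[ℝ] Spc m →L[ℝ] ℝ) : trF M (∑ i ∈ s, B i) = ∑ i ∈ s, trF M (B i) := by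
  induction s using Finset.induction_on with
  | empty => simp [trF]
  | insert i s hi ih => rw [Finset.sum_insert hi, Finset.sum_insert hi, trF_add, ih]

lemma hasDerivAt_max_zero_sq {f : ℝ → ℝ} {d t : ℝ} (h : HasDerivAt f d t) :
    HasDerivAt (fun s => max (f s) 0 ^ 2) (2 * max (f t) 0 * d) t := by
  have key : HasDerivAt (fun y : ℝ => max y 0 ^ 2) (2 * max (f t) 0) (f t) := by
    rcases lt_trichotomy (f t) 0 with h0 | h0 | h0
    · have e : (fun y : ℝ => max y 0 ^ 2) =ᶠ[𝓝 (f t)] fun _ => 0 := by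
        filter_upwards [gt_mem_nhds h0] with y hy
        rw [max_eq_right (le_of_lt hy)]; norm_num
      rw [max_eq_right h0.le, mul_zero]
      exact (hasDerivAt_const _ _).congr_of_eventuallyEq e
    · rw [h0, max_self, mul_zero, hasDerivAt_iff_isLittleO_nhds_zero]
      simp only [zero_add, max_self, smul_zero, sub_zero]
      norm_num
      have h2 : (fun h : ℝ => h ^ 2) =o[𝓝 0] fun h : ℝ => h := by
        simpa using (Asymptotics.isLittleO_pow_id (𝕜 := ℝ) (n := 2) (by norm_num))
      refine Asymptotics.IsBigO.trans_isLittleO (Asymptotics.isBigO_of_le _ fun h => ?_) h2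
      rw [norm_pow, norm_pow]
      refine pow_le_pow_left₀ (norm_nonneg _) ?_ 2
      rw [Real.norm_eq_abs, abs_of_nonneg (le_max_right _ _)]
      exact max_le (le_abs_self h) (abs_nonneg h)
    · have e : (fun y : ℝ => max y 0 ^ 2) =ᶠ[𝓝 (f t)] fun y => y ^ 2 := by
        filter_upwards [lt_mem_nhds h0] with y hy
        rw [max_eq_left (le_of_lt hy)]
      rw [max_eq_left h0.le]
      exact ((by simpa using hasDerivAt_pow 2 (f t) : HasDerivAt (fun y : ℝ => y ^ 2) (2 * f t) (f t))).congr_of_eventuallyEq e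
  exact key.comp t h

lemma max_zero_sq_tangent (a b : ℝ) :
    max a 0 ^ 2 + 2 * max a 0 * (b - a) ≤ max b 0 ^ 2 := by
  rcases le_total a 0 with ha | ha <;> rcases le_total b 0 with hb | hb <;>
    simp only [max_eq_left, max_eq_right, ha, hb] <;> nlinarith [sq_nonneg (a - b), sq_nonneg b]

lemma abs_riemann_sum_sub_integral_le {f : ℝ → ℝ} {a δ ω τ : ℝ} {N : ℕ} (hδ : 0 ≤ δ)
    (hf : ContinuousOn f (Icc a (a + N * δ))) (hτ : τ ∈ Icc 0 δ)
    (hω : ∀ s ∈ Icc a (a + N * δ), ∀ s' ∈ Icc a (a + N * δ), |s - s'| ≤ δ → |f s - f s'| ≤ ω) :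
    |δ * ∑ i ∈ Finset.range N, f (a + τ + i * δ) - ∫ s in a..(a + N * δ), f s| ≤ N * δ * ω := by
  have hmem : ∀ i < N, Icc (a + i * δ) (a + (i + 1 : ℕ) * δ) ⊆ Icc a (a + N * δ) := by
    intro i hi s hs
    have h1 : (0 : ℝ) ≤ i * δ := by positivity
    have h2 : ((i + 1 : ℕ) : ℝ) * δ ≤ N * δ :=
      mul_le_mul_of_nonneg_right (by exact_mod_cast hi) hδ
    exact ⟨by linarith [hs.1], by linarith [hs.2]⟩
  have hle : ∀ i : ℕ, a + i * δ ≤ a + (i + 1 : ℕ) * δ := fun i => by push_cast; nlinarith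
  have hint : ∀ i < N, IntervalIntegrable f volume (a + i * δ) (a + (i + 1 : ℕ) * δ) := by
    intro i hi
    refine ContinuousOn.intervalIntegrable (hf.mono ?_)
    rw [uIcc_of_le (hle i)]
    exact hmem i hi
  have hsum := intervalIntegral.sum_integral_adjacent_intervals (f := f) (μ := volume)
    (a := fun i : ℕ => a + i * δ) (n := N) hint
  have h0 : a + ((0 : ℕ) : ℝ) * δ = a := by simp
  simp only [h0] at hsum
  rw [← hsum, Finset.mul_sum, ← Finset.sum_sub_distrib]
  refine (Finset.abs_sum_le_sum_abs _ _).trans ?_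
  have : ∀ i ∈ Finset.range N, |δ * f (a + τ + i * δ) -
      ∫ s in (a + i * δ)..(a + (i + 1 : ℕ) * δ), f s| ≤ δ * ω := by
    intro i hi
    have hi' := Finset.mem_range.1 hi
    have e : a + ((i + 1 : ℕ) : ℝ) * δ - (a + i * δ) = δ := by push_cast; ring
    have e1 : δ * f (a + τ + i * δ) = ∫ s in (a + i * δ)..(a + (i + 1 : ℕ) * δ),
        f (a + τ + i * δ) := by
      rw [intervalIntegral.integral_const, e, smul_eq_mul]
    rw [e1, ← intervalIntegral.integral_sub intervalIntegrable_const (hint i hi')]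
    have := intervalIntegral.norm_integral_le_of_norm_le_const (a := a + i * δ)
      (b := a + (i + 1 : ℕ) * δ) (C := ω) (f := fun s => f (a + τ + i * δ) - f s) ?_
    · rw [e, abs_of_nonneg hδ, Real.norm_eq_abs] at this
      linarith
    · intro s hs
      rw [uIoc_of_le (hle i)] at hs
      have hs' : a + ((i + 1 : ℕ) : ℝ) * δ = a + i * δ + δ := by push_cast; ring
      rw [hs'] at hs
      refine hω _ (hmem i hi' ⟨by linarith [hτ.1], by rw [hs']; linarith [hτ.2]⟩) _
        (hmem i hi' ⟨hs.1.le, by rw [hs']; exact hs.2⟩) ?_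
      rw [abs_le]
      constructor <;> linarith [hτ.1, hτ.2, hs.1, hs.2]
  refine (Finset.sum_le_sum this).trans ?_
  rw [Finset.sum_const, Finset.card_range, nsmul_eq_mul]
  linarith

end timeAverage

section timeAverage
variable {m : ℕ} {lam Lam : ℝ} {A : Spc m → Matrix (Fin (m + 1)) (Fin (m + 1)) ℝ}

set_option maxHeartbeats 1000000 in
/-- The time average of the squared positive part of a subsolution satisfies a strict maximum
principle, as soon as the subsolution is nonpositive initially. -/
theorem not_isMax_timeAverage (hlam : 0 < lam) (hA : IsElliptic lam Lam A)
    {Z : Spc m × ℝ → ℝ} {x0 c : Spc m} {r t0 T η : ℝ} (hr : 0 < r) (hT : t0 < T) (hη : 0 < η)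
    (hcont : ∀ x ∈ Metric.closedBall c r, ∀ s ∈ Icc t0 T, ContinuousAt Z (x, s))
    (hinit : ∀ x ∈ Metric.closedBall c r, Z (x, t0) ≤ 0)
    (hsub : ∀ x ∈ Metric.closedBall c r, ∀ s ∈ Icc t0 T, ContDiffAt ℝ 2 (fun y => Z (y, s)) x ∧
      ∃ d, HasDerivAt (fun τ => Z (x, τ)) d s ∧ d ≤ trF (A x) (D2 (fun y => Z (y, s)) x)) :
    ¬∀ x ∈ Metric.closedBall c r,
      (∫ s in t0..T, max (Z (x, s)) 0 ^ 2) + η * ‖x - x0‖ ^ 2 ≤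
        (∫ s in t0..T, max (Z (c, s)) 0 ^ 2) + η * ‖c - x0‖ ^ 2 := by
  intro hmax
  have hcK : c ∈ Metric.closedBall c r := Metric.mem_closedBall_self hr.le
  have hKc := isCompact_closedBall c r
  have hfc : ∀ x ∈ Metric.closedBall c r, ∀ s ∈ Icc t0 T,
      ContinuousAt (fun q => max (Z q) 0 ^ 2) (x, s) := fun x hx s hs =>
    ((hcont x hx s hs).max continuousAt_const).pow 2
  have huc := (hKc.prod (isCompact_Icc (a := t0) (b := T))).uniformContinuousOn_of_continuous
    (f := fun q : Spc m × ℝ => max (Z q) 0 ^ 2)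
    (fun q hq => (hfc q.1 hq.1 q.2 hq.2).continuousWithinAt)
  rw [Metric.uniformContinuousOn_iff] at huc
  obtain ⟨e, he⟩ : ∃ e : ℝ, e = η / 2 * r ^ 2 := ⟨_, rfl⟩
  have he0 : 0 < e := by rw [he]; positivity
  obtain ⟨ρ, hρ, huc⟩ := huc (e / (4 * (T - t0))) (div_pos he0 (by linarith))
  obtain ⟨c0, hc0⟩ : ∃ c0 : ℝ, c0 = η * (lam * (m + 1)) := ⟨_, rfl⟩
  have hc00 : 0 < c0 := by rw [hc0]; positivity
  obtain ⟨N, hN⟩ := exists_nat_gt (max ((T - t0) / ρ) (c0 * (T - t0) / e))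
  have hN1 := (le_max_left _ _).trans_lt hN
  have hN2 := (le_max_right _ _).trans_lt hN
  have hN0 : (0 : ℝ) < N := lt_trans (div_pos (by linarith) hρ) hN1
  obtain ⟨δ, hδ⟩ : ∃ δ : ℝ, δ = (T - t0) / N := ⟨_, rfl⟩
  have hδ0 : 0 < δ := by rw [hδ]; exact div_pos (by linarith) hN0
  have hNδ : N * δ = T - t0 := by rw [hδ]; field_simp
  have hδρ : δ < ρ := by
    rw [div_lt_iff₀ hρ] at hN1
    rw [hδ, div_lt_iff₀ hN0]; linarith
  have hδe : c0 * δ < e := by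
    rw [div_lt_iff₀ he0] at hN2
    rw [hδ, ← mul_div_assoc, div_lt_iff₀ hN0]; linarith
  have hT' : t0 + N * δ = T := by linarith
  obtain ⟨F, hF⟩ : ∃ F : Spc m × ℝ → ℝ, F = fun q =>
      δ * (∑ i ∈ Finset.range N, max (Z (q.1, q.2 + i * δ)) 0 ^ 2) +
        (η * ‖q.1 - x0‖ ^ 2 - η / 2 * ‖q.1 - c‖ ^ 2) := ⟨_, rfl⟩
  have htime : ∀ s ∈ Icc t0 (t0 + δ), ∀ i < N, s + i * δ ∈ Icc t0 T := by
    intro s hs i hi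
    have h1 : (0 : ℝ) ≤ i * δ := by positivity
    have h2 : ((i + 1 : ℕ) : ℝ) * δ ≤ N * δ :=
      mul_le_mul_of_nonneg_right (by exact_mod_cast hi) hδ0.le
    push_cast at h2
    exact ⟨by linarith [hs.1], by linarith [hs.2]⟩
  have hFW : ∀ x ∈ Metric.closedBall c r, ∀ s ∈ Icc t0 (t0 + δ),
      |F (x, s) - ((∫ s in t0..T, max (Z (x, s)) 0 ^ 2) +
        (η * ‖x - x0‖ ^ 2 - η / 2 * ‖x - c‖ ^ 2))| ≤ e / 4 := by
    intro x hx s hs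
    have := abs_riemann_sum_sub_integral_le (f := fun s => max (Z (x, s)) 0 ^ 2) (a := t0)
      (δ := δ) (ω := e / (4 * (T - t0))) (τ := s - t0) (N := N) hδ0.le ?_
      ⟨by linarith [hs.1], by linarith [hs.2]⟩ ?_
    · rw [hT', hNδ] at this
      have e1 : (T - t0) * (e / (4 * (T - t0))) = e / 4 := by
        field_simp [show T - t0 ≠ 0 by linarith]
      rw [e1, show t0 + (s - t0) = s by ring] at this
      rw [hF]
      simpa only [add_sub_add_right_eq_sub] using this
    · rw [hT']
      intro s' hs'
      exact (ContinuousAt.comp (x := s') (f := fun s => (x, s)) (hfc x hx s' hs')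
        (Continuous.prodMk_right x).continuousAt).continuousWithinAt
    · rw [hT']
      intro s1 h1 s2 h2 h12
      have := huc (x, s1) ⟨hx, h1⟩ (x, s2) ⟨hx, h2⟩ (by
        rw [Prod.dist_eq, dist_self, Real.dist_eq]
        exact max_lt hρ (by linarith))
      rw [Real.dist_eq] at this
      exact this.le
  have hFc : ∀ x ∈ Metric.closedBall c r, ∀ s ∈ Icc t0 (t0 + δ), ContinuousAt F (x, s) := by
    intro x hx s hs
    rw [hF]
    refine ContinuousAt.add (continuousAt_const.mul (tendsto_finsetSum _ fun i hi => ?_))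
      (by fun_prop)
    exact ContinuousAt.comp (x := (x, s)) (f := fun q : Spc m × ℝ => (q.1, q.2 + i * δ))
      (hfc x hx _ (htime s hs i (Finset.mem_range.1 hi))) (by fun_prop)
  have hs0 : t0 ∈ Icc t0 (t0 + δ) := ⟨le_rfl, by linarith⟩
  obtain ⟨x1, hx1, hx1max⟩ := hKc.exists_isMaxOn ⟨c, hcK⟩ (f := fun x => F (x, t0))
    (fun x hx => (ContinuousAt.comp (x := x) (f := fun y => (y, t0)) (hFc x hx t0 hs0)
      (Continuous.prodMk_left t0).continuousAt).continuousWithinAt)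
  have hmin := min_principle (z := fun q => F (x1, t0) - c0 / 2 * (q.2 - t0) - F q) hKc
    (a := t0) (b := t0 + δ) ?_ ?_ ?_ (t0 + δ) ⟨by linarith, le_rfl⟩ x1 hx1
  · have htel : F (x1, t0 + δ) - F (x1, t0) =
        δ * (max (Z (x1, T)) 0 ^ 2 - max (Z (x1, t0)) 0 ^ 2) := by
      have h := Finset.sum_range_sub (fun i : ℕ => max (Z (x1, t0 + i * δ)) 0 ^ 2) N
      rw [hT', Nat.cast_zero, zero_mul, add_zero, Finset.sum_sub_distrib] at h
      rw [← h, hF]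
      have e1 : ∀ i : ℕ, t0 + δ + i * δ = t0 + (i + 1 : ℕ) * δ := fun i => by push_cast; ring
      simp only [e1]
      ring
    rw [max_eq_right (hinit x1 hx1)] at htel
    have : 0 ≤ δ * (max (Z (x1, T)) 0 ^ 2 - 0 ^ 2) := by
      rw [zero_pow two_ne_zero, sub_zero]; positivity
    have h3 : 0 < c0 * δ := by positivity
    simp only at hmin
    linarith
  · intro t ht x hx b hb
    have : ContinuousAt (fun q : Spc m × ℝ => F (x1, t0) - c0 / 2 * (q.2 - t0) - F q) (x, t) :=
      ContinuousAt.sub (by fun_prop) (hFc x hx t ht)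
    exact nhdsWithin_le_nhds (this.eventually (lt_mem_nhds hb))
  · intro x hx
    have : F (x, t0) ≤ F (x1, t0) := hx1max hx
    simp only [sub_self, mul_zero, sub_zero]
    linarith
  · intro t ht x hx hneg hxmin
    have htI : t ∈ Icc t0 (t0 + δ) := ⟨ht.1.le, ht.2⟩
    simp only at hneg hxmin
    have hxint : dist x c < r := by
      refine lt_of_le_of_ne hx fun h => ?_
      rw [dist_eq_norm] at h
      have h1 := (abs_le.1 (hFW x hx t htI)).2
      have h2 := (abs_le.1 (hFW c hcK t0 hs0)).1
      have h3 : F (c, t0) ≤ F (x1, t0) := hx1max hcK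
      have h4 := hmax x hx
      rw [h, ← he] at h1
      rw [sub_self, norm_zero] at h2
      have h5 : c0 / 2 * (t - t0) ≤ c0 / 2 * δ :=
        mul_le_mul_of_nonneg_left (by linarith [ht.2]) (by positivity)
      linarith
    have hz : ∀ i ∈ Finset.range N, ContDiffAt ℝ 2 (fun y => Z (y, t + i * δ)) x ∧
        ∃ d, HasDerivAt (fun τ => Z (x, τ)) d (t + i * δ) ∧
          d ≤ trF (A x) (D2 (fun y => Z (y, t + i * δ)) x) := fun i hi =>
      hsub x hx _ (htime t htI i (Finset.mem_range.1 hi))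
    choose! hz1 d hd hdle using hz
    refine ⟨-(c0 / 2) - δ * ∑ i ∈ Finset.range N, 2 * max (Z (x, t + i * δ)) 0 * d i, ?_, ?_⟩
    · obtain ⟨a, ha⟩ : ∃ a : ℕ → ℝ, a = fun i : ℕ => δ * (2 * max (Z (x, t + i * δ)) 0) := ⟨_, rfl⟩
      have ha0 : ∀ i, 0 ≤ a i := fun i => by rw [ha]; positivity
      have hq2 : ContDiffAt ℝ 2 (fun y : Spc m => η / 2 * ‖y - c‖ ^ 2 - η * ‖y - x0‖ ^ 2) x :=
        ((contDiff_normSq_sub c).contDiffAt.const_smul (η / 2)).sub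
          ((contDiff_normSq_sub x0).contDiffAt.const_smul η)
      have hcd : ∀ i ∈ Finset.range N, ContDiffAt ℝ 2 (fun y => a i * Z (y, t + i * δ)) x :=
        fun i hi => (hz1 i hi).const_smul (a i)
      have hloc : IsLocalMin (fun y => (η / 2 * ‖y - c‖ ^ 2 - η * ‖y - x0‖ ^ 2) -
          ∑ i ∈ Finset.range N, a i * Z (y, t + i * δ)) x := by
        filter_upwards [Metric.isOpen_ball.mem_nhds (x := x) hxint] with y hy
        have h1 := hxmin y (Metric.ball_subset_closedBall hy)
        have h2 : F (y, t) ≤ F (x, t) := by linarith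
        have h3 : ∑ i ∈ Finset.range N, (a i * Z (y, t + i * δ) - a i * Z (x, t + i * δ)) ≤
            ∑ i ∈ Finset.range N, (δ * max (Z (y, t + i * δ)) 0 ^ 2 -
              δ * max (Z (x, t + i * δ)) 0 ^ 2) := by
          refine Finset.sum_le_sum fun i _ => ?_
          have := mul_le_mul_of_nonneg_left
            (max_zero_sq_tangent (Z (x, t + i * δ)) (Z (y, t + i * δ))) hδ0.le
          simp only [ha]
          linarith
        rw [Finset.sum_sub_distrib, Finset.sum_sub_distrib, ← Finset.mul_sum,
          ← Finset.mul_sum] at h3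
        simp only [hF] at h2
        linarith
      have h4 := trF_D2_le_of_isLocalMin hA hlam.le hq2 (ContDiffAt.sum hcd) hloc
      rw [D2_sum _ _ _ hcd, trF_sum] at h4
      have h5 : trF (A x) (D2 (fun y : Spc m => η / 2 * ‖y - c‖ ^ 2 - η * ‖y - x0‖ ^ 2) x) =
          -η * trF (A x) (innerForm m) := by
        have hq3 : ContDiffAt ℝ 2 (fun y : Spc m => η / 2 * ‖y - c‖ ^ 2) x :=
          (contDiff_normSq_sub c).contDiffAt.const_smul (η / 2)
        have hq4 : ContDiffAt ℝ 2 (fun y : Spc m => η * ‖y - x0‖ ^ 2) x :=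
          (contDiff_normSq_sub x0).contDiffAt.const_smul η
        rw [D2_sub hq3 hq4, trF_sub, D2_const_mul, D2_const_mul, D2_normSq_sub, D2_normSq_sub,
          trF_smul, trF_smul, trF_smul, trF_smul]
        ring
      have h6 : lam * (m + 1) ≤ trF (A x) (innerForm m) := by
        have := hA.le_trF x (B := innerForm m) (fun ξ => by simp)
        simpa [eVec] using this
      rw [h5] at h4
      have h7 : δ * ∑ i ∈ Finset.range N, 2 * max (Z (x, t + i * δ)) 0 * d i ≤
          ∑ i ∈ Finset.range N, trF (A x) (D2 (fun y => a i * Z (y, t + i * δ)) x) := by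
        rw [Finset.mul_sum]
        refine Finset.sum_le_sum fun i hi => ?_
        rw [D2_const_mul, trF_smul]
        have := mul_le_mul_of_nonneg_left (hdle i hi) (ha0 i)
        refine le_trans (le_of_eq ?_) this
        simp only [ha]; ring
      have h8 := mul_le_mul_of_nonneg_left h6 hη.le
      rw [← hc0] at h8
      linarith
    · have h1 : ∀ i ∈ Finset.range N, HasDerivAt (fun s => max (Z (x, s + i * δ)) 0 ^ 2)
          (2 * max (Z (x, t + i * δ)) 0 * d i) t := fun i hi =>
        hasDerivAt_max_zero_sq (f := fun s => Z (x, s + i * δ)) ((hd i hi).comp_add_const t _)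
      have h2 := (HasDerivAt.fun_sum h1).const_mul δ
      have h3 : HasDerivAt (fun s => F (x1, t0) - c0 / 2 * (s - t0)) (-(c0 / 2)) t := by
        simpa using (((hasDerivAt_id t).sub_const t0).const_mul (c0 / 2)).const_sub (F (x1, t0))
      have h4 := h3.sub (h2.add_const (η * ‖x - x0‖ ^ 2 - η / 2 * ‖x - c‖ ^ 2))
      rw [hF]
      rw [hF] at h4
      exact h4

end timeAverage

section semicontinuity
variable {m : ℕ} {lam Lam : ℝ} {A : Spc m → Matrix (Fin (m + 1)) (Fin (m + 1)) ℝ}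

lemma hasDerivAt_trF {u : Spc m × ℝ → ℝ} {Ω : Set (Spc m × ℝ)} (hu : SolvesL A u Ω)
    {x : Spc m} {t : ℝ} (h : (x, t) ∈ Ω) :
    HasDerivAt (fun s => u (x, s)) (trF (A x) (D2 (fun y => u (y, t)) x)) t := by
  obtain ⟨h1, h2⟩ := hu _ h
  rwa [Lop_eq _ _ _ h1] at h2

set_option maxHeartbeats 1000000 in
/-- A nonnegative solution is forward lower semicontinuous at a point as soon as it is continuous
off a family of vertical lines along which it is close to its value at that point. -/
theorem rlsc_of_lines (hlam : 0 < lam) (hA : IsElliptic lam Lam A) {u : Spc m × ℝ → ℝ}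
    {Ω : Set (Spc m × ℝ)} (hu : SolvesL A u Ω) (h0 : ∀ p ∈ Ω, 0 ≤ u p) {x0 : Spc m} {t0 : ℝ}
    (h : ∀ ε > 0, ∃ R > 0, ∃ X : Set (Spc m), IsClosed X ∧
      Metric.closedBall x0 R ×ˢ Icc (t0 - R) (t0 + R) ⊆ Ω ∧
      (∀ x ∈ X ∩ Metric.closedBall x0 R, ∀ s ∈ Icc (t0 - R) (t0 + R), u (x0, t0) - ε ≤ u (x, s)) ∧
      ∀ x ∈ Metric.closedBall x0 R \ X, ∀ s ∈ Icc (t0 - R) (t0 + R), ContinuousAt u (x, s)) :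
    RLSC u (x0, t0) := by
  intro c' hc'
  obtain ⟨c, hc⟩ : ∃ c : ℝ, c = u (x0, t0) := ⟨_, rfl⟩
  rw [← hc] at hc'
  obtain ⟨R, hR, X, hX, hΩ, hlow, hcontu⟩ := h ((c - c') / 4) (by linarith)
  rw [← hc] at hlow
  obtain ⟨ε, hε⟩ : ∃ ε : ℝ, ε = (c - c') / 4 := ⟨_, rfl⟩
  rw [← hε] at hlow
  have hε0 : 0 < ε := by linarith
  have hmemΩ : ∀ x ∈ Metric.closedBall x0 R, ∀ s ∈ Icc t0 (t0 + R), (x, s) ∈ Ω :=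
    fun x hx s hs => hΩ ⟨hx, by simp only; linarith [hs.1], hs.2⟩
  rcases lt_or_ge c' 0 with hneg | hc'0
  · have : Metric.closedBall x0 R ×ˢ Icc (t0 - R) (t0 + R) ∈ 𝓝 (x0, t0) :=
      prod_mem_nhds (Metric.closedBall_mem_nhds _ hR) (Icc_mem_nhds (by linarith) (by linarith))
    filter_upwards [nhdsWithin_le_nhds this] with q hq
    exact hneg.trans_le (h0 q (hΩ hq))
  have hc0 : 0 < c := by linarith
  have hx0R : x0 ∈ Metric.closedBall x0 R := Metric.mem_closedBall_self hR.le
  have ht0 : t0 ∈ Icc t0 (t0 + R) := ⟨le_rfl, by linarith⟩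
  have hsl : ∀ᶠ x in 𝓝 x0, c - ε < u (x, t0) :=
    (hu _ (hmemΩ x0 hx0R t0 ht0)).1.continuousAt.eventually (lt_mem_nhds (by simp only; linarith))
  obtain ⟨r', hr', hball⟩ := Metric.nhds_basis_closedBall.mem_iff.1 hsl
  obtain ⟨r, hr⟩ : ∃ r : ℝ, r = min r' (R / 2) := ⟨_, rfl⟩
  have hr0 : 0 < r := by rw [hr]; exact lt_min hr' (by linarith)
  have hrR : r ≤ R / 2 := by rw [hr]; exact min_le_right _ _
  have hslice : ∀ x ∈ Metric.closedBall x0 r, c - ε < u (x, t0) := fun x hx =>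
    hball (Metric.closedBall_subset_closedBall (by rw [hr]; exact min_le_left _ _) hx)
  have hsub : Metric.closedBall x0 r ⊆ Metric.closedBall x0 R :=
    Metric.closedBall_subset_closedBall (by linarith)
  obtain ⟨B, hB⟩ : ∃ B : ℝ, B = 2 * c / r ^ 2 * ((m + 1) * Lam) := ⟨_, rfl⟩
  have hI := fun x => hA.trF_innerForm_le x
  have hI0 := fun x => trF_innerForm_nonneg hA hlam.le x
  have hB0 : 0 ≤ B := by
    rw [hB]; exact mul_nonneg (by positivity) ((hI0 x0).trans (hI x0))
  obtain ⟨Z, hZ⟩ : ∃ Z : Spc m × ℝ → ℝ, Z = fun q =>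
      (c - 2 * ε - B * (q.2 - t0)) - c / r ^ 2 * ‖q.1 - x0‖ ^ 2 - u q := ⟨_, rfl⟩
  have hpos : ∀ x, 0 ≤ c / r ^ 2 * ‖x - x0‖ ^ 2 := fun x => by positivity
  have hBs : ∀ s ∈ Icc t0 (t0 + R), 0 ≤ B * (s - t0) := fun s hs =>
    mul_nonneg hB0 (by linarith [hs.1])
  have hZle : ∀ x ∈ Metric.closedBall x0 R, ∀ s ∈ Icc t0 (t0 + R), Z (x, s) ≤ c := by
    intro x hx s hs
    rw [hZ]
    have := h0 _ (hmemΩ x hx s hs)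
    have := hpos x
    have := hBs s hs
    simp only; linarith
  have hZdiff : ∀ x ∈ Metric.closedBall x0 R, ∀ s ∈ Icc t0 (t0 + R),
      ContDiffAt ℝ 2 (fun y => Z (y, s)) x ∧
      ∃ d, HasDerivAt (fun τ => Z (x, τ)) d s ∧ d ≤ trF (A x) (D2 (fun y => Z (y, s)) x) := by
    intro x hx s hs
    have hp := hmemΩ x hx s hs
    have hu1 : ContDiffAt ℝ 2 (fun y => u (y, s)) x := (hu _ hp).1
    have hq : ContDiffAt ℝ 2 (fun y : Spc m => c / r ^ 2 * ‖y - x0‖ ^ 2) x :=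
      (contDiff_normSq_sub x0).contDiffAt.const_smul (c / r ^ 2)
    have hk : ContDiffAt ℝ 2 (fun _ : Spc m => c - 2 * ε - B * (s - t0)) x := contDiffAt_const
    refine ⟨?_, -B - trF (A x) (D2 (fun y => u (y, s)) x), ?_, ?_⟩
    · rw [hZ]; exact (hk.sub hq).sub hu1
    · rw [hZ]
      have h1 : HasDerivAt (fun τ => c - 2 * ε - B * (τ - t0)) (-B) s := by
        simpa using (((hasDerivAt_id s).sub_const t0).const_mul B).const_sub (c - 2 * ε)
      exact (h1.sub_const (c / r ^ 2 * ‖x - x0‖ ^ 2)).sub (hasDerivAt_trF hu hp)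
    · have e : D2 (fun y => Z (y, s)) x = D2 (fun _ : Spc m => c - 2 * ε - B * (s - t0)) x -
          D2 (fun y : Spc m => c / r ^ 2 * ‖y - x0‖ ^ 2) x - D2 (fun y => u (y, s)) x := by
        rw [hZ, ← D2_sub hk hq]
        exact D2_sub (hk.sub hq) hu1
      rw [e, D2_const, D2_const_mul, D2_normSq_sub, trF_sub, trF_sub, trF_smul, trF_smul]
      have e0 : trF (A x) (0 : Spc m →L[ℝ] Spc m →L[ℝ] ℝ) = 0 := by simp [trF]
      rw [e0]
      have := mul_le_mul_of_nonneg_left (hI x) (show 0 ≤ 2 * c / r ^ 2 by positivity)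
      rw [← hB] at this
      have e1 : c / r ^ 2 * (2 * trF (A x) (innerForm m)) =
        2 * c / r ^ 2 * trF (A x) (innerForm m) := by ring
      rw [e1]; linarith
  have hZx : ∀ x ∈ Metric.closedBall x0 R, ∀ s ∈ Icc t0 (t0 + R),
      ContinuousAt (fun τ => Z (x, τ)) s := fun x hx s hs => by
    obtain ⟨d, hd, -⟩ := (hZdiff x hx s hs).2
    exact hd.continuousAt
  have hle : t0 ≤ t0 + R := by linarith
  obtain ⟨W, hW⟩ : ∃ W : Spc m → ℝ, W = fun x => ∫ s in t0..(t0 + R), max (Z (x, s)) 0 ^ 2 :=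
    ⟨_, rfl⟩
  have hfc : ∀ x ∈ Metric.closedBall x0 R,
      ContinuousOn (fun s => max (Z (x, s)) 0 ^ 2) (Icc t0 (t0 + R)) := fun x hx s hs =>
    ContinuousAt.continuousWithinAt (((hZx x hx s hs).max continuousAt_const).pow 2)
  have hWc : ContinuousOn W (Metric.closedBall x0 r) := by
    intro x hx
    have hnear : ∀ᶠ y in 𝓝 x, y ∈ Metric.closedBall x0 R := by
      filter_upwards [Metric.isOpen_ball.mem_nhds (x := x) (s := Metric.ball x0 R)
        (Metric.closedBall_subset_ball (by linarith) hx)] with y hy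
      exact Metric.ball_subset_closedBall hy
    refine ContinuousAt.continuousWithinAt ?_
    rw [hW]
    refine intervalIntegral.continuousAt_of_dominated_interval (bound := fun _ => c ^ 2) ?_ ?_
      intervalIntegrable_const ?_
    · filter_upwards [hnear] with y hy
      rw [uIoc_of_le hle]
      exact ((hfc y hy).mono Ioc_subset_Icc_self).aestronglyMeasurable measurableSet_Ioc
    · filter_upwards [hnear] with y hy
      refine Eventually.of_forall fun s hs => ?_
      rw [uIoc_of_le hle] at hs
      rw [Real.norm_eq_abs, abs_of_nonneg (sq_nonneg _)]
      exact pow_le_pow_left₀ (le_max_right _ _)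
        (max_le (hZle y hy s (Ioc_subset_Icc_self hs)) hc0.le) 2
    · refine Eventually.of_forall fun s hs => ?_
      rw [uIoc_of_le hle] at hs
      exact ((((hZdiff x (hsub hx) s (Ioc_subset_Icc_self hs)).1).continuousAt).max
        continuousAt_const).pow 2
  have hWzero : ∀ x ∈ Metric.closedBall x0 R, (∀ s ∈ Icc t0 (t0 + R), Z (x, s) ≤ 0) → W x = 0 := by
    intro x hx hZ0
    have : ∫ s in t0..(t0 + R), max (Z (x, s)) 0 ^ 2 = ∫ s in t0..(t0 + R), (0 : ℝ) := by
      refine intervalIntegral.integral_congr fun s hs => ?_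
      rw [uIcc_of_le hle] at hs
      rw [max_eq_right (hZ0 s hs)]; norm_num
    rw [hW]
    simpa using this
  have hWnonpos : ∀ x ∈ Metric.closedBall x0 r, W x ≤ 0 := by
    by_contra! hcon
    obtain ⟨x1, hx1, hWx1⟩ := hcon
    obtain ⟨η, hη⟩ : ∃ η : ℝ, η = W x1 / (2 * r ^ 2) := ⟨_, rfl⟩
    have hη0 : 0 < η := by rw [hη]; positivity
    have hηr : η * r ^ 2 = W x1 / 2 := by rw [hη]; field_simp
    obtain ⟨z, hz, hzmax⟩ := (isCompact_closedBall x0 r).exists_isMaxOn ⟨x1, hx1⟩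
      (f := fun x => W x + η * ‖x - x0‖ ^ 2) (hWc.add (by fun_prop))
    have hzval : W x1 ≤ W z + η * ‖z - x0‖ ^ 2 := by
      have h1 : W x1 + η * ‖x1 - x0‖ ^ 2 ≤ W z + η * ‖z - x0‖ ^ 2 := hzmax hx1
      have : 0 ≤ η * ‖x1 - x0‖ ^ 2 := by positivity
      linarith
    have hzd : ‖z - x0‖ ≤ r := by rw [← dist_eq_norm]; exact hz
    have hzle : η * ‖z - x0‖ ^ 2 ≤ η * r ^ 2 :=
      mul_le_mul_of_nonneg_left (pow_le_pow_left₀ (norm_nonneg _) hzd 2) hη0.le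
    have hWz : W z ≠ 0 := by intro h; linarith
    have hzX : z ∉ X := by
      intro hzX
      refine hWz (hWzero z (hsub hz) fun s hs => ?_)
      have h1 := hlow z ⟨hzX, hsub hz⟩ s ⟨by linarith [hs.1], hs.2⟩
      have h2 := hpos z
      have h3 := hBs s hs
      rw [hZ]; simp only; linarith
    have hzlt : dist z x0 < r := by
      refine lt_of_le_of_ne hz fun h => hWz (hWzero z (hsub hz) fun s hs => ?_)
      have h1 := h0 _ (hmemΩ z (hsub hz) s hs)
      have h3 := hBs s hs
      have h4 : c / r ^ 2 * ‖z - x0‖ ^ 2 = c := by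
        rw [← dist_eq_norm, h]; field_simp
      rw [hZ]; simp only; linarith
    obtain ⟨ρ, hρ, hρsub⟩ := Metric.nhds_basis_closedBall.mem_iff.1
      ((Metric.isOpen_ball.inter hX.isOpen_compl).mem_nhds (x := z) ⟨hzlt, hzX⟩)
    have hρ1 : Metric.closedBall z ρ ⊆ Metric.closedBall x0 r := fun x hx =>
      Metric.ball_subset_closedBall (hρsub hx).1
    refine not_isMax_timeAverage (Z := Z) (x0 := x0) (c := z) (r := ρ) (t0 := t0) (T := t0 + R)
      hlam hA hρ (by linarith) hη0 ?_ ?_ (fun x hx s hs => hZdiff x (hsub (hρ1 hx)) s hs) ?_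
    · intro x hx s hs
      have := hcontu x ⟨hsub (hρ1 hx), (hρsub hx).2⟩ s ⟨by linarith [hs.1], hs.2⟩
      rw [hZ]
      exact ContinuousAt.sub (by fun_prop) this
    · intro x hx
      have h1 := hslice x (hρ1 hx)
      have h2 := hpos x
      rw [hZ]; simp only [sub_self, mul_zero]; linarith
    · intro x hx
      have : W x + η * ‖x - x0‖ ^ 2 ≤ W z + η * ‖z - x0‖ ^ 2 := hzmax (hρ1 hx)
      rw [hW] at this
      exact this
  have hZnonpos : ∀ x ∈ Metric.closedBall x0 r, ∀ s ∈ Icc t0 (t0 + R), Z (x, s) ≤ 0 := by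
    intro x hx s hs
    by_contra! hcon
    have := intervalIntegral.integral_pos (a := t0) (b := t0 + R) (by linarith) (hfc x (hsub hx))
      (fun s _ => sq_nonneg _) ⟨s, hs, by
        rw [max_eq_left hcon.le]; positivity⟩
    have h2 := hWnonpos x hx
    rw [hW] at h2
    simp only at h2
    linarith
  have hev : ∀ᶠ q : Spc m × ℝ in 𝓝 (x0, t0),
      c' < (c - 2 * ε - B * (q.2 - t0)) - c / r ^ 2 * ‖q.1 - x0‖ ^ 2 := by
    have : ContinuousAt (fun q : Spc m × ℝ =>
      (c - 2 * ε - B * (q.2 - t0)) - c / r ^ 2 * ‖q.1 - x0‖ ^ 2) (x0, t0) := by fun_prop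
    refine this.eventually (lt_mem_nhds ?_)
    simp only [sub_self, mul_zero, norm_zero]
    norm_num
    linarith
  have hnb : Metric.closedBall x0 r ×ˢ Icc (t0 - R) (t0 + R) ∈ 𝓝 (x0, t0) :=
    prod_mem_nhds (Metric.closedBall_mem_nhds _ hr0) (Icc_mem_nhds (by linarith) (by linarith))
  filter_upwards [nhdsWithin_le_nhds hev, nhdsWithin_le_nhds hnb, self_mem_nhdsWithin]
    with q hq1 hq2 hq3
  have := hZnonpos q.1 hq2.1 q.2 ⟨hq3, hq2.2.2⟩
  rw [hZ] at this
  simp only at this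
  linarith

end semicontinuity

section continuity
variable {m : ℕ} {lam Lam : ℝ} {A : Spc m → Matrix (Fin (m + 1)) (Fin (m + 1)) ℝ}

lemma IsElliptic.lam_le (hA : IsElliptic lam Lam A) : lam ≤ Lam := by
  have h := hA.2 0 (eVec m 0)
  have h3 : ‖eVec m 0‖ = 1 := by simp [eVec]
  rw [h3] at h
  linarith

/-- If `u` is uniformly Lipschitz in time along the lines through the points outside an open set
`G`, then near every point the lines missing `G` carry values close to the value at the point. -/
lemma exists_lines {u : Spc m × ℝ → ℝ} {U G : Set (Spc m × ℝ)} (hu : SolvesL A u U)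
    (hU : IsOpen U) (hG : IsOpen G) {σ L : ℝ} (hσ : 0 < σ) (hL : 0 ≤ L)
    (hlip : ∀ p ∈ U \ G, ∀ s s', |s - p.2| < σ → |s' - p.2| < σ →
      |u (p.1, s) - u (p.1, s')| ≤ L * (|s - p.2| + |s' - p.2|))
    {x0 : Spc m} {t0 : ℝ} (hp : (x0, t0) ∈ U) {ε : ℝ} (hε : 0 < ε) :
    ∃ R > 0, R ≤ 1 ∧ ∃ X : Set (Spc m), IsCompact X ∧ X ⊆ Metric.closedBall x0 R ∧
      Metric.closedBall x0 R ×ˢ Icc (t0 - R) (t0 + R) ⊆ U ∧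
      (∀ x ∈ X, ∀ s ∈ Icc (t0 - R) (t0 + R), |u (x, s) - u (x0, t0)| ≤ ε) ∧
      (∀ x ∈ Metric.closedBall x0 R \ X, ∀ s ∈ Icc (t0 - R) (t0 + R), (x, s) ∈ G) ∧
      ((x0, t0) ∉ G → x0 ∈ X) := by
  obtain ⟨R1, hR1, hR1U⟩ := Metric.nhds_basis_closedBall.mem_iff.1 (hU.mem_nhds hp)
  have hsl : ∀ᶠ x in 𝓝 x0, |u (x, t0) - u (x0, t0)| < ε / 2 := by
    have h1 : ContinuousAt (fun y => u (y, t0)) x0 := (hu _ hp).1.continuousAt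
    simpa [Real.dist_eq] using h1.eventually (Metric.ball_mem_nhds _ (half_pos hε))
  obtain ⟨R2, hR2, hR2u⟩ := Metric.nhds_basis_closedBall.mem_iff.1 hsl
  obtain ⟨R3, hR3⟩ : ∃ R3 : ℝ, R3 = min (min (σ / 3) (ε / (6 * (L + 1)))) 1 := ⟨_, rfl⟩
  obtain ⟨R, hR⟩ : ∃ R : ℝ, R = min (min R1 R2) R3 := ⟨_, rfl⟩
  have hR30 : 0 < R3 := by rw [hR3]; positivity
  have hR0 : 0 < R := by rw [hR]; exact lt_min (lt_min hR1 hR2) hR30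
  have hRR1 : R ≤ R1 := by rw [hR]; exact (min_le_left _ _).trans (min_le_left _ _)
  have hRR2 : R ≤ R2 := by rw [hR]; exact (min_le_left _ _).trans (min_le_right _ _)
  have hRR3 : R ≤ R3 := by rw [hR]; exact min_le_right _ _
  have hR1' : R ≤ 1 := hRR3.trans (by rw [hR3]; exact min_le_right _ _)
  have hRσ : R ≤ σ / 3 :=
    hRR3.trans (by rw [hR3]; exact (min_le_left _ _).trans (min_le_left _ _))
  have hRε : R ≤ ε / (6 * (L + 1)) :=
    hRR3.trans (by rw [hR3]; exact (min_le_left _ _).trans (min_le_right _ _))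
  have hbox : Metric.closedBall x0 R ×ˢ Icc (t0 - R) (t0 + R) ⊆ U := by
    refine Subset.trans ?_ hR1U
    rw [← closedBall_prod_same, Real.closedBall_eq_Icc]
    exact Set.prod_mono (Metric.closedBall_subset_closedBall hRR1)
      (Icc_subset_Icc (by linarith) (by linarith))
  have hKc : IsCompact ((Metric.closedBall x0 R ×ˢ Icc (t0 - R) (t0 + R)) \ G) :=
    ((isCompact_closedBall x0 R).prod isCompact_Icc).diff hG
  refine ⟨R, hR0, hR1', Prod.fst '' ((Metric.closedBall x0 R ×ˢ Icc (t0 - R) (t0 + R)) \ G),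
    hKc.image continuous_fst, ?_, hbox, ?_, ?_, ?_⟩
  · rintro _ ⟨q, hq, rfl⟩
    exact hq.1.1
  · rintro _ ⟨⟨x, t⟩, ⟨⟨hx, ht⟩, hG'⟩, rfl⟩ s hs
    simp only at hx ht hs ⊢
    have h1 := hR2u (Metric.closedBall_subset_closedBall hRR2 hx)
    have hst : |s - t| ≤ 2 * R := by
      rw [abs_le]; constructor <;> linarith [hs.1, hs.2, ht.1, ht.2]
    have htt : |t0 - t| ≤ R := by
      rw [abs_le]; constructor <;> linarith [ht.1, ht.2]
    have h2 := hlip (x, t) ⟨hbox ⟨hx, ht⟩, hG'⟩ s t0 (by simp only; linarith)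
      (by simp only; linarith)
    simp only at h2
    have h3 : L * (|s - t| + |t0 - t|) ≤ (L + 1) * (3 * R) :=
      mul_le_mul (by linarith) (by linarith) (by positivity) (by linarith)
    have h4 : (L + 1) * (3 * R) ≤ ε / 2 := by
      rw [le_div_iff₀ (by positivity)] at hRε
      linarith
    have h5 := abs_sub_le (u (x, s)) (u (x, t0)) (u (x0, t0))
    have h6 : |u (x, t0) - u (x0, t0)| < ε / 2 := h1
    linarith
  · rintro x ⟨hx, hxX⟩ s hs
    by_contra h
    exact hxX ⟨(x, s), ⟨⟨hx, hs⟩, h⟩, rfl⟩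
  · intro h
    exact ⟨(x0, t0), ⟨⟨Metric.mem_closedBall_self hR0.le, by simp only; constructor <;> linarith⟩, h⟩,
      rfl⟩

set_option maxHeartbeats 1000000 in
lemma eventually_continuousAt_of_lipschitz_lines (hlam : 0 < lam) (hA : IsElliptic lam Lam A)
    {u : Spc m × ℝ → ℝ} {U G : Set (Spc m × ℝ)} (hu : SolvesL A u U) (h0 : ∀ p ∈ U, 0 ≤ u p)
    (hU : IsOpen U) (hG : IsOpen G) (hGc : ∀ p ∈ G, ContinuousAt u p) {σ L : ℝ} (hσ : 0 < σ)
    (hL : 0 ≤ L) (hlip : ∀ p ∈ U \ G, ∀ s s', |s - p.2| < σ → |s' - p.2| < σ →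
      |u (p.1, s) - u (p.1, s')| ≤ L * (|s - p.2| + |s' - p.2|))
    {P : Spc m × ℝ} (hP : P ∈ U) : ∀ᶠ p in 𝓝 P, ContinuousAt u p := by
  by_cases hPG : P ∈ G
  · filter_upwards [hG.mem_nhds hPG] with p hp using hGc p hp
  have hrlsc : ∀ p ∈ U, RLSC u p := by
    rintro ⟨x, t⟩ hp
    refine rlsc_of_lines hlam hA hu h0 fun ε hε => ?_
    obtain ⟨R, hR, -, X, hX, -, hbox, hXu, hXG, -⟩ := exists_lines hu hU hG hσ hL hlip hp hε
    refine ⟨R, hR, X, hX.isClosed, hbox, fun x hx s hs => ?_, fun x hx s hs =>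
      hGc _ (hXG x hx s hs)⟩
    linarith [(abs_le.1 (hXu x hx.1 s hs)).1]
  have hpos : PosSol A u U := ⟨hu, h0, hrlsc⟩
  obtain ⟨x0, t0⟩ := P
  obtain ⟨C, hC, hH⟩ := exists_harnack m hlam hA.lam_le
  obtain ⟨R, hR, hR1, X, hX, hXR, hbox, hXu, hXG, hx0X⟩ :=
    exists_lines hu hU hG hσ hL hlip hP one_pos
  have hx0X := hx0X hPG
  obtain ⟨V, hV⟩ : ∃ V : Set (Spc m × ℝ), V = Metric.ball x0 (R / 10) ×ˢ
    Ioo (t0 - R / 10) (t0 + R / 10) := ⟨_, rfl⟩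
  have hVo : IsOpen V := by rw [hV]; exact Metric.isOpen_ball.prod isOpen_Ioo
  have hVU : V ⊆ U := by
    rw [hV]
    refine Subset.trans (Set.prod_mono ?_ ?_) hbox
    · exact (Metric.ball_subset_ball (by linarith)).trans Metric.ball_subset_closedBall
    · exact fun s hs => ⟨by linarith [hs.1], by linarith [hs.2]⟩
  have hc0 : 0 ≤ u (x0, t0) := h0 _ hP
  have hXle : ∀ x ∈ X, ∀ s ∈ Icc (t0 - R) (t0 + R), u (x, s) ≤ u (x0, t0) + 1 :=
    fun x hx s hs => by linarith [(abs_le.1 (hXu x hx s hs)).2]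
  obtain ⟨b, hb⟩ : ∃ b : ℝ, b = (C + 1) * (u (x0, t0) + 1) := ⟨_, rfl⟩
  have hVb : ∀ p ∈ V, u p ≤ b := by
    rw [hV]
    rintro ⟨y, s⟩ ⟨hy, hs⟩
    simp only at hy hs
    have hy' : dist y x0 < R / 10 := hy
    have hCu : 0 ≤ C * (u (x0, t0) + 1) := by positivity
    have hyR : y ∈ Metric.closedBall x0 R := by rw [Metric.mem_closedBall]; linarith
    by_cases hyX : y ∈ X
    · have := hXle y hyX s ⟨by linarith [hs.1], by linarith [hs.2]⟩
      linarith
    obtain ⟨x', hx'X, hx'd⟩ := hX.exists_infDist_eq_dist ⟨x0, hx0X⟩ y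
    have hd0 : 0 < Metric.infDist y X := (hX.isClosed.notMem_iff_infDist_pos ⟨x0, hx0X⟩).1 hyX
    have hdle : Metric.infDist y X ≤ dist y x0 := Metric.infDist_le_dist_of_mem hx0X
    have hdX : ∀ z ∈ X, Metric.infDist y X ≤ dist y z := fun z hz =>
      Metric.infDist_le_dist_of_mem hz
    obtain ⟨r, hr⟩ : ∃ r : ℝ, r = Metric.infDist y X / 2 := ⟨_, rfl⟩
    have hr0 : 0 < r := by rw [hr]; linarith
    have hrR : r < R / 20 := by rw [hr]; linarith
    have hr2 : r ^ 2 ≤ r / 20 := by nlinarith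
    have hr20 : 0 ≤ r ^ 2 := sq_nonneg r
    have := hH A hA u U G hpos hG (fun p hp => (hGc p hp).continuousWithinAt) y s r hr0
      ((closedBall_prod_subset (by linarith) (by linarith [hs.1]) (by linarith [hs.2])).trans hbox)
      (by
        rintro ⟨z, τ⟩ ⟨hz, hτ⟩
        simp only at hz hτ
        have hz' : dist z y ≤ r := hz
        refine hXG z ⟨?_, fun hzX => ?_⟩ τ ⟨by linarith [hτ.1, hs.1], by linarith [hτ.2, hs.2]⟩
        · rw [Metric.mem_closedBall]
          linarith [dist_triangle z y x0]
        · have := hdX z hzX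
          rw [dist_comm] at this
          linarith) x' (by
        rw [Metric.mem_closedBall, dist_comm, ← hx'd]; linarith)
    have h2 := hXle x' hx'X (s + 4 * r ^ 2) ⟨by linarith [hs.1], by linarith [hs.2]⟩
    have h3 := mul_le_mul_of_nonneg_left h2 hC.le
    linarith
  have hsolve : SolvesL A (fun q => b - u q) V := (hu.mono hVU).const_sub b
  have hrusc : ∀ p ∈ V, RLSC (fun q => -u q) p := by
    rintro ⟨x, t⟩ hp
    have h1 : RLSC (fun q => b - u q) (x, t) := by
      refine rlsc_of_lines hlam hA hsolve (fun p hp => by linarith [hVb p hp]) fun ε hε => ?_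
      obtain ⟨R, hR, -, X, hX, -, hbox, hXu, hXG, -⟩ := exists_lines (hu.mono hVU) hVo hG hσ hL
        (fun p hp => hlip p ⟨hVU hp.1, hp.2⟩) hp hε
      refine ⟨R, hR, X, hX.isClosed, hbox, fun x hx s hs => ?_, fun x hx s hs =>
        continuousAt_const.sub (hGc _ (hXG x hx s hs))⟩
      linarith [(abs_le.1 (hXu x hx.1 s hs)).2]
    have h2 := h1.sub_continuous (φ := fun _ => b) continuousAt_const
    have e : (fun q => b - u q - b) = fun q => -u q := by funext q; ring
    rwa [e] at h2
  have hPV : (x0, t0) ∈ V := by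
    rw [hV]
    exact ⟨Metric.mem_ball_self (by linarith), by simp only; constructor <;> linarith⟩
  filter_upwards [hVo.mem_nhds hPV] with p hp
  exact continuousAt_of_rlsc hlam hA hVo (hu.mono hVU) (fun p hp => hrlsc p (hVU hp)) hrusc
    (fun p hp => ⟨h0 p (hVU hp), hVb p hp⟩) hp

end continuity

section continuity
variable {m : ℕ} {lam Lam : ℝ} {A : Spc m → Matrix (Fin (m + 1)) (Fin (m + 1)) ℝ}

lemma isClosed_lipschitz_lines {u : Spc m × ℝ → ℝ} {Y : Set (Spc m × ℝ)} {J : Set ℝ} {a L : ℝ}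
    (hc : ∀ p ∈ Y, ∀ s ∈ J, ContinuousAt (fun y => u (y, s)) p.1) :
    IsClosed {y : Y | ∀ s ∈ J, ∀ s' ∈ J, |s - y.1.2| < a → |s' - y.1.2| < a →
      |u (y.1.1, s) - u (y.1.1, s')| ≤ L * (|s - y.1.2| + |s' - y.1.2|)} := by
  have hcs : ∀ s ∈ J, Continuous fun y : Y => u (y.1.1, s) := fun s hs =>
    continuous_iff_continuousAt.2 fun y => ContinuousAt.comp (f := fun y : Y => y.1.1)
      (g := fun x => u (x, s)) (hc y.1 y.2 s hs) (by fun_prop)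
  have e : {y : Y | ∀ s ∈ J, ∀ s' ∈ J, |s - y.1.2| < a → |s' - y.1.2| < a →
      |u (y.1.1, s) - u (y.1.1, s')| ≤ L * (|s - y.1.2| + |s' - y.1.2|)} =
      ⋂ s ∈ J, ⋂ s' ∈ J, ({y : Y | a ≤ |s - y.1.2|} ∪ ({y : Y | a ≤ |s' - y.1.2|} ∪
        {y : Y | |u (y.1.1, s) - u (y.1.1, s')| ≤ L * (|s - y.1.2| + |s' - y.1.2|)})) := by
    ext y
    simp only [mem_iInter, mem_union, mem_ofPred_eq, ← not_lt (b := a)]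
    refine forall₄_congr fun s hs s' hs' => ?_
    tauto
  rw [e]
  refine isClosed_biInter fun s hs => isClosed_biInter fun s' hs' => ?_
  refine (isClosed_le (by fun_prop) (by fun_prop)).union ((isClosed_le (by fun_prop)
    (by fun_prop)).union (isClosed_le ?_ (by fun_prop)))
  exact ((hcs s hs).sub (hcs s' hs')).abs

lemma exists_lipschitz_at {f : ℝ → ℝ} {d t : ℝ} (h : HasDerivAt f d t) :
    ∃ a > 0, ∃ L : ℝ, ∀ s s', |s - t| < a → |s' - t| < a →
      |f s - f s'| ≤ L * (|s - t| + |s' - t|) := by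
  have h1 := h.isBigO_sub
  rw [Asymptotics.isBigO_iff] at h1
  obtain ⟨L, hL⟩ := h1
  obtain ⟨a, ha, hball⟩ := Metric.eventually_nhds_iff.1 hL
  refine ⟨a, ha, L, fun s s' hs hs' => ?_⟩
  have h2 := hball (y := s) (by rwa [Real.dist_eq])
  have h3 := hball (y := s') (by rwa [Real.dist_eq])
  simp only [Real.norm_eq_abs] at h2 h3
  have h4 := abs_sub_le (f s) (f t) (f s')
  rw [abs_sub_comm (f t)] at h4
  linarith

/-- Nonnegative solutions, which are only assumed to be regular in each variable separately, are
continuous. -/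
theorem SolvesL.continuousAt (hlam : 0 < lam) (hA : IsElliptic lam Lam A)
    {u : Spc m × ℝ → ℝ} {Ω : Set (Spc m × ℝ)} (hΩ : IsOpen Ω) (hu : SolvesL A u Ω)
    (h0 : ∀ p ∈ Ω, 0 ≤ u p) {p : Spc m × ℝ} (hp : p ∈ Ω) : ContinuousAt u p := by
  obtain ⟨G, hG⟩ : ∃ G : Set (Spc m × ℝ), G = {q | ∀ᶠ q' in 𝓝 q, ContinuousAt u q'} := ⟨_, rfl⟩
  have hGo : IsOpen G := by rw [hG]; exact isOpen_setOfPred_eventually_nhds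
  have hGc : ∀ q ∈ G, ContinuousAt u q := by
    rw [hG]; intro q hq; exact Eventually.self_of_nhds hq
  by_contra hcon
  have hpG : p ∉ G := fun h => hcon (hGc p h)
  obtain ⟨ρ, hρ, hρΩ⟩ := Metric.nhds_basis_closedBall.mem_iff.1 (hΩ.mem_nhds hp)
  obtain ⟨S, hS⟩ : ∃ S : Set (Spc m × ℝ), S = Metric.ball p (ρ / 2) \ G := ⟨_, rfl⟩
  have hpS : p ∈ S := by rw [hS]; exact ⟨Metric.mem_ball_self (by linarith), hpG⟩
  obtain ⟨Y, hY⟩ : ∃ Y : Set (Spc m × ℝ), Y = closure S := ⟨_, rfl⟩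
  have hYc : IsClosed Y := by rw [hY]; exact isClosed_closure
  have hSY : S ⊆ Y := by rw [hY]; exact subset_closure
  have hYb : Y ⊆ Metric.closedBall p (ρ / 2) := by
    rw [hY]
    refine closure_minimal ?_ Metric.isClosed_closedBall
    rw [hS]
    exact sdiff_subset.trans Metric.ball_subset_closedBall
  have hbox : ∀ q ∈ Y, ∀ s ∈ Icc (p.2 - ρ) (p.2 + ρ), (q.1, s) ∈ Ω := by
    intro q hq s hs
    apply hρΩ
    rw [Metric.mem_closedBall, Prod.dist_eq]
    have h1 : dist q p ≤ ρ / 2 := hYb hq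
    rw [Prod.dist_eq] at h1
    refine max_le ?_ ?_
    · exact ((le_max_left _ _).trans h1).trans (by linarith)
    · rw [Real.dist_eq, abs_le]; constructor <;> linarith [hs.1, hs.2]
  have hY2 : ∀ q ∈ Y, |q.2 - p.2| ≤ ρ / 2 := by
    intro q hq
    have h1 : dist q p ≤ ρ / 2 := hYb hq
    rw [Prod.dist_eq] at h1
    exact (le_max_right _ _).trans h1
  have : CompleteSpace Y := hYc.completeSpace_coe
  have : Nonempty Y := ⟨⟨p, hSY hpS⟩⟩
  obtain ⟨k, hk⟩ := nonempty_interior_of_iUnion_of_closed (X := Y)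
    (f := fun k : ℕ => {y : Y | ∀ s ∈ Icc (p.2 - ρ) (p.2 + ρ), ∀ s' ∈ Icc (p.2 - ρ) (p.2 + ρ),
      |s - y.1.2| < ρ / (2 * (k + 1)) → |s' - y.1.2| < ρ / (2 * (k + 1)) →
      |u (y.1.1, s) - u (y.1.1, s')| ≤ k * (|s - y.1.2| + |s' - y.1.2|)})
    (fun k => isClosed_lipschitz_lines fun q hq s hs => (hu _ (hbox q hq s hs)).1.continuousAt) (by
      refine eq_univ_of_forall fun y => mem_iUnion.2 ?_
      have hy2 := abs_le.1 (hY2 y.1 y.2)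
      obtain ⟨a, ha, L, hL⟩ := exists_lipschitz_at (hasDerivAt_trF hu (x := y.1.1) (t := y.1.2)
        (hbox y.1 y.2 y.1.2 ⟨by linarith, by linarith⟩))
      obtain ⟨k, hk⟩ := exists_nat_gt (max L (ρ / (2 * a)))
      have hk1 := (le_max_left _ _).trans_lt hk
      have hk2 := (le_max_right _ _).trans_lt hk
      have hka : ρ / (2 * (k + 1)) ≤ a := by
        rw [div_lt_iff₀ (by positivity)] at hk2
        rw [div_le_iff₀ (by positivity)]
        nlinarith
      refine ⟨k, fun s _ s' _ hs hs' => ?_⟩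
      refine (hL s s' (hs.trans_le hka) (hs'.trans_le hka)).trans ?_
      exact mul_le_mul_of_nonneg_right hk1.le (by positivity))
  obtain ⟨V, hV, hVe⟩ := isOpen_induced_iff.1 (isOpen_interior (X := Y) (s :=
    {y : Y | ∀ s ∈ Icc (p.2 - ρ) (p.2 + ρ), ∀ s' ∈ Icc (p.2 - ρ) (p.2 + ρ),
      |s - y.1.2| < ρ / (2 * (k + 1)) → |s' - y.1.2| < ρ / (2 * (k + 1)) →
      |u (y.1.1, s) - u (y.1.1, s')| ≤ k * (|s - y.1.2| + |s' - y.1.2|)}))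
  obtain ⟨y, hy⟩ := hk
  have hyV : y.1 ∈ V := by
    have : y ∈ (Subtype.val ⁻¹' V : Set Y) := by rw [hVe]; exact hy
    exact this
  have hyS : y.1 ∈ closure S := by rw [← hY]; exact y.2
  obtain ⟨q, hqV, hqS⟩ := mem_closure_iff.1 hyS V hV hyV
  have hqS' : q ∈ Metric.ball p (ρ / 2) \ G := by rw [← hS]; exact hqS
  have hUΩ : V ∩ Metric.ball p (ρ / 2) ⊆ Ω := fun z hz => hρΩ
    (Metric.closedBall_subset_closedBall (by linarith) (Metric.ball_subset_closedBall hz.2))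
  have hak : ρ / (2 * ((k : ℝ) + 1)) ≤ ρ / 2 := by
    refine div_le_div_of_nonneg_left hρ.le (by norm_num) ?_
    have : (0 : ℝ) ≤ k := Nat.cast_nonneg k
    linarith
  have := eventually_continuousAt_of_lipschitz_lines hlam hA (hu.mono hUΩ)
    (fun z hz => h0 z (hUΩ hz)) (hV.inter Metric.isOpen_ball) hGo hGc
    (σ := ρ / (2 * ((k : ℝ) + 1))) (L := k) (by positivity) (by positivity) (by
      rintro z ⟨⟨hzV, hzb⟩, hzG⟩ s s' hs hs'
      have hzY : z ∈ Y := hSY (by rw [hS]; exact ⟨hzb, hzG⟩)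
      have hzF : (⟨z, hzY⟩ : Y) ∈ (Subtype.val ⁻¹' V : Set Y) := hzV
      rw [hVe] at hzF
      have h2 := abs_le.1 (hY2 z hzY)
      have h3 := abs_lt.1 hs
      have h4 := abs_lt.1 hs'
      exact interior_subset hzF s ⟨by linarith, by linarith⟩ s' ⟨by linarith, by linarith⟩ hs hs')
    (P := q) ⟨hqV, hqS'.1⟩
  exact hqS'.2 (by rw [hG]; exact this)

end continuity

section geometry
variable {m : ℕ}

@[simp] lemma xprime_mkPt (x' : Spc' m) (a : ℝ) : xprime (mkPt x' a) = x' := by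
  ext i
  simp [xprime, mkPt]

@[simp] lemma xlast_mkPt (x' : Spc' m) (a : ℝ) : xlast (mkPt x' a) = a := by
  simp [xlast, mkPt]

lemma mkPt_xprime_xlast (x : Spc m) : mkPt (xprime x) (xlast x) = x := by
  ext i
  refine Fin.lastCases ?_ (fun i => ?_) i <;> simp [xprime, xlast, mkPt]

lemma normSq_eq (x : Spc m) : ‖x‖ ^ 2 = ‖xprime x‖ ^ 2 + xlast x ^ 2 := by
  rw [EuclideanSpace.norm_sq_eq, EuclideanSpace.norm_sq_eq, Fin.sum_univ_castSucc]
  simp [xprime, xlast]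

lemma xprime_sub (x y : Spc m) : xprime (x - y) = xprime x - xprime y := by
  ext i
  simp [xprime]

lemma xlast_sub (x y : Spc m) : xlast (x - y) = xlast x - xlast y := by
  simp [xlast]

lemma norm_xprime_sub_le (x y : Spc m) : ‖xprime x - xprime y‖ ≤ ‖x - y‖ := by
  rw [← xprime_sub]
  refine le_of_sq_le_sq ?_ (norm_nonneg _)
  nlinarith [normSq_eq (x - y), sq_nonneg (xlast (x - y))]

lemma abs_xlast_sub_le (x y : Spc m) : |xlast x - xlast y| ≤ ‖x - y‖ := by
  rw [← xlast_sub]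
  refine abs_le_of_sq_le_sq ?_ (norm_nonneg _)
  nlinarith [normSq_eq (x - y), sq_nonneg ‖xprime (x - y)‖]

lemma norm_mkPt_sub_le (x' y' : Spc' m) (a b : ℝ) :
    ‖mkPt x' a - mkPt y' b‖ ≤ ‖x' - y'‖ + |a - b| := by
  refine le_of_sq_le_sq ?_ (by positivity)
  rw [normSq_eq, xprime_sub, xlast_sub]
  simp only [xprime_mkPt, xlast_mkPt]
  nlinarith [sq_abs (a - b), mul_nonneg (norm_nonneg (x' - y')) (abs_nonneg (a - b))]

lemma continuous_xprime : Continuous (xprime (m := m)) := by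
  refine LipschitzWith.continuous (K := 1) (LipschitzWith.of_dist_le_mul fun x y => ?_)
  rw [dist_eq_norm, dist_eq_norm, NNReal.coe_one, one_mul]
  exact norm_xprime_sub_le x y

lemma continuous_xlast : Continuous (xlast (m := m)) := by
  refine LipschitzWith.continuous (K := 1) (LipschitzWith.of_dist_le_mul fun x y => ?_)
  rw [Real.dist_eq, dist_eq_norm, NNReal.coe_one, one_mul]
  exact abs_xlast_sub_le x y

/-- The height of a point above the graph of `g`. -/
def hgt (g : Spc' m → ℝ → ℝ) (p : Spc m × ℝ) : ℝ := xlast p.1 - g (xprime p.1) p.2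

/-- The point with horizontal coordinate `x'`, time `t` and height `h` above the graph of `g`. -/
def lift (g : Spc' m → ℝ → ℝ) (x' : Spc' m) (t h : ℝ) : Spc m × ℝ := (mkPt x' (g x' t + h), t)

@[simp] lemma lift_snd (g : Spc' m → ℝ → ℝ) (x' : Spc' m) (t h : ℝ) : (lift g x' t h).2 = t := rfl

@[simp] lemma xprime_lift (g : Spc' m → ℝ → ℝ) (x' : Spc' m) (t h : ℝ) :
    xprime (lift g x' t h).1 = x' := by simp [lift]

@[simp] lemma hgt_lift (g : Spc' m → ℝ → ℝ) (x' : Spc' m) (t h : ℝ) : hgt g (lift g x' t h) = h := by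
  simp [lift, hgt]

lemma lift_hgt (g : Spc' m → ℝ → ℝ) (p : Spc m × ℝ) :
    lift g (xprime p.1) p.2 (hgt g p) = p := by
  have e : g (xprime p.1) p.2 + (xlast p.1 - g (xprime p.1) p.2) = xlast p.1 := by ring
  rw [lift, hgt, e, mkPt_xprime_xlast]

lemma mem_Cyl {g : Spc' m → ℝ → ℝ} {p : Spc m × ℝ} {r : ℝ} :
    p ∈ Cyl g r ↔ ‖xprime p.1‖ < r ∧ |p.2| < r ^ 2 ∧ 0 < hgt g p ∧ hgt g p < r := by
  rw [abs_lt]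
  constructor
  · rintro ⟨h1, h2, h3, h4, h5⟩
    exact ⟨h1, ⟨h2, h3⟩, by rw [hgt]; linarith, by rw [hgt]; linarith⟩
  · rintro ⟨h1, ⟨h2, h3⟩, h4, h5⟩
    rw [hgt] at h4 h5
    exact ⟨h1, h2, h3, by linarith, by linarith⟩

variable {g : Spc' m → ℝ → ℝ} {K : ℝ}

lemma continuous_hgt (hgc : Continuous fun q : Spc' m × ℝ => g q.1 q.2) : Continuous (hgt g) := by
  refine (continuous_xlast.comp continuous_fst).sub ?_
  exact hgc.comp ((continuous_xprime.comp continuous_fst).prodMk continuous_snd)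

lemma isOpen_Cyl (hgc : Continuous fun q : Spc' m × ℝ => g q.1 q.2) (r : ℝ) : IsOpen (Cyl g r) := by
  have e : Cyl g r = {p | ‖xprime p.1‖ < r} ∩ ({p | |p.2| < r ^ 2} ∩
      ({p | 0 < hgt g p} ∩ {p | hgt g p < r})) := by
    ext p
    exact mem_Cyl
  rw [e]
  have h1 := continuous_hgt hgc
  have h2 := continuous_xprime (m := m)
  exact (isOpen_lt (h2.comp continuous_fst).norm continuous_const).inter
    ((isOpen_lt (by fun_prop) continuous_const).inter
      ((isOpen_lt continuous_const h1).inter (isOpen_lt h1 continuous_const)))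

lemma HolderSemi.abs_sub_le (hg : HolderSemi 1 (1 / 2) K g) (x' y' : Spc' m) (t s : ℝ) :
    |g x' t - g y' s| ≤ K * (‖x' - y'‖ + √|t - s|) := by
  have := hg x' y' t s
  rwa [Real.rpow_one, ← Real.sqrt_eq_rpow] at this

lemma HolderSemi.abs_hgt_sub_le (hg : HolderSemi 1 (1 / 2) K g) (hK : 0 ≤ K) (p q : Spc m × ℝ) :
    |hgt g p - hgt g q| ≤ (1 + K) * (‖p.1 - q.1‖ + √|p.2 - q.2|) := by
  have h1 := hg.abs_sub_le (xprime q.1) (xprime p.1) q.2 p.2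
  have h2 := norm_xprime_sub_le q.1 p.1
  have h3 := abs_xlast_sub_le p.1 q.1
  rw [norm_sub_rev q.1, abs_sub_comm q.2] at *
  have h4 : hgt g p - hgt g q =
      (xlast p.1 - xlast q.1) + (g (xprime q.1) q.2 - g (xprime p.1) p.2) := by
    rw [hgt, hgt]; ring
  rw [h4]
  have h5 := abs_add_le (xlast p.1 - xlast q.1) (g (xprime q.1) q.2 - g (xprime p.1) p.2)
  have h6 := mul_le_mul_of_nonneg_left h2 hK
  have h7 := Real.sqrt_nonneg |p.2 - q.2|
  linarith

/-- A bound for the height in terms of explicit bounds for the displacements. -/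
lemma HolderSemi.abs_hgt_sub_le_of (hg : HolderSemi 1 (1 / 2) K g) (hK : 0 ≤ K)
    {p q : Spc m × ℝ} {a b : ℝ} (ha : ‖p.1 - q.1‖ ≤ a) (hb : 0 ≤ b) (hb2 : |p.2 - q.2| ≤ b ^ 2) :
    |hgt g p - hgt g q| ≤ (1 + K) * (a + b) := by
  refine (hg.abs_hgt_sub_le hK p q).trans (mul_le_mul_of_nonneg_left ?_ (by linarith))
  exact add_le_add ha (Real.sqrt_le_iff.2 ⟨hb, hb2⟩)

lemma HolderSemi.norm_lift_sub_le (hg : HolderSemi 1 (1 / 2) K g) (hK : 0 ≤ K)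
    (x' y' : Spc' m) {t s b : ℝ} (h k : ℝ) (hb : 0 ≤ b) (hb2 : |t - s| ≤ b ^ 2) :
    ‖(lift g x' t h).1 - (lift g y' s k).1‖ ≤ (1 + K) * ‖x' - y'‖ + |h - k| + K * b := by
  have h1 := norm_mkPt_sub_le x' y' (g x' t + h) (g y' s + k)
  have h2 := hg.abs_sub_le x' y' t s
  have h3 : √|t - s| ≤ b := Real.sqrt_le_iff.2 ⟨hb, hb2⟩
  have h4 := mul_le_mul_of_nonneg_left h3 hK
  have h5 : |g x' t + h - (g y' s + k)| ≤ |g x' t - g y' s| + |h - k| := by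
    have e : g x' t + h - (g y' s + k) = (g x' t - g y' s) + (h - k) := by ring
    rw [e]; exact abs_add_le _ _
  simp only [lift]
  linarith

/-- Closed boxes around a point of sufficiently large height are contained in the unit cylinder. -/
lemma HolderSemi.box_subset_Cyl (hg : HolderSemi 1 (1 / 2) K g) (hK : 0 ≤ K)
    {x : Spc m} {t ρ b : ℝ} (hb : 0 ≤ b) (h1 : ‖xprime x‖ + ρ < 1) (h2 : |t| + b ^ 2 < 1)
    (h3 : (1 + K) * (ρ + b) < hgt g (x, t)) (h4 : hgt g (x, t) + (1 + K) * (ρ + b) < 1) :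
    Metric.closedBall x ρ ×ˢ Icc (t - b ^ 2) (t + b ^ 2) ⊆ Cyl g 1 := by
  rintro ⟨y, s⟩ ⟨hy, hs⟩
  simp only at hy hs
  have hy' : ‖y - x‖ ≤ ρ := by rw [← dist_eq_norm]; exact hy
  have hs' : |s - t| ≤ b ^ 2 := by rw [abs_le]; constructor <;> linarith [hs.1, hs.2]
  have h5 := abs_le.1 (hg.abs_hgt_sub_le_of hK (p := (y, s)) (q := (x, t)) hy' hb hs')
  have h6 := norm_xprime_sub_le y x
  have h7 := norm_sub_norm_le (xprime y) (xprime x)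
  have h8 := abs_sub_abs_le_abs_sub s t
  rw [mem_Cyl]
  simp only
  exact ⟨by linarith, by linarith, by linarith, by linarith⟩

end geometry

section boundaryDecay
variable {m : ℕ} {A : Spc m → Matrix (Fin (m + 1)) (Fin (m + 1)) ℝ} {lam Lam : ℝ}

lemma bar_le_inv {M r : ℝ} (γ : ℕ) (hr : 0 < r) (x0 : Spc m) (t0 : ℝ) (q : Spc m × ℝ) :
    bar M (γ + 2) r x0 t0 q * (r ^ 2) ^ γ ≤ 1 := by
  unfold bar
  obtain ⟨W, hW⟩ : ∃ W : ℝ, W = max (r ^ 2 + M * (q.2 - t0)) (r ^ 2) := ⟨_, rfl⟩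
  rw [← hW]
  have h1 : r ^ 2 ≤ W := hW ▸ le_max_right _ _
  have h2 : r ^ 2 + M * (q.2 - t0) ≤ W := hW ▸ le_max_left _ _
  have h0 : 0 < W := lt_of_lt_of_le (by positivity) h1
  have h3 : max (r ^ 2 + M * (q.2 - t0) - ‖q.1 - x0‖ ^ 2) 0 ≤ W :=
    max_le (by linarith [sq_nonneg ‖q.1 - x0‖]) h0.le
  rw [div_mul_eq_mul_div, div_le_one (by positivity), pow_add, mul_comm (W ^ γ)]
  have h4 := pow_le_pow_left₀ (le_max_right _ _) h3 2
  have h5 := pow_le_pow_left₀ (by positivity) h1 γ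
  exact mul_le_mul h4 h5 (by positivity) (by positivity)

/-- Decay of the negative part of a solution across an exterior ball. -/
lemma neg_le_of_exterior_ball (hA : IsElliptic lam Lam A) (hlam : 0 < lam) {M s : ℝ} (hM : 0 < M)
    {γ : ℕ} (hγ : (2 * M + 8 * lam + 4 * ((m + 1) * Lam)) ^ 2 ≤ ((γ + 2 : ℕ) : ℝ) * M * (32 * lam))
    (hs : 0 < s) {D : Set (Spc m × ℝ)} (hD : IsOpen D) {w : Spc m × ℝ → ℝ} (hw : SolvesL A w D)
    (hwc : ContinuousOn w D) {y0 : Spc m} {ρ t1 t0 k : ℝ} (hρ : 0 < ρ) (hk : 0 ≤ k)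
    (hlow : ∀ x ∈ Metric.closedBall y0 ρ, ∀ t ∈ Icc t1 t0, (x, t) ∈ D → -k ≤ w (x, t))
    (hbd : ∀ x ∈ Metric.closedBall y0 ρ, ∀ t ∈ Icc t1 t0, (x, t) ∉ D →
      ∀ ε > 0, ∀ᶠ q in 𝓝[D] (x, t), -ε < w q)
    (hext : ∀ x, ‖x - y0‖ < s → (x, t1) ∉ D) (hρM : s ^ 2 + M * (t0 - t1) < ρ ^ 2)
    {x : Spc m} {t : ℝ} (hx : x ∈ Metric.closedBall y0 ρ) (ht : t ∈ Icc t1 t0) (hxt : (x, t) ∈ D) :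
    -(1 - bar M (γ + 2) s y0 t1 (x, t) * (s ^ 2) ^ γ) * k ≤ w (x, t) := by
  obtain ⟨φ, hφ⟩ : ∃ φ : Spc m × ℝ → ℝ, φ = fun q => bar M (γ + 2) s y0 t1 q * (s ^ 2) ^ γ :=
    ⟨_, rfl⟩
  have hφ1 : ∀ q, φ q ≤ 1 := fun q => by rw [hφ]; exact bar_le_inv γ hs y0 t1 q
  have hφc : Continuous φ := by
    rw [hφ]; exact (bar_continuous (γ + 2) hs y0 t1).mul continuous_const
  obtain ⟨z, hz⟩ : ∃ z : Spc m × ℝ → ℝ,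
      z = fun q => if q ∈ D then w q + k - k * φ q else 0 := ⟨_, rfl⟩
  have hzD : ∀ q ∈ D, z q = w q + k - k * φ q := fun q hq => by rw [hz]; exact if_pos hq
  have hzN : ∀ q ∉ D, z q = 0 := fun q hq => by rw [hz]; exact if_neg hq
  have key := min_principle (K := Metric.closedBall y0 ρ) (isCompact_closedBall _ _)
    (a := t1) (b := t0) (z := z) ?_ ?_ ?_ t ht x hx
  · rw [hzD _ hxt, hφ] at key
    linarith
  · intro t ht x hx c hc
    refine Filter.Eventually.filter_mono nhdsWithin_le_nhds ?_
    by_cases hp : (x, t) ∈ D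
    · have hwa : ContinuousAt w (x, t) := hwc.continuousAt (hD.mem_nhds hp)
      have h1 : ContinuousAt (fun q => w q + k - k * φ q) (x, t) :=
        (hwa.add continuousAt_const).sub (continuousAt_const.mul hφc.continuousAt)
      rw [hzD _ hp] at hc
      filter_upwards [h1.eventually_const_lt hc, hD.mem_nhds hp] with q h2 h3
      rw [hzD _ h3]
      exact h2
    · rw [hzN _ hp] at hc
      have h2 := hbd x hx t ht hp (-c) (by linarith)
      rw [eventually_nhdsWithin_iff] at h2
      filter_upwards [h2] with q h3
      by_cases hq : q ∈ D
      · rw [hzD _ hq]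
        have := h3 hq
        nlinarith [hφ1 q]
      · rw [hzN _ hq]
        exact hc
  · intro x hx
    by_cases hp : (x, t1) ∈ D
    · rw [hzD _ hp]
      have h1 := hlow x hx t1 ⟨le_rfl, ht.1.trans ht.2⟩ hp
      have h2 : φ (x, t1) ≤ 0 := by
        by_contra hc
        push Not at hc
        have h3 : 0 < bar M (γ + 2) s y0 t1 (x, t1) := by
          by_contra h4
          have h5 := bar_nonneg (M := M) (γ + 2) hs y0 t1 (x, t1)
          have h6 : bar M (γ + 2) s y0 t1 (x, t1) = 0 := le_antisymm (not_lt.1 h4) h5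
          rw [hφ] at hc
          simp only [h6, zero_mul, lt_self_iff_false] at hc
        rw [bar_pos_iff _ hs] at h3
        simp only [sub_self, mul_zero, add_zero] at h3
        exact hext x (lt_of_pow_lt_pow_left₀ 2 hs.le h3) hp
      nlinarith
    · rw [hzN _ hp]
  · intro t ht x hx hneg hmin
    have hp : (x, t) ∈ D := by
      by_contra hc
      rw [hzN _ hc] at hneg
      exact lt_irrefl _ hneg
    have h1 := hlow x hx t ⟨ht.1.le, ht.2⟩ hp
    rw [hzD _ hp] at hneg
    have h2 : 0 < bar M (γ + 2) s y0 t1 (x, t) := by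
      by_contra h4
      have h5 := bar_nonneg (M := M) (γ + 2) hs y0 t1 (x, t)
      have h6 : bar M (γ + 2) s y0 t1 (x, t) = 0 := le_antisymm (not_lt.1 h4) h5
      have h7 : φ (x, t) = 0 := by rw [hφ]; simp only [h6, zero_mul]
      rw [h7] at hneg
      linarith
    obtain ⟨hC, d, hd, hle⟩ := bar_subsolution hA hlam hM hγ hs y0 ht.1 h2
    rw [bar_pos_iff _ hs] at h2
    obtain ⟨hs1, hs2⟩ := hw _ hp
    rw [Lop_eq _ _ _ hs1] at hs2
    simp only at hs1 hs2
    obtain ⟨e, he⟩ : ∃ e : ℝ, e = k * (s ^ 2) ^ γ := ⟨_, rfl⟩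
    have he0 : 0 ≤ e := by rw [he]; positivity
    have hzform : ∀ q ∈ D, z q = w q - ((-k) + e * bar M (γ + 2) s y0 t1 q) := fun q hq => by
      rw [hzD q hq, hφ, he]; ring
    have hx' : ‖x - y0‖ < ρ := by
      refine lt_of_pow_lt_pow_left₀ 2 hρ.le (h2.trans_le ?_)
      have : M * (t - t1) ≤ M * (t0 - t1) := mul_le_mul_of_nonneg_left (by linarith [ht.2]) hM.le
      simp only
      linarith
    have hnx : ∀ᶠ y in 𝓝 x, (y, t) ∈ D :=
      (Continuous.prodMk_left t).continuousAt.eventually (hD.mem_nhds hp)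
    have hnt : ∀ᶠ r in 𝓝 t, (x, r) ∈ D :=
      (Continuous.prodMk_right x).continuousAt.eventually (hD.mem_nhds hp)
    have hCe : ContDiffAt ℝ 2 (fun y => e * bar M (γ + 2) s y0 t1 (y, t)) x :=
      contDiffAt_const.mul hC
    have hloc : IsLocalMin (fun y => w (y, t) - e * bar M (γ + 2) s y0 t1 (y, t)) x := by
      have hnb : Metric.closedBall y0 ρ ∈ 𝓝 x :=
        Filter.mem_of_superset (Metric.isOpen_ball.mem_nhds (by rwa [mem_ball_iff_norm]))
          Metric.ball_subset_closedBall
      filter_upwards [hnb, hnx] with y hy hyD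
      have := hmin y hy
      rw [hzform _ hp, hzform _ hyD] at this
      linarith
    have htr := trF_D2_le_of_isLocalMin hA hlam.le hs1 hCe hloc
    have htr2 : trF (A x) (D2 (fun y => e * bar M (γ + 2) s y0 t1 (y, t)) x) =
        e * trF (A x) (D2 (fun y => bar M (γ + 2) s y0 t1 (y, t)) x) := by
      rw [D2_const_mul, trF_smul]
    refine ⟨_, ?_, (hs2.sub ((hd.const_mul e).const_add (-k))).congr_of_eventuallyEq ?_⟩
    · rw [htr2] at htr
      nlinarith
    · filter_upwards [hnt] with r hr
      exact hzform _ hr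

lemma xprime_mkPt_sub (x : Spc m) (a : ℝ) : ‖x - mkPt (xprime x) (xlast x - a)‖ ≤ |a| := by
  have := norm_mkPt_sub_le (xprime x) (xprime x) (xlast x) (xlast x - a)
  rw [mkPt_xprime_xlast] at this
  simpa using this

/-- Decay of the negative part of a solution at points close to the graph. -/
theorem exists_boundary_decay (m : ℕ) {lam Lam K : ℝ} (hlam : 0 < lam) (hK : 0 ≤ K) :
    ∃ R c : ℝ, 1 ≤ R ∧ 0 < c ∧ c < 1 ∧
      ∀ A : Spc m → Matrix (Fin (m + 1)) (Fin (m + 1)) ℝ, IsElliptic lam Lam A →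
      ∀ g : Spc' m → ℝ → ℝ, Continuous (fun q : Spc' m × ℝ => g q.1 q.2) →
      HolderSemi 1 (1 / 2) K g → ∀ w, SolvesL A w (Cyl g 1) → ContinuousOn w (Cyl g 1) →
      ∀ x0 t0 s k, (x0, t0) ∈ Cyl g 1 → 0 < s → hgt g (x0, t0) ≤ s → 0 ≤ k →
      (∀ x t, ‖x - x0‖ ≤ R * s → t ∈ Icc (t0 - s ^ 2) t0 → (x, t) ∈ Cyl g 1 → -k ≤ w (x, t)) →
      (∀ x t, ‖x - x0‖ ≤ R * s → t ∈ Icc (t0 - s ^ 2) t0 → (x, t) ∉ Cyl g 1 →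
        ∀ ε > 0, ∀ᶠ q in 𝓝[Cyl g 1] (x, t), -ε < w q) →
      -(1 - c) * k ≤ w (x0, t0) := by
  obtain ⟨N, hN⟩ : ∃ N : ℝ, N = 3 + 2 * K := ⟨_, rfl⟩
  have hN3 : 3 ≤ N := by linarith
  have hM : 0 < 2 * N ^ 2 := by positivity
  obtain ⟨γ, hγ⟩ := exists_bar_exponent hlam
    ((2 * (2 * N ^ 2) + 8 * lam + 4 * ((m + 1) * Lam)) ^ 2) hM
  have hγ' : (2 * (2 * N ^ 2) + 8 * lam + 4 * ((m + 1) * Lam)) ^ 2 ≤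
      ((γ + 2 : ℕ) : ℝ) * (2 * N ^ 2) * (32 * lam) := by
    refine hγ.trans ?_
    push_cast
    gcongr
    linarith
  obtain ⟨c, hc⟩ : ∃ c : ℝ, c = (1 + N ^ 2) ^ 2 / (1 + 2 * N ^ 2) ^ (γ + 2) := ⟨_, rfl⟩
  have hc0 : 0 < c := by rw [hc]; positivity
  have hc1 : c ≤ 1 := by
    rw [hc, div_le_one (by positivity)]
    calc (1 + N ^ 2) ^ 2 ≤ (1 + 2 * N ^ 2) ^ 2 := by gcongr; nlinarith
      _ ≤ (1 + 2 * N ^ 2) ^ (γ + 2) := pow_le_pow_right₀ (by nlinarith) (by omega)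
  refine ⟨3 * N, c / 2, by linarith, by positivity, by linarith, ?_⟩
  intro A hA g hgc hg w hw hwc x0 t0 s k hP hs hhs hk hlow hbd
  obtain ⟨y0, hy0⟩ : ∃ y0, y0 = mkPt (xprime x0) (xlast x0 - N * s) := ⟨_, rfl⟩
  have hNs : 0 < N * s := by positivity
  have hd : ‖x0 - y0‖ ≤ N * s := by
    have := xprime_mkPt_sub x0 (N * s)
    rwa [← hy0, abs_of_pos hNs] at this
  have hd2 : ‖x0 - y0‖ ^ 2 ≤ N ^ 2 * s ^ 2 := by
    rw [← mul_pow]; exact pow_le_pow_left₀ (norm_nonneg _) hd 2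
  have hball : ∀ x ∈ Metric.closedBall y0 (2 * (N * s)), ‖x - x0‖ ≤ 3 * N * s := by
    intro x hx
    rw [mem_closedBall_iff_norm] at hx
    have := norm_sub_le_norm_sub_add_norm_sub x y0 x0
    rw [norm_sub_rev y0] at this
    linarith
  have hs2 : 0 < s ^ 2 := by positivity
  have hsz : s ^ 2 + 2 * N ^ 2 * (t0 - (t0 - s ^ 2)) < (2 * (N * s)) ^ 2 := by
    have : 0 < s ^ 2 * (2 * N ^ 2 - 1) := mul_pos hs2 (by nlinarith)
    linarith
  have key := neg_le_of_exterior_ball hA hlam hM hγ' hs (isOpen_Cyl hgc 1) hw hwc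
    (y0 := y0) (ρ := 2 * (N * s)) (t1 := t0 - s ^ 2) (t0 := t0) (k := k) (by positivity) hk
    (fun x hx t ht => hlow x t (hball x hx) ht) (fun x hx t ht => hbd x t (hball x hx) ht)
    (fun x hx hin => ?_) hsz (x := x0) (t := t0)
    (by rw [mem_closedBall_iff_norm]; linarith) ⟨by linarith, le_rfl⟩ hP
  · have hb : c ≤ bar (2 * N ^ 2) (γ + 2) s y0 (t0 - s ^ 2) (x0, t0) * (s ^ 2) ^ γ := by
      have e1 : s ^ 2 + 2 * N ^ 2 * (t0 - (t0 - s ^ 2)) = s ^ 2 * (1 + 2 * N ^ 2) := by ring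
      rw [bar_eq hM (γ + 2) y0 (by simp only; linarith) (by simp only; nlinarith)]
      simp only
      rw [e1, mul_pow, pow_add (s ^ 2), hc, div_mul_eq_mul_div,
        div_le_div_iff₀ (by positivity) (by positivity)]
      have h1 : s ^ 2 * (1 + N ^ 2) ≤ s ^ 2 * (1 + 2 * N ^ 2) - ‖x0 - y0‖ ^ 2 := by nlinarith
      have h2 := pow_le_pow_left₀ (by positivity) h1 2
      have h3 : 0 ≤ (s ^ 2) ^ γ * (1 + 2 * N ^ 2) ^ (γ + 2) := by positivity
      have h4 := mul_le_mul_of_nonneg_right h2 h3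
      nlinarith
    nlinarith
  · have hyh : hgt g (y0, t0) = hgt g (x0, t0) - N * s := by
      rw [hgt, hgt, hy0]; simp only [xprime_mkPt, xlast_mkPt]; ring
    have h1 := (abs_le.1 (hg.abs_hgt_sub_le_of hK (p := (x, t0 - s ^ 2)) (q := (y0, t0)) (a := s)
      hx.le hs.le (by simp only; rw [sub_sub_cancel_left, abs_neg, abs_of_pos hs2]))).2
    have h2 := (mem_Cyl.1 hin).2.2.1
    rw [hyh] at h1
    nlinarith

lemma VanishesOn.tendsto {g : Spc' m → ℝ → ℝ} (hgc : Continuous fun q : Spc' m × ℝ => g q.1 q.2)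
    {u : Spc m × ℝ → ℝ} (hu : VanishesOn u (Cyl g 1) (graphSet g)) {p : Spc m × ℝ}
    (h1 : ‖xprime p.1‖ < 1) (h2 : |p.2| < 1) (h3 : hgt g p < 1) (hp : p ∉ Cyl g 1) :
    Tendsto u (𝓝[Cyl g 1] p) (𝓝 0) := by
  by_cases hcl : p ∈ closure (Cyl g 1)
  · refine hu p ⟨?_, hcl⟩
    have h4 : p ∈ {q | 0 ≤ hgt g q} :=
      closure_minimal (fun q hq => (mem_Cyl.1 hq).2.2.1.le)
        (isClosed_le continuous_const (continuous_hgt hgc)) hcl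
    have h5 : ¬ 0 < hgt g p := fun h => hp (mem_Cyl.2 ⟨h1, by rwa [one_pow], h, h3⟩)
    have h6 : hgt g p = 0 := le_antisymm (not_lt.1 h5) h4
    rw [hgt] at h6
    exact sub_eq_zero.1 h6
  · rw [notMem_closure_iff_nhdsWithin_eq_bot.1 hcl]
    exact tendsto_bot

end boundaryDecay

section chains
variable {m : ℕ}

/-- Harnack inequality along a segment in space-time. -/
theorem exists_harnack_segment (m : ℕ) {lam Lam : ℝ} (hlam : 0 < lam) (hLam : lam ≤ Lam) :
    ∃ C : ℝ, 1 ≤ C ∧ ∀ A : Spc m → Matrix (Fin (m + 1)) (Fin (m + 1)) ℝ, IsElliptic lam Lam A →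
      ∀ (v : Spc m × ℝ → ℝ) (D : Set (Spc m × ℝ)), IsOpen D → SolvesL A v D → ContinuousOn v D →
      ∀ (n : ℕ) (x y : Spc m) (t T ρ : ℝ), 1 ≤ n → 0 < T → ‖y - x‖ + 5 * √T ≤ ρ →
      ‖y - x‖ ^ 2 ≤ n * T → Metric.closedBall x ρ ×ˢ Icc (t - T) (t + T) ⊆ D →
      (∀ q ∈ Metric.closedBall x ρ ×ˢ Icc (t - T) (t + T), 0 ≤ v q) →
      v (x, t) ≤ C ^ n * v (y, t + T) := by
  obtain ⟨C, hC, H⟩ := exists_harnack m hlam hLam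
  refine ⟨max C 1, le_max_right _ _, ?_⟩
  intro A hA v D hD hv hvc n x y t T ρ hn hT hρ hyn hbox hpos
  have hn0 : (0 : ℝ) < n := by exact_mod_cast hn
  have hn1 : (1 : ℝ) ≤ n := by exact_mod_cast hn
  have hPS : PosSol A v (Metric.closedBall x ρ ×ˢ Icc (t - T) (t + T)) :=
    ⟨fun p hp => hv p (hbox hp), hpos,
      fun p hp => (hvc.continuousAt (hD.mem_nhds (hbox hp))).rlsc⟩
  obtain ⟨r, hr⟩ : ∃ r : ℝ, r = √(T / n) / 2 := ⟨_, rfl⟩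
  have hr0 : 0 < r := by rw [hr]; positivity
  have hr2 : 4 * r ^ 2 = T / n := by
    rw [hr, div_pow, Real.sq_sqrt (by positivity)]; ring
  have hrT : 2 * r ≤ √T := by
    rw [hr, mul_div_cancel₀ _ (two_ne_zero)]
    exact Real.sqrt_le_sqrt (div_le_self hT.le hn1)
  have hTn : T / n ≤ T := div_le_self hT.le hn1
  have hstep : ‖(1 / (n : ℝ)) • (y - x)‖ ≤ 2 * r := by
    refine le_of_sq_le_sq ?_ (by positivity)
    rw [norm_smul, mul_pow, mul_pow, Real.norm_of_nonneg (by positivity)]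
    have : (2 : ℝ) ^ 2 * r ^ 2 = T / n := by linarith
    rw [this, div_pow, one_pow, div_mul_eq_mul_div, one_mul, div_le_div_iff₀ (by positivity) hn0]
    nlinarith
  have key : ∀ i : ℕ, i ≤ n →
      v (x, t) ≤ max C 1 ^ i * v (x + ((i : ℝ) / n) • (y - x), t + (i / n) * T) := by
    intro i
    induction i with
    | zero => intro _; simp
    | succ i ih =>
      intro hi
      have hin : ((i : ℝ) + 1) / n ≤ 1 := by
        rw [div_le_one hn0]; exact_mod_cast hi
      have hi0 : (0 : ℝ) ≤ (i : ℝ) / n := by positivity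
      have e0 : ((i : ℝ) + 1) / n = i / n + 1 / n := add_div _ _ _
      obtain ⟨xi, hxi⟩ : ∃ xi, xi = x + ((i : ℝ) / n) • (y - x) := ⟨_, rfl⟩
      obtain ⟨ti, hti⟩ : ∃ ti, ti = t + (i / n : ℝ) * T := ⟨_, rfl⟩
      have hn1' : (0 : ℝ) < 1 / n := by positivity
      have e4 : (1 / n : ℝ) * T = 4 * r ^ 2 := by rw [hr2]; ring
      have hti1 : t ≤ ti := by rw [hti]; nlinarith [mul_nonneg hi0 hT.le]
      have hti2 : ti + 4 * r ^ 2 ≤ t + T := by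
        have := mul_le_mul_of_nonneg_right hin hT.le
        rw [e0, add_mul, one_mul] at this
        rw [hti, ← e4]; linarith
      have e1 : x + (((i + 1 : ℕ) : ℝ) / n) • (y - x) = xi + (1 / (n : ℝ)) • (y - x) := by
        rw [hxi, add_assoc, ← add_smul]; push_cast; rw [e0]
      have e2 : t + (((i + 1 : ℕ) : ℝ) / n) * T = ti + 4 * r ^ 2 := by
        rw [hti, ← e4]; push_cast; rw [e0]; ring
      have hd : ‖xi - x‖ ≤ ‖y - x‖ := by
        rw [hxi, add_sub_cancel_left, norm_smul, Real.norm_of_nonneg hi0]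
        exact mul_le_of_le_one_left (norm_nonneg _) (by linarith)
      have hsub : Metric.closedBall xi (10 * r) ×ˢ Icc (ti - 2 * r ^ 2) (ti + 4 * r ^ 2) ⊆
          Metric.closedBall x ρ ×ˢ Icc (t - T) (t + T) := by
        refine Set.prod_mono (Metric.closedBall_subset_closedBall' ?_)
          (Icc_subset_Icc (by nlinarith) hti2)
        rw [dist_eq_norm]
        linarith
      have hsub2 : Metric.closedBall xi r ×ˢ Icc (ti - r ^ 2) ti ⊆
          Metric.closedBall xi (10 * r) ×ˢ Icc (ti - 2 * r ^ 2) (ti + 4 * r ^ 2) :=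
        Set.prod_mono (Metric.closedBall_subset_closedBall (by linarith))
          (Icc_subset_Icc (by nlinarith) (by nlinarith))
      have h1 := H A hA v _ D hPS hD hvc xi ti r hr0 hsub ((hsub2.trans hsub).trans hbox)
        (xi + (1 / (n : ℝ)) • (y - x)) (by rw [mem_closedBall_iff_norm, add_sub_cancel_left]; exact hstep)
      have h2 := ih (by omega)
      rw [← hxi, ← hti] at h2
      rw [e1, e2, pow_succ, mul_assoc]
      refine h2.trans (mul_le_mul_of_nonneg_left (h1.trans ?_) (by positivity))
      refine mul_le_mul_of_nonneg_right (le_max_left _ _) (hpos _ (hsub ⟨?_, ?_⟩))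
      · simp only
        rw [mem_closedBall_iff_norm, add_sub_cancel_left]
        linarith
      · simp only
        exact ⟨by nlinarith, le_rfl⟩
  have := key n le_rfl
  rwa [div_self hn0.ne', one_smul, one_mul, add_sub_cancel] at this

/-- Harnack inequality between two points above the same horizontal position, with comparable
heights. -/
theorem exists_vertical_step (m : ℕ) {lam Lam K : ℝ} (hlam : 0 < lam) (hLam : lam ≤ Lam)
    (hK : 0 ≤ K) :
    ∃ κ θ C : ℝ, 0 < κ ∧ κ ≤ 1 / 4 ∧ 0 < θ ∧ θ ≤ κ / 2 ∧ 1 ≤ C ∧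
      ∀ A : Spc m → Matrix (Fin (m + 1)) (Fin (m + 1)) ℝ, IsElliptic lam Lam A →
      ∀ g : Spc' m → ℝ → ℝ, Continuous (fun q : Spc' m × ℝ => g q.1 q.2) →
      HolderSemi 1 (1 / 2) K g → ∀ w, SolvesL A w (Cyl g 1) → ContinuousOn w (Cyl g 1) →
      ∀ x' t h h1 h2, 0 < h → h ≤ h1 → h1 ≤ (1 + κ) * h → h ≤ h2 → h2 ≤ (1 + κ) * h →
      (∀ q, ‖xprime q.1 - x'‖ ≤ h / 2 → |q.2 - t| ≤ θ * h ^ 2 → h / 2 ≤ hgt g q →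
        hgt g q ≤ 2 * h → q ∈ Cyl g 1 ∧ 0 ≤ w q) →
      w (lift g x' t h1) ≤ C * w (lift g x' (t + θ * h ^ 2) h2) := by
  obtain ⟨C, hC, H⟩ := exists_harnack_segment m hlam hLam
  have hL : 0 < 1 + K := by linarith
  obtain ⟨κ, hκ⟩ : ∃ κ : ℝ, κ = 1 / (4 * (1 + K)) := ⟨_, rfl⟩
  have hκ0 : 0 < κ := by rw [hκ]; positivity
  have hκL : (1 + K) * κ = 1 / 4 := by rw [hκ]; field_simp
  have hκ4 : κ ≤ 1 / 4 := by nlinarith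
  obtain ⟨b, hb⟩ : ∃ b : ℝ, b = κ / (K + 6) := ⟨_, rfl⟩
  have hb0 : 0 < b := by rw [hb]; positivity
  have hbK : (K + 6) * b = κ := by rw [hb]; field_simp
  obtain ⟨n, hn⟩ := exists_nat_ge (max 1 ((κ + K * b) ^ 2 / b ^ 2))
  have hn1 : 1 ≤ n := by exact_mod_cast (le_max_left _ _).trans hn
  have hn2 : (κ + K * b) ^ 2 ≤ n * b ^ 2 := by
    rw [← div_le_iff₀ (by positivity)]; exact (le_max_right _ _).trans hn
  refine ⟨κ, b ^ 2, C ^ n, hκ0, hκ4, by positivity, by nlinarith, one_le_pow₀ hC, ?_⟩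
  intro A hA g hgc hg w hw hwc x' t h h1 h2 hh hh1 hh1' hh2 hh2' hdom
  have hbh : 0 < b * h := by positivity
  have hT : 0 < b ^ 2 * h ^ 2 := by positivity
  have hTs : √(b ^ 2 * h ^ 2) = b * h := by rw [← mul_pow]; exact Real.sqrt_sq hbh.le
  have habs : |h2 - h1| ≤ κ * h := by rw [abs_le]; constructor <;> linarith
  have hdisp : ‖(lift g x' (t + b ^ 2 * h ^ 2) h2).1 - (lift g x' t h1).1‖ ≤ (κ + K * b) * h := by
    have := hg.norm_lift_sub_le hK x' x' (t := t + b ^ 2 * h ^ 2) (s := t) h2 h1 hbh.le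
      (by rw [add_sub_cancel_left, abs_of_pos hT, mul_pow])
    rw [sub_self, norm_zero, mul_zero, zero_add] at this
    nlinarith
  have hbox : ∀ q ∈ Metric.closedBall (lift g x' t h1).1 (κ * h + (K + 5) * (b * h)) ×ˢ
      Icc (t - b ^ 2 * h ^ 2) (t + b ^ 2 * h ^ 2), q ∈ Cyl g 1 ∧ 0 ≤ w q := by
    rintro q ⟨hq1, hq2⟩
    rw [mem_closedBall_iff_norm] at hq1
    have hqt : |q.2 - t| ≤ b ^ 2 * h ^ 2 := by
      rw [abs_le]; constructor <;> linarith [hq2.1, hq2.2]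
    have h3 := abs_le.1 (hg.abs_hgt_sub_le_of hK (p := q) (q := lift g x' t h1) hq1 hbh.le
      (by rwa [lift_snd, mul_pow]))
    rw [hgt_lift] at h3
    have h4 : (1 + K) * (κ * h + (K + 5) * (b * h) + b * h) = h / 2 := by
      have : (1 + K) * (κ * h + (K + 5) * (b * h) + b * h) =
        ((1 + K) * κ) * h + (1 + K) * ((K + 6) * b) * h := by ring
      rw [this, hbK, hκL]; ring
    rw [h4] at h3
    have h5 := (norm_xprime_sub_le q.1 (lift g x' t h1).1).trans hq1
    rw [xprime_lift] at h5
    refine hdom q (h5.trans ?_) hqt (by linarith) (by nlinarith)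
    have h6 : (K + 5) * (b * h) ≤ κ * h := by rw [← hbK]; nlinarith
    nlinarith
  have := H A hA w _ (isOpen_Cyl hgc 1) hw hwc n _ (lift g x' (t + b ^ 2 * h ^ 2) h2).1 t
    (b ^ 2 * h ^ 2) (κ * h + (K + 5) * (b * h)) hn1 hT (by rw [hTs]; linarith) ?_
    (fun q hq => (hbox q hq).1) (fun q hq => (hbox q hq).2)
  · exact this
  · refine (pow_le_pow_left₀ (norm_nonneg _) hdisp 2).trans ?_
    rw [mul_pow, ← mul_assoc]
    exact mul_le_mul_of_nonneg_right hn2 (by positivity)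

set_option maxHeartbeats 2000000 in
/-- Harnack chains between interior points of the unit cylinder. -/
theorem exists_chain (m : ℕ) {lam Lam K δ τ : ℝ} (hlam : 0 < lam) (hLam : lam ≤ Lam)
    (hK : 0 ≤ K) (hδ : 0 < δ) (hτ : 0 < τ) :
    ∃ C : ℝ, 0 < C ∧
      ∀ A : Spc m → Matrix (Fin (m + 1)) (Fin (m + 1)) ℝ, IsElliptic lam Lam A →
      ∀ g : Spc' m → ℝ → ℝ, Continuous (fun q : Spc' m × ℝ => g q.1 q.2) →
      HolderSemi 1 (1 / 2) K g → ∀ w, SolvesL A w (Cyl g 1) → ContinuousOn w (Cyl g 1) →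
      (∀ q ∈ Cyl g 1, 0 ≤ w q) →
      ∀ x' y' t s h k, ‖x'‖ ≤ 3 / 4 → ‖y'‖ ≤ 3 / 4 → -(7 / 8) ≤ t → s ≤ 7 / 8 → τ ≤ s - t →
      δ ≤ h → h ≤ 1 / 2 → δ ≤ k → k ≤ 1 / 2 →
      w (lift g x' t h) ≤ C * w (lift g y' s k) := by
  obtain ⟨C, hC, H⟩ := exists_harnack_segment m hlam hLam
  have hL : 0 < 1 + K := by linarith
  obtain ⟨n, hn⟩ := exists_nat_ge (max 1 ((2 * (1 + K) / τ + K) ^ 2))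
  have hn1 : 1 ≤ n := by exact_mod_cast (le_max_left _ _).trans hn
  have hn2 : (2 * (1 + K) / τ + K) ^ 2 ≤ n := (le_max_right _ _).trans hn
  obtain ⟨ε, hε⟩ : ∃ ε : ℝ, ε = δ / (4 * (1 + K) * (3 * K + 8)) := ⟨_, rfl⟩
  have hε0 : 0 < ε := by rw [hε]; positivity
  have hεL : (1 + K) * ((3 * K + 8) * ε) = δ / 4 := by rw [hε]; field_simp
  obtain ⟨N, hN⟩ := exists_nat_ge (max 1 (max (1 / ε) (2 / ε ^ 2)))
  have hN1 : (1 : ℝ) ≤ N := (le_max_left _ _).trans hN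
  have hN0 : (0 : ℝ) < N := by linarith
  have hN2 : 1 / N ≤ ε := by
    rw [div_le_iff₀ hN0, mul_comm, ← div_le_iff₀ hε0]
    exact (le_max_left _ _).trans ((le_max_right _ _).trans hN)
  have hN3 : 2 / N ≤ ε ^ 2 := by
    rw [div_le_iff₀ hN0, mul_comm, ← div_le_iff₀ (by positivity)]
    exact (le_max_right _ _).trans ((le_max_right _ _).trans hN)
  refine ⟨(C ^ n) ^ N, by positivity, ?_⟩
  intro A hA g hgc hg w hw hwc hpos x' y' t s h k hx hy ht hs hts hh hh2 hk hk2
  obtain ⟨T, hT⟩ : ∃ T : ℝ, T = (s - t) / N := ⟨_, rfl⟩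
  have hT0 : 0 < T := by rw [hT]; exact div_pos (by linarith) hN0
  have hTε : T ≤ ε ^ 2 := by
    refine le_trans ?_ hN3
    rw [hT]
    exact div_le_div_of_nonneg_right (by linarith) hN0.le
  have hTs : √T ≤ ε := Real.sqrt_le_iff.2 ⟨hε0.le, hTε⟩
  have hδ2 : δ ≤ 1 / 2 := hh.trans hh2
  have hε1 : (3 * K + 8) * ε ≤ 1 / 8 := by
    nlinarith only [mul_nonneg hK (mul_nonneg (by linarith : 0 ≤ 3 * K + 8) hε0.le), hεL, hδ2]
  have hε8 : ε ≤ 1 / 64 := by nlinarith only [mul_nonneg hK hε0.le, hε1]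
  have hT1 : T ≤ 1 / 64 := by nlinarith only [hTε, hε8, hε0]
  have hsq := Real.sqrt_nonneg T
  have hsqT := Real.sq_sqrt hT0.le
  have hNτ : 1 / N ≤ T / τ := by
    rw [hT, div_div, div_le_div_iff₀ hN0 (by positivity)]
    nlinarith
  obtain ⟨p, hp⟩ : ∃ p : ℝ → Spc m × ℝ, p = fun a => lift g (x' + a • (y' - x')) (t + a * (s - t))
      (h + a * (k - h)) := ⟨_, rfl⟩
  have key : ∀ i : ℕ, i ≤ N → w (p 0) ≤ (C ^ n) ^ i * w (p (i / N)) := by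
    intro i
    induction i with
    | zero => intro _; simp
    | succ i ih =>
      intro hi
      have hin : ((i : ℝ) + 1) / N ≤ 1 := by
        rw [div_le_one hN0]; exact_mod_cast hi
      obtain ⟨a, ha⟩ : ∃ a : ℝ, a = i / N := ⟨_, rfl⟩
      have hi0 : 0 ≤ a := by rw [ha]; positivity
      have e0 : ((i + 1 : ℕ) : ℝ) / N = a + 1 / N := by rw [ha, ← add_div]; push_cast; rfl
      have hin' : a + 1 / N ≤ 1 := by rw [← e0]; push_cast; exact hin
      have hNp : (0 : ℝ) < 1 / N := by positivity
      have ha1 : a ≤ 1 := by linarith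
      have htN : 1 / N * (s - t) = T := by rw [hT]; ring
      have h1 := ih (by omega)
      rw [← ha] at h1
      rw [e0, pow_succ, mul_assoc]
      refine h1.trans (mul_le_mul_of_nonneg_left ?_ (by positivity))
      have e1 : p (a + 1 / N) = ((p (a + 1 / N)).1, (p a).2 + T) := by
        refine Prod.ext rfl ?_
        rw [hp]; simp only [lift_snd]; rw [← htN]; ring
      have hxx : ‖x' + a • (y' - x')‖ ≤ 3 / 4 := by
        have e : x' + a • (y' - x') = (1 - a) • x' + a • y' := by
          rw [smul_sub, sub_smul, one_smul]; abel
        rw [e]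
        refine (norm_add_le _ _).trans ?_
        rw [norm_smul, norm_smul, Real.norm_of_nonneg hi0, Real.norm_of_nonneg (by linarith)]
        have h3 := mul_le_mul_of_nonneg_left hx (sub_nonneg.2 ha1)
        have h4 := mul_le_mul_of_nonneg_left hy hi0
        linarith
      have hyx : ‖y' - x'‖ ≤ 3 / 2 := (norm_sub_le _ _).trans (by linarith)
      have hdisp : ‖(p (a + 1 / N)).1 - (p a).1‖ ≤ 2 * (1 + K) * (1 / N) + K * √T := by
        have := hg.norm_lift_sub_le hK (x' + (a + 1 / N) • (y' - x')) (x' + a • (y' - x'))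
          (t := t + (a + 1 / N) * (s - t)) (s := t + a * (s - t)) (h + (a + 1 / N) * (k - h))
          (h + a * (k - h)) hsq (by
            have e : t + (a + 1 / N) * (s - t) - (t + a * (s - t)) = T := by rw [← htN]; ring
            rw [e, hsqT, abs_of_pos hT0])
        rw [hp]
        refine this.trans ?_
        have e2 : x' + (a + 1 / (N : ℝ)) • (y' - x') - (x' + a • (y' - x')) =
            (1 / (N : ℝ)) • (y' - x') := by rw [add_smul]; abel
        have e3 : h + (a + 1 / N) * (k - h) - (h + a * (k - h)) = 1 / N * (k - h) := by ring
        rw [e2, e3, norm_smul, Real.norm_of_nonneg hNp.le, abs_mul, abs_of_pos hNp]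
        have h3 : |k - h| ≤ 1 / 2 := by rw [abs_le]; constructor <;> linarith
        have h4 : (1 + K) * (1 / N * ‖y' - x'‖) ≤ (1 + K) * (1 / N * (3 / 2)) := by gcongr
        have h5 : 1 / N * |k - h| ≤ 1 / N * (1 / 2) := by gcongr
        have h6 := mul_nonneg hK hNp.le
        linarith
      obtain ⟨ρ, hρ⟩ : ∃ ρ : ℝ, ρ = 2 * (1 + K) * (1 / N) + K * √T + 5 * √T := ⟨_, rfl⟩
      have hρε : ρ + √T ≤ (3 * K + 8) * ε := by
        have : 2 * (1 + K) * (1 / N) ≤ 2 * (1 + K) * ε := by gcongr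
        have h6 := mul_le_mul_of_nonneg_left hTs hK
        rw [hρ]; linarith
      have hρ8 : ρ ≤ 1 / 8 := by linarith
      have hLρ : (1 + K) * (ρ + √T) ≤ δ / 4 := by
        rw [← hεL]; exact mul_le_mul_of_nonneg_left hρε hL.le
      have hhk1 : δ ≤ h + a * (k - h) := by
        have h3 := mul_le_mul_of_nonneg_left hh (sub_nonneg.2 ha1)
        have h4 := mul_le_mul_of_nonneg_left hk hi0
        linarith
      have hhk2 : h + a * (k - h) ≤ 1 / 2 := by
        have h3 := mul_le_mul_of_nonneg_left hh2 (sub_nonneg.2 ha1)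
        have h4 := mul_le_mul_of_nonneg_left hk2 hi0
        linarith
      have hbox : Metric.closedBall (p a).1 ρ ×ˢ Icc ((p a).2 - T) ((p a).2 + T) ⊆ Cyl g 1 := by
        have := hg.box_subset_Cyl hK (x := (p a).1) (t := (p a).2) (ρ := ρ) (b := √T) hsq ?_ ?_ ?_ ?_
        · rwa [hsqT] at this
        · rw [hp, xprime_lift]; linarith
        · rw [hp, hsqT, lift_snd]
          have : |t + a * (s - t)| ≤ 7 / 8 := by
            have h3 : 0 ≤ a * (s - t) := mul_nonneg hi0 (by linarith)
            have h4 : a * (s - t) ≤ s - t := mul_le_of_le_one_left (by linarith) ha1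
            rw [abs_le]
            constructor <;> linarith
          linarith
        · rw [Prod.mk.eta, hp, hgt_lift]; linarith
        · rw [Prod.mk.eta, hp, hgt_lift]; linarith
      have := H A hA w _ (isOpen_Cyl hgc 1) hw hwc n (p a).1 (p (a + 1 / N)).1 (p a).2 T ρ hn1 hT0
        (by rw [hρ]; linarith) ?_ hbox (fun q hq => hpos q (hbox hq))
      · rw [Prod.mk.eta] at this
        rw [e1]; exact this
      · have h6 : 2 * (1 + K) * (1 / N) + K * √T ≤ (2 * (1 + K) / τ + K) * √T := by
          have h7 : T ≤ √T := Real.le_sqrt_of_sq_le (by nlinarith only [hT0, hT1])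
          have h8 : 2 * (1 + K) * (1 / N) ≤ 2 * (1 + K) * (T / τ) := by gcongr
          have h9 : 2 * (1 + K) * (T / τ) ≤ 2 * (1 + K) * (√T / τ) := by gcongr
          have e : 2 * (1 + K) * (√T / τ) = 2 * (1 + K) / τ * √T := by ring
          linarith
        refine (pow_le_pow_left₀ (norm_nonneg _) (hdisp.trans h6) 2).trans ?_
        rw [mul_pow, hsqT]
        exact mul_le_mul_of_nonneg_right hn2 hT0.le
  have := key N le_rfl
  rw [div_self hN0.ne', hp] at this
  simpa using this

end chains

section carleson
variable {m : ℕ}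

/-- Polynomial bound for the growth of solutions close to the graph. -/
theorem exists_polynomial_bound (m : ℕ) {lam Lam K : ℝ} (hlam : 0 < lam) (hLam : lam ≤ Lam)
    (hK : 0 ≤ K) :
    ∃ (γ : ℕ) (C : ℝ), 1 ≤ γ ∧ 0 < C ∧
      ∀ A : Spc m → Matrix (Fin (m + 1)) (Fin (m + 1)) ℝ, IsElliptic lam Lam A →
      ∀ g : Spc' m → ℝ → ℝ, Continuous (fun q : Spc' m × ℝ => g q.1 q.2) →
      HolderSemi 1 (1 / 2) K g → ∀ w, SolvesL A w (Cyl g 1) → ContinuousOn w (Cyl g 1) →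
      (∀ q ∈ Cyl g 1, 0 < w q) →
      ∀ x' t h, ‖x'‖ ≤ 3 / 4 → -(7 / 8) ≤ t → t ≤ 3 / 8 + h ^ 2 / 4 → 0 < h → h ≤ 1 / 2 →
      w (lift g x' t h) * h ^ γ ≤ C * w (Ebar g) := by
  obtain ⟨κ, θ, C2, hκ, hκ4, hθ, hθκ, hC2, H⟩ := exists_vertical_step m hlam hLam hK
  obtain ⟨C, hC, HC⟩ := exists_chain m (δ := 1 / 4) (τ := 1 / 16) hlam hLam hK (by norm_num)
    (by norm_num)
  obtain ⟨γ, hγ⟩ := pow_unbounded_of_one_lt C2 (show 1 < 1 + κ by linarith)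
  have hγ1 : 1 ≤ γ := by
    by_contra hc
    have : γ = 0 := by omega
    rw [this, pow_zero] at hγ
    linarith
  refine ⟨γ, C, hγ1, hC, ?_⟩
  intro A hA g hgc hg w hw hwc hpos
  have key : ∀ k : ℕ, ∀ x' t h, ‖x'‖ ≤ 3 / 4 → -(7 / 8) ≤ t → t ≤ 3 / 8 + h ^ 2 / 4 → 0 < h →
      h ≤ 1 / 2 → 1 / 4 ≤ h * (1 + κ) ^ k → w (lift g x' t h) * h ^ γ ≤ C * w (Ebar g) := by
    have base : ∀ x' t h, ‖x'‖ ≤ 3 / 4 → -(7 / 8) ≤ t → t ≤ 3 / 8 + h ^ 2 / 4 →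
        h ≤ 1 / 2 → 1 / 4 ≤ h → w (lift g x' t h) * h ^ γ ≤ C * w (Ebar g) := by
      intro x' t h hx ht ht2 hh2 hh4
      have h1 : h ^ 2 ≤ 1 / 4 := by nlinarith only [hh2, hh4]
      have h2 := HC A hA g hgc hg w hw hwc (fun q hq => (hpos q hq).le) x' 0 t (1 / 2) h (1 / 2) hx
        (by rw [norm_zero]; norm_num) ht (by norm_num) (by linarith) hh4 hh2 (by norm_num) le_rfl
      have h3 : 0 < w (lift g x' t h) := by
        refine hpos _ (mem_Cyl.2 ⟨?_, ?_, ?_, ?_⟩)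
        · rw [xprime_lift]; linarith
        · rw [lift_snd, abs_lt]; constructor <;> linarith
        · rw [hgt_lift]; linarith
        · rw [hgt_lift]; linarith
      have h4 : h ^ γ ≤ 1 := pow_le_one₀ (by linarith) (by linarith)
      exact (mul_le_of_le_one_right h3.le h4).trans h2
    intro k
    induction k with
    | zero =>
      intro x' t h hx ht ht2 hh hh2 hh4
      exact base x' t h hx ht ht2 hh2 (by simpa using hh4)
    | succ k ih =>
      intro x' t h hx ht ht2 hh hh2 hh4
      by_cases hb : 1 / 4 ≤ h
      · exact base x' t h hx ht ht2 hh2 hb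
      push Not at hb
      have hh16 : h ^ 2 ≤ 1 / 16 := by nlinarith only [hb, hh]
      have hθh : θ * h ^ 2 ≤ 1 / 128 := by nlinarith only [hh16, hθκ, hκ4, hθ, sq_nonneg h]
      have hθh0 : 0 < θ * h ^ 2 := by positivity
      have hstep := H A hA g hgc hg w hw hwc x' t h h ((1 + κ) * h) hh le_rfl
        (by nlinarith only [hh, hκ]) (by nlinarith only [hh, hκ]) le_rfl ?_
      · have h1 := ih x' (t + θ * h ^ 2) ((1 + κ) * h) hx (by linarith)
          (by nlinarith only [ht2, hθκ, sq_nonneg h, mul_nonneg (sq_nonneg κ) (sq_nonneg h)])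
          (by positivity) (by nlinarith only [hb, hκ4, hh]) (by rw [pow_succ] at hh4; linarith)
        have h2 : 0 ≤ w (lift g x' (t + θ * h ^ 2) ((1 + κ) * h)) := by
          by_contra hc
          have h5 : w (lift g x' t h) < 0 := by
            push Not at hc
            nlinarith only [hstep, hc, hC2]
          refine absurd (hpos (lift g x' t h) (mem_Cyl.2 ⟨?_, ?_, ?_, ?_⟩)) (not_lt.2 h5.le)
          · rw [xprime_lift]; linarith
          · rw [lift_snd, abs_lt]; constructor <;> linarith
          · rw [hgt_lift]; linarith
          · rw [hgt_lift]; linarith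
        refine le_trans ?_ h1
        rw [mul_pow, ← mul_assoc]
        refine mul_le_mul_of_nonneg_right (hstep.trans ?_) (by positivity)
        rw [mul_comm]
        exact mul_le_mul_of_nonneg_left hγ.le h2
      · intro q hq1 hq2 hq3 hq4
        have h1 := norm_sub_norm_le (xprime q.1) x'
        have h2 := abs_le.1 hq2
        have hq : q ∈ Cyl g 1 := by
          refine mem_Cyl.2 ⟨by linarith, ?_, by linarith, by linarith⟩
          rw [abs_lt]
          constructor <;> linarith [h2.1, h2.2]
        exact ⟨hq, (hpos q hq).le⟩
  intro x' t h hx ht ht2 hh hh2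
  obtain ⟨k, hk⟩ := pow_unbounded_of_one_lt (1 / 4 / h) (show 1 < 1 + κ by linarith)
  refine key k x' t h hx ht ht2 hh hh2 ?_
  rw [div_lt_iff₀ hh] at hk
  linarith

lemma continuous_lift {g : Spc' m → ℝ → ℝ} (hgc : Continuous fun q : Spc' m × ℝ => g q.1 q.2) :
    Continuous fun z : Spc' m × ℝ × ℝ => lift g z.1 z.2.1 z.2.2 := by
  have h1 : Continuous fun z : Spc' m × ℝ => mkPt z.1 z.2 := by
    refine (PiLp.continuous_toLp 2 _).comp (continuous_pi fun i => ?_)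
    by_cases hi : i = Fin.last m
    · simp only [hi, dite_true]
      exact continuous_snd
    · simp only [hi, dite_false]
      fun_prop
  have h2 : Continuous fun z : Spc' m × ℝ × ℝ => g z.1 z.2.1 + z.2.2 :=
    (hgc.comp (continuous_fst.prodMk (continuous_fst.comp continuous_snd))).add
      (continuous_snd.comp continuous_snd)
  exact (h1.comp (continuous_fst.prodMk h2)).prodMk (continuous_fst.comp continuous_snd)

/-- A solution vanishing on the graph is bounded on smaller cylinders. -/
lemma VanishesOn.exists_bound {g : Spc' m → ℝ → ℝ}
    (hgc : Continuous fun q : Spc' m × ℝ => g q.1 q.2) {u : Spc m × ℝ → ℝ}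
    (huc : ContinuousOn u (Cyl g 1)) (hu : VanishesOn u (Cyl g 1) (graphSet g)) :
    ∃ B, ∀ q ∈ Cyl g 1, ‖xprime q.1‖ ≤ 3 / 4 → |q.2| ≤ 7 / 8 → hgt g q ≤ 1 / 2 → u q ≤ B := by
  have hc : IsCompact (Metric.closedBall (0 : Spc' m) (3 / 4) ×ˢ
      (Icc (-(7 / 8) : ℝ) (7 / 8) ×ˢ Icc (0 : ℝ) (1 / 2))) :=
    (isCompact_closedBall _ _).prod (isCompact_Icc.prod isCompact_Icc)
  have key := hc.induction_on (p := fun S => ∃ B, ∀ z ∈ S, lift g z.1 z.2.1 z.2.2 ∈ Cyl g 1 →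
    u (lift g z.1 z.2.1 z.2.2) ≤ B) ?_ ?_ ?_ ?_
  · obtain ⟨B, hB⟩ := key
    refine ⟨B, fun q hq h1 h2 h3 => ?_⟩
    have := hB (xprime q.1, q.2, hgt g q)
      ⟨by simpa using h1, abs_le.1 h2, (mem_Cyl.1 hq).2.2.1.le, h3⟩
    simp only [lift_hgt] at this
    exact this hq
  · exact ⟨0, by simp⟩
  · rintro S S' hSS ⟨B, hB⟩
    exact ⟨B, fun z hz => hB z (hSS hz)⟩
  · rintro S S' ⟨B, hB⟩ ⟨B', hB'⟩
    refine ⟨max B B', fun z hz hq => ?_⟩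
    rcases hz with hz | hz
    · exact (hB z hz hq).trans (le_max_left _ _)
    · exact (hB' z hz hq).trans (le_max_right _ _)
  · rintro ⟨x', t, h⟩ ⟨hz1, hz2, hz3⟩
    simp only at hz1 hz2 hz3
    have hev : ∃ B, ∀ᶠ q in 𝓝 (lift g x' t h), q ∈ Cyl g 1 → u q ≤ B := by
      by_cases hp : lift g x' t h ∈ Cyl g 1
      · have h1 := (huc.continuousAt ((isOpen_Cyl hgc 1).mem_nhds hp)).eventually_lt_const
          (lt_add_one (u (lift g x' t h)))
        exact ⟨_, h1.mono fun q hq _ => hq.le⟩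
      · have h1 := hu.tendsto hgc (p := lift g x' t h)
          (by rw [xprime_lift]; rw [mem_closedBall_zero_iff] at hz1; linarith)
          (by rw [lift_snd, abs_lt]; constructor <;> linarith [hz2.1, hz2.2])
          (by rw [hgt_lift]; linarith [hz3.2]) hp
        have h2 := h1.eventually_lt_const (zero_lt_one)
        rw [eventually_nhdsWithin_iff] at h2
        exact ⟨1, h2.mono fun q hq hqD => (hq hqD).le⟩
    obtain ⟨B, hB⟩ := hev
    have h3 := (continuous_lift hgc).continuousAt (x := (x', t, h)) |>.eventually hB
    exact ⟨_, mem_nhdsWithin_of_mem_nhds h3, B, fun z hz => hz⟩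

/-- Carleson estimate. -/
theorem exists_carleson (m : ℕ) {lam Lam K : ℝ} (hlam : 0 < lam) (hLam : lam ≤ Lam)
    (hK : 0 ≤ K) :
    ∃ M : ℝ, 0 < M ∧
      ∀ A : Spc m → Matrix (Fin (m + 1)) (Fin (m + 1)) ℝ, IsElliptic lam Lam A →
      ∀ g : Spc' m → ℝ → ℝ, Continuous (fun q : Spc' m × ℝ => g q.1 q.2) →
      HolderSemi 1 (1 / 2) K g → ∀ u, SolvesL A u (Cyl g 1) → ContinuousOn u (Cyl g 1) →
      (∀ q ∈ Cyl g 1, 0 < u q) → VanishesOn u (Cyl g 1) (graphSet g) →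
      ∀ q ∈ Cyl g 1, ‖xprime q.1‖ ≤ 5 / 8 → -(5 / 8) ≤ q.2 → q.2 ≤ 3 / 8 → hgt g q ≤ 1 / 2 →
      u q ≤ M * u (Ebar g) := by
  obtain ⟨R, c, hR, hc0, hc1, HB⟩ := exists_boundary_decay m (Lam := Lam) hlam hK
  obtain ⟨γ, C, hγ, hC, HP⟩ := exists_polynomial_bound m hlam hLam hK
  have hL : 0 < 1 + K := by linarith
  have hγ0 : (1 : ℝ) ≤ γ := by exact_mod_cast hγ
  obtain ⟨r, hr⟩ : ∃ r : ℝ, r = 1 - c / γ := ⟨_, rfl⟩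
  have hcγ : c / γ ≤ c := div_le_self hc0.le hγ0
  have hcγ0 : 0 < c / γ := by positivity
  have hr0 : 0 < r := by linarith
  have hr1 : r < 1 := by linarith
  have hrγ : 1 - c ≤ r ^ γ := by
    have := one_add_mul_le_pow (a := -(c / γ)) (by linarith) γ
    have e : 1 + (γ : ℝ) * -(c / γ) = 1 - c := by field_simp; ring
    rw [e] at this
    rw [hr, sub_eq_add_neg]
    exact this
  obtain ⟨σ, hσ⟩ : ∃ σ : ℝ, σ = (1 - r) / (8 * (2 + K) * (R + 1)) := ⟨_, rfl⟩
  have hσ0 : 0 < σ := by rw [hσ]; exact div_pos (by linarith) (by positivity)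
  have hσe : σ * ((2 + K) * (R + 1)) = (1 - r) / 8 := by rw [hσ]; field_simp
  have hσR : σ * (R + 1) ≤ (1 - r) / 8 := by
    rw [← hσe]
    refine mul_le_mul_of_nonneg_left ?_ hσ0.le
    exact le_mul_of_one_le_left (by linarith) (by linarith)
  have hσ1 : σ ≤ (1 - r) / 8 :=
    (le_mul_of_one_le_right hσ0.le (by linarith)).trans hσR
  have hσh : σ * (1 + (1 + K) * (R + 1)) ≤ 1 / 2 := by
    have : σ * (1 + (1 + K) * (R + 1)) ≤ σ * ((2 + K) * (R + 1)) :=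
      mul_le_mul_of_nonneg_left (by nlinarith only [hR]) hσ0.le
    linarith
  refine ⟨C / σ ^ γ, by positivity, ?_⟩
  intro A hA g hgc hg u hu huc hpos hvan q hq hq1 hq2 hq3 hq4
  by_contra hcon
  push Not at hcon
  obtain ⟨B, hB⟩ := hvan.exists_bound hgc huc
  have hU : 0 < u (Ebar g) := by
    refine hpos _ (mem_Cyl.2 ?_)
    have e : Ebar g = lift g 0 (1 / 2) (1 / 2) := rfl
    rw [e, xprime_lift, hgt_lift, lift_snd, norm_zero]
    norm_num [abs_of_pos]
  obtain ⟨V, hV⟩ : ∃ V : ℝ, V = C / σ ^ γ * u (Ebar g) := ⟨_, rfl⟩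
  have hV0 : 0 < V := by rw [hV]; positivity
  rw [← hV] at hcon
  have hw : SolvesL A (fun q => -u q) (Cyl g 1) := by
    have := hu.const_add_mul 0 (-1)
    simpa using this
  have h1r : 0 < 1 - r := by linarith
  have key : ∀ i : ℕ, ∃ p ∈ Cyl g 1, ‖xprime p.1‖ ≤ 3 / 4 - R * (σ * r ^ i) / (1 - r) ∧
      -(7 / 8) + σ * r ^ i / (1 - r) ≤ p.2 ∧ p.2 ≤ 3 / 8 ∧ hgt g p ≤ 1 / 2 ∧
      V < u p * (1 - c) ^ i := by
    intro i
    induction i with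
    | zero =>
      refine ⟨q, hq, ?_, ?_, hq3, hq4, by simpa using hcon⟩
      · have : R * (σ * r ^ 0) / (1 - r) ≤ 1 / 8 := by
          rw [div_le_iff₀ h1r, pow_zero]; linarith
        linarith
      · have : σ * r ^ 0 / (1 - r) ≤ 1 / 8 := by
          rw [div_le_iff₀ h1r, pow_zero]; linarith
        linarith
    | succ i ih =>
      obtain ⟨p, hp, hp1, hp2, hp3, hp4, hp5⟩ := ih
      obtain ⟨s, hs⟩ : ∃ s : ℝ, s = σ * r ^ i := ⟨_, rfl⟩
      rw [← hs] at hp1 hp2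
      have hs0 : 0 < s := by rw [hs]; positivity
      have hsσ : s ≤ σ := by
        rw [hs]; exact mul_le_of_le_one_right hσ0.le (pow_le_one₀ hr0.le hr1.le)
      have hs8 : s ≤ 1 / 8 := by linarith
      have hss : s ^ 2 ≤ s := by nlinarith only [hs0, hs8]
      have hci : 0 < (1 - c) ^ i := pow_pos (by linarith) i
      have hph := (mem_Cyl.1 hp).2.2.1
      have hsr : s / (1 - r) = s + s * r / (1 - r) := by field_simp; ring
      have hRsr : R * s / (1 - r) = R * s + R * (s * r) / (1 - r) := by field_simp; ring
      have hsr0 : 0 ≤ s * r / (1 - r) := by positivity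
      have hRsr0 : 0 ≤ R * (s * r) / (1 - r) := by positivity
      have hRs0 : 0 ≤ R * s := by positivity
      have hhs : hgt g p ≤ s := by
        have h1 := HP A hA g hgc hg u hu huc hpos (xprime p.1) p.2 (hgt g p) (by linarith)
          (by linarith) (by linarith [sq_nonneg (hgt g p)]) hph hp4
        rw [lift_hgt] at h1
        have h2 : u (Ebar g) * C = V * σ ^ γ := by rw [hV]; field_simp
        have h3 : u p * hgt g p ^ γ ≤ u p * (1 - c) ^ i * σ ^ γ := by
          have := mul_le_mul_of_nonneg_right hp5.le (pow_pos hσ0 γ).le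
          linarith
        rw [mul_assoc] at h3
        have h4 := le_of_mul_le_mul_left h3 (hpos p hp)
        have h5 : (1 - c) ^ i * σ ^ γ ≤ s ^ γ := by
          rw [hs, mul_pow, ← pow_mul, mul_comm i, pow_mul, mul_comm]
          exact mul_le_mul_of_nonneg_left (pow_le_pow_left₀ (by linarith) hrγ i) (by positivity)
        exact le_of_pow_le_pow_left₀ (by omega) hs0.le (h4.trans h5)
      have hbox : ∀ x t, ‖x - p.1‖ ≤ R * s → t ∈ Icc (p.2 - s ^ 2) p.2 →
          ‖xprime x‖ ≤ 3 / 4 - R * (s * r) / (1 - r) ∧ -(7 / 8) + s * r / (1 - r) ≤ t ∧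
          t ≤ 3 / 8 ∧ hgt g (x, t) ≤ 1 / 2 := by
        intro x t hx ht
        refine ⟨?_, by linarith [ht.1], by linarith [ht.2], ?_⟩
        · have h1 := (norm_xprime_sub_le x p.1).trans hx
          have h2 := norm_sub_norm_le (xprime x) (xprime p.1)
          linarith
        · have h1 := (abs_le.1 (hg.abs_hgt_sub_le_of hK (p := (x, t)) (q := p) hx hs0.le
            (by simp only; rw [abs_le]; constructor <;> linarith [ht.1, ht.2]))).2
          have h2 : (1 + K) * (R * s + s) ≤ (1 + K) * (R * σ + σ) := by gcongr
          linarith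
      by_contra hcon2
      push Not at hcon2
      have hVc : 0 < V / (1 - c) ^ (i + 1) := div_pos hV0 (pow_pos (by linarith) _)
      have hfin := HB A hA g hgc hg _ hw huc.neg p.1 p.2 s (V / (1 - c) ^ (i + 1)) hp hs0 hhs hVc.le
        ?_ ?_
      · have e : (1 - c) * (V / (1 - c) ^ (i + 1)) = V / (1 - c) ^ i := by
          rw [pow_succ]
          have : 1 - c ≠ 0 := by linarith
          field_simp
        have h1 : u p ≤ V / (1 - c) ^ i := by rw [← e]; simp only [Prod.mk.eta] at hfin; linarith
        rw [le_div_iff₀ hci] at h1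
        linarith
      · intro x t hx ht hxt
        obtain ⟨h1, h2, h3, h4⟩ := hbox x t hx ht
        rw [neg_le_neg_iff, le_div_iff₀ (pow_pos (by linarith) _)]
        have e : σ * r ^ (i + 1) = s * r := by rw [hs, pow_succ, mul_assoc]
        have := hcon2 (x, t) hxt
        rw [e] at this
        exact this h1 h2 h3 h4
      · intro x t hx ht hxt ε hε
        obtain ⟨h1, h2, h3, h4⟩ := hbox x t hx ht
        have h5 := hvan.tendsto hgc (p := (x, t)) (by simp only; linarith)
          (by simp only; rw [abs_lt]; constructor <;> linarith) (by linarith) hxt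
        filter_upwards [h5.eventually_lt_const hε] with y hy
        linarith
  obtain ⟨i, hi⟩ := exists_pow_lt_of_lt_one (show 0 < V / (|B| + 1) by positivity)
    (show 1 - c < 1 by linarith)
  obtain ⟨p, hp, hp1, hp2, hp3, hp4, hp5⟩ := key i
  have hs0 : 0 ≤ σ * r ^ i / (1 - r) := by positivity
  have hs1 : 0 ≤ R * (σ * r ^ i) / (1 - r) := by positivity
  have h1 := hB p hp (by linarith) (by rw [abs_le]; constructor <;> linarith) hp4
  rw [lt_div_iff₀ (by positivity)] at hi
  have h2 : u p * (1 - c) ^ i ≤ (|B| + 1) * (1 - c) ^ i :=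
    mul_le_mul_of_nonneg_right (by linarith [le_abs_self B]) (pow_nonneg (by linarith) _)
  linarith

end carleson

section iteration
variable {m : ℕ}

lemma SolvesL.add {A : Spc m → Matrix (Fin (m + 1)) (Fin (m + 1)) ℝ} {u v : Spc m × ℝ → ℝ}
    {Ω : Set (Spc m × ℝ)} (hu : SolvesL A u Ω) (hv : SolvesL A v Ω) :
    SolvesL A (fun q => u q + v q) Ω := by
  intro p hp
  obtain ⟨h1, h2⟩ := hu p hp
  obtain ⟨h3, h4⟩ := hv p hp
  refine ⟨h1.add h3, ?_⟩
  rw [Lop_eq _ _ _ h1] at h2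
  rw [Lop_eq _ _ _ h3] at h4
  rw [Lop_eq _ _ _ (h1.add h3), D2_add h1 h3, trF_add]
  exact h2.add h4

/-- Lower bounds for `w` in a parabolic cylinder below `(z', τ)`, with a better bound away from the
graph. -/
def LowerBounds (g : Spc' m → ℝ → ℝ) (w : Spc m × ℝ → ℝ) (z' : Spc' m) (τ δ M r a : ℝ) : Prop :=
  ∀ p : Spc m × ℝ, ‖xprime p.1 - z'‖ ≤ r → τ - r ^ 2 ≤ p.2 → p.2 ≤ τ → 0 < hgt g p → hgt g p ≤ r →
    -a ≤ w p ∧ (δ * r ≤ hgt g p → M * a ≤ w p)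

set_option maxHeartbeats 1000000 in
/-- The lower bounds improve on smaller cylinders. -/
theorem exists_improvement (m : ℕ) {lam Lam K : ℝ} (hlam : 0 < lam) (hLam : lam ≤ Lam)
    (hK : 0 ≤ K) :
    ∃ κ δ q M : ℝ, 0 < κ ∧ κ ≤ 1 / 8 ∧ 0 < δ ∧ δ ≤ 1 / 2 ∧ 0 ≤ q ∧ 0 < M ∧
      ∀ A : Spc m → Matrix (Fin (m + 1)) (Fin (m + 1)) ℝ, IsElliptic lam Lam A →
      ∀ g : Spc' m → ℝ → ℝ, Continuous (fun q : Spc' m × ℝ => g q.1 q.2) →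
      HolderSemi 1 (1 / 2) K g → ∀ w, SolvesL A w (Cyl g 1) → ContinuousOn w (Cyl g 1) →
      (∀ p, ‖xprime p.1‖ < 1 → |p.2| < 1 → hgt g p < 1 → p ∉ Cyl g 1 →
        ∀ ε > 0, ∀ᶠ q in 𝓝[Cyl g 1] p, -ε < w q) →
      ∀ z' τ r a, ‖z'‖ ≤ 1 / 2 → |τ| ≤ 1 / 4 → 0 < r → r ≤ 1 / 8 → 0 ≤ a →
      LowerBounds g w z' τ δ M r a → LowerBounds g w z' τ δ M ((1 - κ) * r) (q * a) := by
  obtain ⟨R, c, hR, hc0, hc1, HB⟩ := exists_boundary_decay m (Lam := Lam) hlam hK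
  obtain ⟨κ0, θ, C2, hκ0, hκ4, hθ, hθκ, hC2, H⟩ := exists_vertical_step m hlam hLam hK
  obtain ⟨κ, hκ⟩ : ∃ κ : ℝ, κ = κ0 / 2 := ⟨_, rfl⟩
  have hκp : 0 < κ := by linarith
  have hκ8 : κ ≤ 1 / 8 := by linarith
  have hC20 : 0 < C2 := by linarith
  obtain ⟨J, hJ⟩ := exists_pow_lt_of_lt_one (show 0 < 1 / (2 * C2) by positivity)
    (show 1 - c < 1 by linarith)
  have h1c : 0 ≤ 1 - c := by linarith
  have hJ' : 2 * C2 * (1 - c) ^ J ≤ 1 := by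
    rw [lt_div_iff₀ (by positivity)] at hJ; linarith
  obtain ⟨δ, hδ⟩ : ∃ δ : ℝ, δ = κ / ((J + 1) * (R + 1) * (1 + K)) := ⟨_, rfl⟩
  have hδ0 : 0 < δ := by rw [hδ]; positivity
  have hδe : δ * ((J + 1) * (R + 1) * (1 + K)) = κ := by rw [hδ]; field_simp
  have hJ0 : (0 : ℝ) ≤ J := Nat.cast_nonneg J
  have hδJ : δ * ((J + 1) * (R + 1)) ≤ κ := by
    rw [← hδe]
    exact mul_le_mul_of_nonneg_left (le_mul_of_one_le_right (by positivity) (by linarith)) hδ0.le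
  have hδL : δ * ((1 + K) * (R + 1)) ≤ κ := by
    rw [← hδe]
    refine mul_le_mul_of_nonneg_left ?_ hδ0.le
    rw [mul_assoc, mul_comm (R + 1)]
    exact le_mul_of_one_le_left (by positivity) (by linarith)
  have hδκ : δ ≤ κ := (le_mul_of_one_le_right hδ0.le (by nlinarith only [hK, hR])).trans hδL
  refine ⟨κ, δ, (1 - c) ^ J, 2 * C2, hκp, hκ8, hδ0, by linarith, by positivity, by positivity, ?_⟩
  intro A hA g hgc hg w hw hwc hbd z' τ r a hz hτ hr hr8 ha hyp
  have hτ' := abs_le.1 hτ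
  have hr2 : 0 < r ^ 2 := by positivity
  have hr64 : r ^ 2 ≤ 1 / 64 := by nlinarith only [hr, hr8]
  obtain ⟨s, hs⟩ : ∃ s : ℝ, s = δ * r := ⟨_, rfl⟩
  have hs0 : 0 < s := by rw [hs]; positivity
  have hsκ : s ≤ κ * r := by rw [hs]; exact mul_le_mul_of_nonneg_right hδκ hr.le
  have hs2 : s ^ 2 ≤ δ * r ^ 2 := by rw [hs]; nlinarith only [hδ0, hδκ, hκ8, hr2]
  have hM : ∀ b, 0 ≤ b → 0 ≤ 2 * C2 * b := fun b hb => by positivity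
  have hmem : ∀ p, ‖xprime p.1 - z'‖ ≤ r → τ - r ^ 2 ≤ p.2 → p.2 ≤ τ → hgt g p ≤ r →
      ‖xprime p.1‖ < 1 ∧ |p.2| < 1 ∧ hgt g p < 1 := by
    intro p h1 h2 h3 h4
    have h5 := norm_sub_norm_le (xprime p.1) z'
    refine ⟨by linarith, ?_, by linarith⟩
    rw [abs_lt]
    constructor <;> linarith
  have hCyl : ∀ p, ‖xprime p.1 - z'‖ ≤ r → τ - r ^ 2 ≤ p.2 → p.2 ≤ τ → 0 < hgt g p →
      hgt g p ≤ r → p ∈ Cyl g 1 := by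
    intro p h1 h2 h3 h4 h5
    obtain ⟨h6, h7, h8⟩ := hmem p h1 h2 h3 h5
    exact mem_Cyl.2 ⟨h6, by rwa [one_pow], h4, h8⟩
  have strip : ∀ j : ℕ, j ≤ J → ∀ p : Spc m × ℝ, ‖xprime p.1 - z'‖ ≤ r - j * (R * s) →
      τ - r ^ 2 + j * s ^ 2 ≤ p.2 → p.2 ≤ τ → 0 < hgt g p → hgt g p ≤ s →
      -((1 - c) ^ j * a) ≤ w p := by
    intro j
    induction j with
    | zero =>
      intro _ p h1 h2 h3 h4 h5
      rw [pow_zero, one_mul]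
      exact (hyp p (by simpa using h1) (by simpa using h2) h3 h4
        (by linarith [mul_le_of_le_one_left hr.le (by linarith : κ ≤ 1)])).1
    | succ j ih =>
      intro hj p h1 h2 h3 h4 h5
      push_cast at h1 h2
      have hRs : 0 ≤ R * s := by positivity
      have hjR : 0 ≤ (j : ℝ) * (R * s) := by positivity
      have hjs : 0 ≤ (j : ℝ) * s ^ 2 := by positivity
      have hs20 := sq_nonneg s
      have hbox : ∀ x t, ‖x - p.1‖ ≤ R * s → t ∈ Icc (p.2 - s ^ 2) p.2 →
          ‖xprime x - z'‖ ≤ r - j * (R * s) ∧ τ - r ^ 2 + j * s ^ 2 ≤ t ∧ t ≤ τ ∧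
            hgt g (x, t) ≤ r := by
        intro x t hx ht
        refine ⟨?_, by linarith [ht.1], by linarith [ht.2], ?_⟩
        · have h6 := (norm_xprime_sub_le x p.1).trans hx
          have h7 := norm_sub_le_norm_sub_add_norm_sub (xprime x) (xprime p.1) z'
          linarith
        · have h6 := (abs_le.1 (hg.abs_hgt_sub_le_of hK (p := (x, t)) (q := p) hx hs0.le
            (by simp only; rw [abs_le]; constructor <;> linarith [ht.1, ht.2]))).2
          have h7 : (1 + K) * (R * s + s) ≤ κ * r := by
            have := mul_le_mul_of_nonneg_right hδL hr.le
            rw [hs]; linarith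
          nlinarith only [h6, h7, h5, hsκ, hκ8, hr]
      have hfin := HB A hA g hgc hg w hw hwc p.1 p.2 s ((1 - c) ^ j * a)
        (hCyl p (by linarith) (by linarith) h3 h4
          (by linarith [mul_le_of_le_one_left hr.le (by linarith : κ ≤ 1)])) hs0 h5 (by positivity)
        ?_ ?_
      · rw [pow_succ]
        simp only [Prod.mk.eta] at hfin
        linarith
      · intro x t hx ht hxt
        obtain ⟨h6, h7, h8, h9⟩ := hbox x t hx ht
        have h10 := (mem_Cyl.1 hxt).2.2.1
        rcases le_total (hgt g (x, t)) s with h11 | h11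
        · exact ih (by omega) (x, t) h6 h7 h8 h10 h11
        · have h12 := (hyp (x, t) (by simp only; linarith) (by simp only; linarith) h8 h10 h9).2
            (by rwa [← hs])
          have h13 := hM a ha
          have h14 : 0 ≤ (1 - c) ^ j * a := by positivity
          linarith
      · intro x t hx ht hxt
        obtain ⟨h6, h7, h8, h9⟩ := hbox x t hx ht
        obtain ⟨h10, h11, h12⟩ := hmem (x, t) (by simp only; linarith) (by simp only; linarith) h8 h9
        exact hbd (x, t) h10 h11 h12 hxt
  intro p h1 h2 h3 h4 h5
  have hκr : 0 < κ * r := by positivity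
  have e2 : ((1 - κ) * r) ^ 2 ≤ r ^ 2 - κ * r ^ 2 := by
    nlinarith only [mul_nonneg (mul_nonneg hκp.le (by linarith : 0 ≤ 1 - κ)) hr2.le]
  have hκr2 : 0 < κ * r ^ 2 := by positivity
  have hr' : (1 - κ) * r = r - κ * r := by ring
  rw [hr'] at h1 h5
  have hyp1 := hyp p (by linarith) (by linarith) h3 h4 (by linarith)
  refine ⟨?_, fun h6 => ?_⟩
  · rcases le_total (hgt g p) s with h7 | h7
    · refine strip J le_rfl p (h1.trans ?_) (le_trans ?_ h2) h3 h4 h7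
      · have : (J : ℝ) * (R * s) ≤ κ * r := by
          have h8 := mul_le_mul_of_nonneg_right hδJ hr.le
          have h9 : 0 ≤ δ * r * (J + R + 1) := by positivity
          rw [hs]; nlinarith only [h8, h9]
        linarith
      · have : (J : ℝ) * s ^ 2 ≤ κ * r ^ 2 := by
          have h8 := mul_le_mul_of_nonneg_right hδJ hr2.le
          have h9 := mul_le_mul_of_nonneg_left hs2 hJ0
          have h10 : 0 ≤ δ * r ^ 2 * (J * R + R + 1) := by positivity
          nlinarith only [h8, h9, h10]
        linarith
    · have h8 := hyp1.2 (by rwa [← hs])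
      have h9 := hM a ha
      have h10 : 0 ≤ (1 - c) ^ J * a := by positivity
      linarith
  · have hgoal : 2 * C2 * ((1 - c) ^ J * a) ≤ a := by
      rw [← mul_assoc]; exact mul_le_of_le_one_left ha hJ'
    rcases le_total s (hgt g p) with h7 | h7
    · have h8 := hyp1.2 (by rwa [← hs])
      have h9 : a ≤ 2 * C2 * a := le_mul_of_one_le_left ha (by linarith)
      linarith
    obtain ⟨h, hh⟩ : ∃ h : ℝ, h = hgt g p := ⟨_, rfl⟩
    rw [← hh] at h4 h5 h6 h7
    have hhs2 : h ^ 2 ≤ s ^ 2 := pow_le_pow_left₀ h4.le h7 2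
    have hθh : θ * h ^ 2 ≤ κ * (κ * r ^ 2) := by
      refine mul_le_mul (by linarith) ?_ (sq_nonneg h) hκp.le
      exact (hhs2.trans hs2).trans (mul_le_mul_of_nonneg_right hδκ hr2.le)
    have hθh2 : θ * h ^ 2 ≤ 1 / 8 * (κ * r ^ 2) :=
      hθh.trans (mul_le_mul_of_nonneg_right hκ8 hκr2.le)
    have hθ0 : 0 < θ * h ^ 2 := by positivity
    have hsr : s ≤ 1 / 8 * r := hsκ.trans (mul_le_mul_of_nonneg_right hκ8 hr.le)
    have hw' : SolvesL A (fun q => a + 1 * w q) (Cyl g 1) := hw.const_add_mul a 1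
    have hstep := H A hA g hgc hg _ hw' (continuousOn_const.add (continuousOn_const.mul hwc))
      (xprime p.1) (p.2 - θ * h ^ 2) h ((1 + κ0) * h) h h4
      (by nlinarith only [h4, hκ0]) le_rfl le_rfl (by nlinarith only [h4, hκ0]) ?_
    · rw [sub_add_cancel, hh, lift_hgt, ← hh] at hstep
      have hQ := (hyp (lift g (xprime p.1) (p.2 - θ * h ^ 2) ((1 + κ0) * h))
        (by rw [xprime_lift]; linarith) (by rw [lift_snd]; linarith) (by rw [lift_snd]; linarith)
        (by rw [hgt_lift]; positivity)
        (by rw [hgt_lift]; nlinarith only [h7, hκ4, hsr, h4])).2 (by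
          rw [hgt_lift]
          have h8 : (1 + κ0) * (1 - κ) * (δ * r) ≤ (1 + κ0) * h := by
            rw [mul_assoc]
            exact mul_le_mul_of_nonneg_left (by linarith) (by linarith)
          refine le_trans (le_mul_of_one_le_left (by positivity) ?_) h8
          nlinarith only [hκ, hκ4, hκ0])
      have h9 : C2 * a ≤ C2 * w p := by nlinarith only [hstep, hQ, hC2, ha]
      have h10 := le_of_mul_le_mul_left h9 hC20
      linarith
    · intro q hq1 hq2 hq3 hq4
      have hq2' := abs_le.1 hq2
      have h8 := norm_sub_le_norm_sub_add_norm_sub (xprime q.1) (xprime p.1) z'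
      have a1 : ‖xprime q.1 - z'‖ ≤ r := by linarith
      have a2 : τ - r ^ 2 ≤ q.2 := by linarith
      have a3 : q.2 ≤ τ := by linarith
      have a4 : 0 < hgt g q := by linarith
      have a5 : hgt g q ≤ r := by linarith
      exact ⟨hCyl q a1 a2 a3 a4 a5, by linarith [(hyp q a1 a2 a3 a4 a5).1]⟩

end iteration

section boundaryHarnack
variable {m : ℕ} {g : Spc' m → ℝ → ℝ}

/-- Iterating the improvement of lower bounds gives nonnegativity. -/
lemma nonneg_of_lowerBounds_improve {w : Spc m × ℝ → ℝ} {κ δ q M a : ℝ} (hκ : 0 < κ)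
    (hκ8 : κ ≤ 1 / 8) (hδ : δ ≤ 1 / 2) (hq : 0 ≤ q) (hM : 0 < M) (ha : 0 ≤ a)
    {p : Spc m × ℝ}
    (himp : ∀ r b, 0 < r → r ≤ 1 / 8 → 0 ≤ b → LowerBounds g w (xprime p.1) p.2 δ M r b →
      LowerBounds g w (xprime p.1) p.2 δ M ((1 - κ) * r) (q * b))
    (hbase : LowerBounds g w (xprime p.1) p.2 δ M (1 / 8) a)
    (hp0 : 0 < hgt g p) (hp8 : hgt g p ≤ 1 / 8) : 0 ≤ w p := by
  have hκ1 : 0 < 1 - κ := by linarith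
  have hpow : ∀ i : ℕ, 0 < (1 - κ) ^ i * (1 / 8) := fun i => by positivity
  have hLB : ∀ i : ℕ,
      LowerBounds g w (xprime p.1) p.2 δ M ((1 - κ) ^ i * (1 / 8)) (q ^ i * a) := by
    intro i
    induction i with
    | zero => simpa only [pow_zero, one_mul] using hbase
    | succ i ih =>
      have h1 : (1 - κ) ^ i ≤ 1 := pow_le_one₀ hκ1.le (by linarith)
      have := himp _ _ (hpow i) (by linarith) (by positivity) ih
      rwa [← mul_assoc, ← mul_assoc, ← pow_succ', ← pow_succ'] at this
  have hex : ∃ i : ℕ, (1 - κ) ^ i * (1 / 8) < hgt g p := by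
    obtain ⟨i, hi⟩ := exists_pow_lt_of_lt_one hp0 (show 1 - κ < 1 by linarith)
    exact ⟨i, by linarith [pow_pos hκ1 i]⟩
  obtain ⟨i, hi⟩ : ∃ i, i + 1 = Nat.find hex := by
    refine ⟨Nat.find hex - 1, Nat.sub_add_cancel (Nat.one_le_iff_ne_zero.2 fun h => ?_)⟩
    have := Nat.find_spec hex
    rw [h, pow_zero, one_mul] at this
    linarith
  have h1 : hgt g p ≤ (1 - κ) ^ i * (1 / 8) := not_lt.1 (Nat.find_min hex (by omega))
  have h2 : (1 - κ) ^ (i + 1) * (1 / 8) < hgt g p := by rw [hi]; exact Nat.find_spec hex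
  have h3 : δ * ((1 - κ) ^ i * (1 / 8)) ≤ hgt g p := by
    refine le_trans ?_ h2.le
    rw [pow_succ', mul_assoc]
    exact mul_le_mul_of_nonneg_right (by linarith) (hpow i).le
  have h4 := (hLB i p (by rw [sub_self, norm_zero]; exact (hpow i).le)
    (by linarith [sq_nonneg ((1 - κ) ^ i * (1 / 8))]) le_rfl hp0 h1).2 h3
  exact le_trans (by positivity) h4

end boundaryHarnack

end estimates

/-- **Boundary Harnack principle in `C^{1,1/2}` domains** (Theorem 1.1). -/
theorem boundary_harnack_C1_half (m : ℕ) (hm : 1 ≤ m) (lam Lam K : ℝ)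
    (hlam : 0 < lam) (hlamLam : lam ≤ Lam) (hK : 0 < K) :
    ∃ C : ℝ, 0 < C ∧
      ∀ (A : Spc m → Matrix (Fin (m + 1)) (Fin (m + 1)) ℝ), IsElliptic lam Lam A →
      ∀ g : Spc' m → ℝ → ℝ,
        Continuous (fun q : Spc' m × ℝ => g q.1 q.2) → g 0 0 = 0 →
        HolderSemi 1 (1 / 2) K g →
      ∀ u v : Spc m × ℝ → ℝ,
        SolvesL A u (Cyl g 1) → SolvesL A v (Cyl g 1) →
        (∀ p ∈ Cyl g 1, 0 < u p) → (∀ p ∈ Cyl g 1, 0 < v p) →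
        VanishesOn u (Cyl g 1) (graphSet g) →
        ∀ p ∈ Cyl g (1 / 2), u p / v p ≤ C * (u (Ebar g) / v (Eund g)) := by
  obtain ⟨κ, δ, q, M, hκ, hκ8, hδ, hδ2, hq, hM, Himp⟩ := exists_improvement m hlam hlamLam hK.le
  obtain ⟨M0, hM0, Hcar⟩ := exists_carleson m hlam hlamLam hK.le
  obtain ⟨Cδ, hCδ, Hch⟩ := exists_chain m (δ := δ / 8) (τ := 15 / 64) hlam hlamLam hK.le
    (by positivity) (by norm_num)
  refine ⟨(M + 1) * M0 * Cδ, by positivity, fun A hA g hgc _ hg u v hu hv hu0 hv0 hvan p hp => ?_⟩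
  have hcont : ∀ f : Spc m × ℝ → ℝ, SolvesL A f (Cyl g 1) → (∀ p ∈ Cyl g 1, 0 < f p) →
      ContinuousOn f (Cyl g 1) := fun f hf hf0 p hp =>
    (hf.continuousAt hlam hA (isOpen_Cyl hgc 1) (fun q hq => (hf0 q hq).le)
      hp).continuousWithinAt
  have huc := hcont u hu hu0
  have hvc := hcont v hv hv0
  have hlift : ∀ t : ℝ, |t| < 1 → lift g 0 t (1 / 2) ∈ Cyl g 1 := fun t ht => by
    rw [mem_Cyl, xprime_lift, hgt_lift, lift_snd, norm_zero]
    norm_num [ht]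
  have hU : 0 < u (Ebar g) := hu0 _ (hlift (1 / 2) (by norm_num [abs_lt]))
  have hV : 0 < v (Eund g) := hv0 _ (hlift (-(1 / 2)) (by norm_num [abs_lt]))
  obtain ⟨U, hUe⟩ : ∃ U, U = u (Ebar g) := ⟨_, rfl⟩
  obtain ⟨V, hVe⟩ : ∃ V, V = v (Eund g) := ⟨_, rfl⟩
  rw [← hUe] at hU ⊢
  rw [← hVe] at hV ⊢
  obtain ⟨p1, p2, p3, p4⟩ := mem_Cyl.1 hp
  have p2' := abs_lt.1 p2
  have hpC : p ∈ Cyl g 1 := mem_Cyl.2 ⟨by linarith, by rw [one_pow]; linarith, p3, by linarith⟩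
  have hvlow : ∀ z, ‖xprime z.1‖ ≤ 5 / 8 → -(17 / 64) ≤ z.2 → z.2 ≤ 1 / 4 → δ / 8 ≤ hgt g z →
      hgt g z ≤ 1 / 2 → (M + 1) * M0 ≤ (M + 1) * M0 * Cδ / V * v z := by
    intro z h1 h2 h3 h4 h5
    have := Hch A hA g hgc hg v hv hvc (fun q hq => (hv0 q hq).le) 0 (xprime z.1) (-(1 / 2)) z.2
      (1 / 2) (hgt g z) (by rw [norm_zero]; norm_num) (by linarith) (by norm_num) (by linarith)
      (by linarith) (by linarith) le_rfl h4 h5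
    rw [lift_hgt, show lift g 0 (-(1 / 2)) (1 / 2) = Eund g from rfl, ← hVe] at this
    rw [div_mul_eq_mul_div, le_div_iff₀ hV, mul_assoc ((M + 1) * M0)]
    exact mul_le_mul_of_nonneg_left this (by positivity)
  have hup : ∀ z ∈ Cyl g 1, ‖xprime z.1‖ ≤ 5 / 8 → -(5 / 8) ≤ z.2 → z.2 ≤ 3 / 8 →
      hgt g z ≤ 1 / 2 → 1 / U * u z ≤ M0 := by
    intro z hz h1 h2 h3 h4
    have := Hcar A hA g hgc hg u hu huc hu0 hvan z hz h1 h2 h3 h4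
    rw [← hUe] at this
    rwa [one_div_mul_eq_div, div_le_iff₀ hU]
  have key : 1 / U * u p ≤ (M + 1) * M0 * Cδ / V * v p := by
    rcases lt_or_ge (1 / 8) (hgt g p) with h8 | h8
    · have h1 := hvlow p (by linarith) (by linarith) (by linarith) (by linarith) p4.le
      have h2 := hup p hpC (by linarith) (by linarith) (by linarith) p4.le
      have h3 : 0 < M * M0 := by positivity
      linarith
    obtain ⟨w, hw⟩ : ∃ w : Spc m × ℝ → ℝ,
        w = fun z => (0 + (M + 1) * M0 * Cδ / V * v z) + (0 + -(1 / U) * u z) := ⟨_, rfl⟩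
    have hwz : ∀ z, w z = (M + 1) * M0 * Cδ / V * v z - 1 / U * u z := fun z => by
      rw [hw]; ring
    have hws : SolvesL A w (Cyl g 1) := by
      rw [hw]; exact (hv.const_add_mul _ _).add (hu.const_add_mul _ _)
    have hwc : ContinuousOn w (Cyl g 1) := by
      rw [hw]
      exact (continuousOn_const.add (continuousOn_const.mul hvc)).add
        (continuousOn_const.add (continuousOn_const.mul huc))
    have hvpos : ∀ z ∈ Cyl g 1, 0 ≤ (M + 1) * M0 * Cδ / V * v z := fun z hz =>
      mul_nonneg (by positivity) (hv0 z hz).le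
    have hbd : ∀ z : Spc m × ℝ, ‖xprime z.1‖ < 1 → |z.2| < 1 → hgt g z < 1 → z ∉ Cyl g 1 →
        ∀ ε > 0, ∀ᶠ q in nhdsWithin z (Cyl g 1), -ε < w q := by
      intro z h1 h2 h3 h4 ε hε
      filter_upwards [(hvan.tendsto hgc h1 h2 h3 h4).eventually_lt_const (mul_pos hε hU),
        self_mem_nhdsWithin] with y hy hyC
      have h5 : 1 / U * u y < ε := by rwa [one_div_mul_eq_div, div_lt_iff₀ hU]
      have := hvpos y hyC
      rw [hwz]; linarith
    have h0 := nonneg_of_lowerBounds_improve (w := w) hκ hκ8 hδ2 hq hM hM0.le (p := p)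
      (fun r b hr hr8 hb h => Himp A hA g hgc hg w hws hwc hbd _ _ r b p1.le
        (by rw [show ((1 : ℝ) / 2) ^ 2 = 1 / 4 by norm_num] at p2; exact p2.le) hr hr8 hb h)
      ?_ p3 h8
    · rw [hwz] at h0; linarith
    · intro z h1 h2 h3 h4 h5
      have h6 : ‖xprime z.1‖ ≤ 5 / 8 := by
        have := norm_sub_norm_le (xprime z.1) (xprime p.1)
        linarith
      have hzC : z ∈ Cyl g 1 := by
        refine mem_Cyl.2 ⟨by linarith, ?_, h4, by linarith⟩
        rw [abs_lt]; constructor <;> linarith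
      have h7 := hup z hzC h6 (by linarith) (by linarith) (by linarith)
      refine ⟨?_, fun h9 => ?_⟩
      · have := hvpos z hzC
        rw [hwz]; linarith
      · have := hvlow z h6 (by linarith) (by linarith) (by linarith) (by linarith)
        rw [hwz]; linarith
  rw [one_div_mul_eq_div, div_mul_eq_mul_div, div_le_div_iff₀ hU hV] at key
  rw [← mul_div_assoc, div_le_div_iff₀ (hv0 p hpC) hV]
  linarith
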